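/- For every integer n > 2 there exist a constant c = c(n) and an absolute constant κ such that the following holds. Let f ∈ ℤ[x_0,…,x_n] be a homogeneous polynomial of degree 4 that is irreducible in ℚ[x_0,…,x_n], and let X ⊂ ℙ^n_ℚ be the hypersurface f = 0. Then for every real H ≥ 2, the number of rational points of X of height at most H is at most c·H^{n−1}·(log H)^κ. -/

import Mathlib

namespace DG
open MvPolynomial

lemma totalDegree_det_le {σ : Type*} {m : ℕ} (M : Matrix (Fin m) (Fin m) (MvPolynomial σ ℚ)) (e : ℕ)
    (h : ∀ i j, (M i j).totalDegree ≤ e) : M.det.totalDegree ≤ m * e := by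
  rw [Matrix.det_apply]
  refine totalDegree_finsetSum_le ?_
  intro s _
  refine (totalDegree_smul_le _ _).trans ?_
  refine (totalDegree_finsetProd _ _).trans ?_
  refine (Finset.sum_le_sum (fun i _ => h _ _)).trans ?_
  simp

lemma isCoprime_of_irreducible {R K : Type*} [CommRing R] [IsDomain R] [UniqueFactorizationMonoid R]
    [Field K] [Algebra R K] [IsFractionRing R K]
    (P Q : Polynomial R) (hP : Irreducible P) (hdeg : P.natDegree ≠ 0) (hd : ¬ P ∣ Q) :
    IsCoprime (P.map (algebraMap R K)) (Q.map (algebraMap R K)) := by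
  have hprim : P.IsPrimitive := hP.isPrimitive hdeg
  have hirr : Irreducible (P.map (algebraMap R K)) := by
    classical
    let _ : NormalizedGCDMonoid R := Classical.choice inferInstance
    exact (hprim.irreducible_iff_irreducible_map_fraction_map).1 hP
  rw [hirr.coprime_iff_not_dvd]
  rintro ⟨S, hS⟩
  obtain ⟨b, hb, hbS⟩ := IsLocalization.integerNormalization_spec (nonZeroDivisors R) S
  set S' := IsLocalization.integerNormalization (nonZeroDivisors R) S
  have hb0 : b ≠ 0 := nonZeroDivisors.ne_zero hb
  have key : Polynomial.C b * Q = P * S' := by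
    apply Polynomial.map_injective (algebraMap R K) (IsFractionRing.injective R K)
    have : S'.map (algebraMap R K) = Polynomial.C (algebraMap R K b) * S := by
      rw [hbS]
      ext n
      simp [Algebra.smul_def]
    rw [Polynomial.map_mul, Polynomial.map_mul, hS, this, Polynomial.map_C]; ring
  have hprime : Prime P := hP.prime
  rcases hprime.dvd_or_dvd (Dvd.intro _ key.symm) with h | h
  · have := Polynomial.natDegree_le_of_dvd h (by simpa using hb0)
    simp at this; exact hdeg this
  · exact hd h

lemma totalDegree_resultant_le {σ : Type*} (P Q : Polynomial (MvPolynomial σ ℚ)) (d e : ℕ)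
    (hd : P.natDegree ≤ d) (he : Q.natDegree ≤ e)
    (hP : ∀ i, (P.coeff i).totalDegree ≤ d) (hQ : ∀ i, (Q.coeff i).totalDegree ≤ e) :
    (Polynomial.resultant P Q).totalDegree ≤ (d + e) ^ 2 := by
  have := totalDegree_det_le (Polynomial.sylvester P Q P.natDegree Q.natDegree) (d + e) (by
    intro i j
    simp only [Polynomial.sylvester, Matrix.of_apply]
    refine Fin.addCases (fun j => ?_) (fun j => ?_) j
    · simp only [Fin.addCases_left]
      split_ifs
      · exact (hQ _).trans (by omega)
      · simp
    · simp only [Fin.addCases_right]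
      split_ifs
      · exact (hP _).trans (by omega)
      · simp)
  refine this.trans ?_
  rw [pow_two]; gcongr

lemma elim0 {k : ℕ} (F G : MvPolynomial (Fin (k+1)) ℚ) (d e : ℕ) (hF : Irreducible F)
    (hFG : ¬ F ∣ G) (hd : F.totalDegree ≤ d) (he : G.totalDegree ≤ e) :
    ∃ r : MvPolynomial (Fin k) ℚ, r ≠ 0 ∧ r.totalDegree ≤ (d + e) ^ 2 ∧
      ∀ x : Fin (k+1) → ℚ, eval x F = 0 → eval x G = 0 → eval (fun j => x j.succ) r = 0 := by
  set P := finSuccEquiv ℚ k F with hPdef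
  set Q := finSuccEquiv ℚ k G with hQdef
  have hcoe : ∀ (A : MvPolynomial (Fin (k+1)) ℚ) i, ((finSuccEquiv ℚ k A).coeff i).totalDegree ≤ A.totalDegree := by
    intro A i
    by_cases h : (finSuccEquiv ℚ k A).coeff i = 0
    · simp [h]
    · have := totalDegree_coeff_finSuccEquiv_add_le A i h
      omega
  have hev : ∀ (A : MvPolynomial (Fin (k+1)) ℚ) (x : Fin (k+1) → ℚ), eval x A =
      Polynomial.eval (x 0) (Polynomial.map (eval (fun j => x j.succ)) (finSuccEquiv ℚ k A)) := by
    intro A x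
    rw [← eval_eq_eval_mv_eval']
    congr 1
    congr 1
    funext j
    refine Fin.cases ?_ (fun j => ?_) j <;> simp
  have hPirr : Irreducible P := (MulEquiv.irreducible_iff (finSuccEquiv ℚ k)).2 hF
  have hPQ : ¬ P ∣ Q := fun h => hFG ((map_dvd_iff (finSuccEquiv ℚ k)).1 h)
  have hPd : P.natDegree ≤ F.totalDegree := by
    rw [hPdef, natDegree_finSuccEquiv]; exact degreeOf_le_totalDegree _ _
  have hQd : Q.natDegree ≤ G.totalDegree := by
    rw [hQdef, natDegree_finSuccEquiv]; exact degreeOf_le_totalDegree _ _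
  by_cases h0 : P.natDegree = 0
  · refine ⟨P.coeff 0, ?_, ?_, ?_⟩
    · intro h
      apply hPirr.ne_zero
      rw [Polynomial.eq_C_of_natDegree_eq_zero h0, h, map_zero]
    · refine (hcoe F 0).trans (hd.trans ?_)
      have : d ≤ d^2 := Nat.le_self_pow (by norm_num) d
      refine this.trans ?_
      gcongr; omega
    · intro x hx _
      rw [hev, ← hPdef, Polynomial.eq_C_of_natDegree_eq_zero h0] at hx
      simpa using hx
  · refine ⟨Polynomial.resultant P Q, ?_, ?_, ?_⟩
    · have hc := isCoprime_of_irreducible (K := FractionRing (MvPolynomial (Fin k) ℚ)) P Q hPirr h0 hPQ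
      have := Polynomial.resultant_ne_zero _ _ hc
      intro h
      apply this
      have hinj := IsFractionRing.injective (MvPolynomial (Fin k) ℚ) (FractionRing (MvPolynomial (Fin k) ℚ))
      rw [Polynomial.natDegree_map_eq_of_injective hinj, Polynomial.natDegree_map_eq_of_injective hinj,
        Polynomial.resultant_map_map, h, map_zero]
    · exact totalDegree_resultant_le P Q d e (hPd.trans hd) (hQd.trans he)
        (fun i => (hcoe F i).trans hd) (fun i => (hcoe G i).trans he)
    · intro x hx hy
      obtain ⟨p, q, -, -, hpq⟩ := Polynomial.exists_mul_add_mul_eq_C_resultant P Q le_rfl le_rfl (Or.inl h0)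
      rw [hev] at hx hy
      have := congrArg (fun A => Polynomial.eval (x 0) (Polynomial.map (eval (fun j => x j.succ)) A)) hpq
      simp only [Polynomial.map_add, Polynomial.map_mul, Polynomial.eval_add, Polynomial.eval_mul,
        Polynomial.map_C, Polynomial.eval_C] at this
      rw [← this, hx, hy]; simp

lemma elim {k : ℕ} (i : Fin (k+1)) (F G : MvPolynomial (Fin (k+1)) ℚ) (d e : ℕ) (hF : Irreducible F)
    (hFG : ¬ F ∣ G) (hd : F.totalDegree ≤ d) (he : G.totalDegree ≤ e) :
    ∃ r : MvPolynomial (Fin k) ℚ, r ≠ 0 ∧ r.totalDegree ≤ (d + e) ^ 2 ∧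
      ∀ x : Fin (k+1) → ℚ, eval x F = 0 → eval x G = 0 → eval (fun j => x (i.succAbove j)) r = 0 := by
  let s : Fin (k+1) ≃ Fin (k+1) := (finSuccEquiv' 0).trans (finSuccEquiv' i).symm
  obtain ⟨r, hr0, hrd, hr⟩ := elim0 (rename s.symm F) (rename s.symm G) d e
    ((MulEquiv.irreducible_iff (renameEquiv ℚ s.symm)).2 hF)
    (fun h => hFG ((map_dvd_iff (renameEquiv ℚ s.symm)).1 h))
    ((totalDegree_rename_le _ _).trans hd) ((totalDegree_rename_le _ _).trans he)
  refine ⟨r, hr0, hrd, fun x hx hy => ?_⟩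
  have hc : (x ∘ s) ∘ s.symm = x := by funext j; simp
  have := hr (x ∘ s) (by rw [eval_rename, hc, hx]) (by rw [eval_rename, hc, hy])
  convert this using 3
  funext j
  have : (finSuccEquiv' (0 : Fin (k+1))) j.succ = some j := by
    have := finSuccEquiv'_succAbove (0 : Fin (k+1)) j
    rwa [Fin.succAbove_zero] at this
  simp [s, this]

lemma zeros_box_le {k : ℕ} (r : MvPolynomial (Fin (k+1)) ℚ) (hr : r ≠ 0) (T : Finset ℚ)
    (S : Finset (Fin (k+1) → ℚ)) (hS : ∀ x ∈ S, eval x r = 0 ∧ ∀ i, x i ∈ T) :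
    S.card ≤ r.totalDegree * T.card ^ k := by
  classical
  rcases S.eq_empty_or_nonempty with rfl | hne
  · simp
  obtain ⟨x0, hx0⟩ := hne
  have hT : 0 < T.card := Finset.card_pos.2 ⟨_, (hS x0 hx0).2 0⟩
  have h := schwartz_zippel_totalDegree hr T
  have hsub : S ⊆ {f ∈ Fintype.piFinset fun _ : Fin (k+1) ↦ T | eval f r = 0} := by
    intro x hx
    simp [hS x hx]
  have hle := Finset.card_le_card hsub
  have hT' : (0 : ℚ≥0) < T.card := by exact_mod_cast hT
  rw [div_le_div_iff₀ (by positivity) hT', pow_succ, ← mul_assoc] at h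
  have h' := le_of_mul_le_mul_right h hT'
  have h'' : (Finset.card {f ∈ Fintype.piFinset fun _ : Fin (k+1) ↦ T | eval f r = 0}) ≤ r.totalDegree * T.card ^ k := by
    exact_mod_cast h'
  exact hle.trans h''

lemma zeros_line_le (r : MvPolynomial (Fin 1) ℚ) (hr : r ≠ 0) (T : Finset ℚ)
    (hT : ∀ t ∈ T, eval (fun _ => t) r = 0) : T.card ≤ r.totalDegree := by
  classical
  have := zeros_box_le r hr T (T.image (fun t => (fun _ : Fin 1 => t))) (by
    intro x hx
    obtain ⟨t, ht, rfl⟩ := Finset.mem_image.1 hx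
    exact ⟨hT t ht, fun _ => ht⟩)
  rw [Finset.card_image_of_injective] at this
  · simpa using this
  · intro a b h; exact congrFun h 0

/-- Bezout bound in the plane. -/
lemma bezout (F G : MvPolynomial (Fin 2) ℚ) (d e : ℕ) (hF : Irreducible F)
    (hFG : ¬ F ∣ G) (hd : F.totalDegree ≤ d) (he : G.totalDegree ≤ e) (S : Finset (Fin 2 → ℚ))
    (hS : ∀ x ∈ S, eval x F = 0 ∧ eval x G = 0) : S.card ≤ (d + e) ^ 4 := by
  classical
  have key : ∀ i : Fin 2, (S.image (fun x => x i)).card ≤ (d+e)^2 := by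
    intro i
    obtain ⟨j, hj⟩ : ∃ j : Fin 2, ∀ l : Fin 1, j.succAbove l = i := by
      fin_cases i
      · exact ⟨1, by decide⟩
      · exact ⟨0, by decide⟩
    obtain ⟨r, hr0, hrd, hr⟩ := elim j F G d e hF hFG hd he
    refine (zeros_line_le r hr0 _ ?_).trans hrd
    intro t ht
    obtain ⟨x, hx, rfl⟩ := Finset.mem_image.1 ht
    have := hr x (hS x hx).1 (hS x hx).2
    simpa [hj] using this
  have hsub : S ⊆ Fintype.piFinset (fun i => S.image (fun x => x i)) := by
    intro x hx
    rw [Fintype.mem_piFinset]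
    intro i
    exact Finset.mem_image_of_mem _ hx
  refine (Finset.card_le_card hsub).trans ?_
  rw [Fintype.card_piFinset, Fin.prod_univ_two]
  calc _ ≤ (d+e)^2 * (d+e)^2 := Nat.mul_le_mul (key 0) (key 1)
    _ = _ := by ring
end DG


namespace DG

section
attribute [local instance] Matrix.seminormedAddCommGroup

lemma siegel_nat {m s : ℕ} (A : Matrix (Fin m) (Fin s) ℤ) (hms : m < s) (Y : ℕ) (hY : 1 ≤ Y)
    (hA : ∀ i j, |A i j| ≤ Y) :
    ∃ t : Fin s → ℤ, t ≠ 0 ∧ A.mulVec t = 0 ∧ ∀ i, |t i| ≤ ((s * Y) ^ s : ℕ) := by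
  have hs : 1 ≤ s := by omega
  rcases Nat.eq_zero_or_pos m with rfl | hm
  · refine ⟨fun _ => 1, fun h => ?_, Subsingleton.elim _ _, fun i => ?_⟩
    · have := congrFun h ⟨0, hs⟩
      simp at this
    · have : 1 ≤ (s * Y)^s := Nat.one_le_pow _ _ (Nat.mul_pos hs hY)
      simpa using (by exact_mod_cast this : (1:ℤ) ≤ (((s * Y)^s : ℕ) : ℤ))
  · obtain ⟨t, ht0, htA, htn⟩ := Int.Matrix.exists_ne_zero_int_vec_norm_le A (by simpa using hms) (by simpa using hm)
    refine ⟨t, ht0, htA, fun i => ?_⟩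
    simp only [Fintype.card_fin] at htn
    have hAn : max 1 ‖A‖ ≤ (Y : ℝ) := by
      apply max_le (by exact_mod_cast hY)
      rw [Matrix.norm_le_iff (by positivity)]
      intro i j
      rw [Int.norm_eq_abs]
      exact_mod_cast hA i j
    have h1 : (1:ℝ) ≤ (s:ℝ) * Y := by exact_mod_cast Nat.mul_pos hs hY
    have hsm : (1 : ℝ) ≤ (s:ℝ) - m := by
      have : (m:ℝ) + 1 ≤ s := by exact_mod_cast hms
      linarith
    have h2 : ‖t‖ ≤ ((s:ℝ) * Y) ^ s := by
      refine htn.trans ?_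
      calc ((s:ℝ) * max 1 ‖A‖) ^ ((m:ℝ) / (s - m)) ≤ ((s:ℝ) * Y) ^ ((m:ℝ) / (s - m)) := by
            apply Real.rpow_le_rpow (by positivity) (by gcongr) (by positivity)
        _ ≤ ((s:ℝ) * Y) ^ (s : ℝ) := by
            apply Real.rpow_le_rpow_of_exponent_le h1
            rw [div_le_iff₀ (by linarith)]
            have : (m:ℝ) ≤ s := by exact_mod_cast hms.le
            nlinarith
        _ = _ := Real.rpow_natCast _ _
    have h3 := (norm_le_pi_norm t i).trans h2
    rw [Int.norm_eq_abs] at h3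
    exact_mod_cast h3
end

lemma height_fin {X : Type*} {s : ℕ} (φ : Fin s → X → ℤ) (S : Set X) (Y : ℕ) (hY : 1 ≤ Y)
    (hb : ∀ i, ∀ x ∈ S, |φ i x| ≤ Y) (a : Fin s → ℚ) (ha : a ≠ 0)
    (hv : ∀ x ∈ S, ∑ i, a i * φ i x = 0) :
    ∃ b : Fin s → ℤ, b ≠ 0 ∧ (∀ i, |b i| ≤ ((s * Y) ^ s : ℕ)) ∧ ∀ x ∈ S, ∑ i, b i * φ i x = 0 := by
  let row : X → (Fin s → ℚ) := fun x i => φ i x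
  obtain ⟨f, hf, hspan, hli⟩ := Submodule.exists_fun_fin_finrank_span_eq ℚ (row '' S)
  generalize hm : Module.finrank ℚ (Submodule.span ℚ (row '' S)) = m at f hf hspan hli
  let Λ : (Fin s → ℚ) →ₗ[ℚ] ℚ := Fintype.linearCombination ℚ a
  have hΛ : ∀ v, Λ v = ∑ i, v i * a i := fun v => by simp [Λ, Fintype.linearCombination_apply]
  have hms : m < s := by
    have hle : Submodule.span ℚ (row '' S) ≤ LinearMap.ker Λ := by
      rw [Submodule.span_le]
      rintro _ ⟨x, hx, rfl⟩
      simp only [SetLike.mem_coe, LinearMap.mem_ker, hΛ]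
      rw [← hv x hx]
      exact Finset.sum_congr rfl fun i _ => mul_comm _ _
    have hne : Submodule.span ℚ (row '' S) ≠ ⊤ := by
      intro h
      rw [h, top_le_iff, LinearMap.ker_eq_top] at hle
      apply ha
      funext i
      have := hΛ (Pi.single i 1)
      rw [hle] at this
      simpa [Pi.single_apply] using this.symm
    have := Submodule.finrank_lt hne
    rw [hm] at this
    simpa using this
  choose p hpS hp using hf
  obtain ⟨t, ht0, htA, htn⟩ := siegel_nat (Matrix.of fun i j => φ j (p i)) hms Y hY
    (fun i j => hb j _ (hpS i))
  refine ⟨t, ht0, htn, fun x hx => ?_⟩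
  let T : (Fin s → ℚ) →ₗ[ℚ] ℚ := Fintype.linearCombination ℚ (fun i => (t i : ℚ))
  have hT : ∀ v, T v = ∑ i, v i * t i := fun v => by simp [T, Fintype.linearCombination_apply]
  have hle : Submodule.span ℚ (Set.range f) ≤ LinearMap.ker T := by
    rw [Submodule.span_le]
    rintro _ ⟨i, rfl⟩
    simp only [SetLike.mem_coe, LinearMap.mem_ker, hT]
    have := congrFun htA i
    simp only [Matrix.mulVec, dotProduct, Matrix.of_apply, Pi.zero_apply] at this
    rw [← hp i]
    simp only [row]
    exact_mod_cast this
  have hmem : row x ∈ Submodule.span ℚ (Set.range f) := by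
    rw [hspan]; exact Submodule.subset_span ⟨x, hx, rfl⟩
  have := hle hmem
  simp only [LinearMap.mem_ker, hT, row] at this
  have h2 : ∑ i, φ i x * t i = 0 := by exact_mod_cast this
  rw [← h2]
  exact Finset.sum_congr rfl fun i _ => mul_comm _ _

/-- Height lemma: a nonzero rational relation yields a small nonzero integral relation. -/
lemma height_lemma {X ι : Type*} [Fintype ι] (φ : ι → X → ℤ) (S : Set X) (Y : ℕ) (hY : 1 ≤ Y)
    (hb : ∀ i, ∀ x ∈ S, |φ i x| ≤ Y) (a : ι → ℚ) (ha : a ≠ 0)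
    (hv : ∀ x ∈ S, ∑ i, a i * φ i x = 0) :
    ∃ b : ι → ℤ, b ≠ 0 ∧ (∀ i, |b i| ≤ ((Fintype.card ι * Y) ^ (Fintype.card ι) : ℕ)) ∧
      ∀ x ∈ S, ∑ i, b i * φ i x = 0 := by
  let e := Fintype.equivFin ι
  obtain ⟨b, hb0, hbn, hbv⟩ := height_fin (fun i => φ (e.symm i)) S Y hY (fun i => hb _) (a ∘ e.symm)
    (fun h => ha (by funext i; simpa using congrFun h (e i)))
    (fun x hx => by
      rw [← hv x hx]
      exact Equiv.sum_comp e.symm (fun i => a i * φ i x))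
  refine ⟨b ∘ e, fun h => hb0 ?_, fun i => hbn _, fun x hx => ?_⟩
  · funext i; simpa using congrFun h (e.symm i)
  · rw [← hbv x hx, ← Equiv.sum_comp e]
    simp

/-- If all determinants vanish there is a nonzero rational relation. -/
lemma relation_of_det {X : Type*} {s : ℕ} (φ : Fin s → X → ℤ) (S : Set X)
    (hdet : ∀ P : Fin s → X, (∀ j, P j ∈ S) → (Matrix.of fun j i => φ i (P j)).det = 0) :
    ∃ a : Fin s → ℚ, a ≠ 0 ∧ ∀ x ∈ S, ∑ i, a i * φ i x = 0 := by
  let row : X → (Fin s → ℚ) := fun x i => φ i x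
  have hne : Submodule.span ℚ (row '' S) ≠ ⊤ := by
    intro h
    obtain ⟨f, hf, hspan, hli⟩ := Submodule.exists_fun_fin_finrank_span_eq ℚ (row '' S)
    have hr : Module.finrank ℚ (Submodule.span ℚ (row '' S)) = s := by rw [h]; simp
    let f' : Fin s → (Fin s → ℚ) := fun i => f (Fin.cast hr.symm i)
    have hli' : LinearIndependent ℚ f' := hli.comp _ (Fin.cast_injective _)
    have hf' : ∀ i, f' i ∈ row '' S := fun i => hf _
    choose p hpS hp using hf'
    have h0 := hdet p hpS
    have hu : IsUnit (Matrix.of f') := by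
      rw [← Matrix.linearIndependent_rows_iff_isUnit]
      exact hli'
    rw [Matrix.isUnit_iff_isUnit_det, isUnit_iff_ne_zero] at hu
    apply hu
    have hM : Matrix.of f' = (Matrix.of fun j i => φ i (p j)).map (Int.castRingHom ℚ) := by
      ext i j
      simp [← hp i, row]
    have h1 := RingHom.map_det (Int.castRingHom ℚ) (Matrix.of fun j i => φ i (p j))
    rw [h0, map_zero] at h1
    rw [hM]; exact h1.symm
  obtain ⟨g, hg0, hg⟩ := Submodule.exists_le_ker_of_lt_top _ hne.lt_top
  refine ⟨fun i => g (Pi.single i 1), fun h => hg0 ?_, fun x hx => ?_⟩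
  · apply LinearMap.pi_ext'
    intro i
    ext
    simpa using congrFun h i
  · have : g (row x) = 0 := hg (Submodule.subset_span ⟨x, hx, rfl⟩)
    rw [← this, LinearMap.pi_apply_eq_sum_univ g (row x)]
    refine Finset.sum_congr rfl fun i _ => ?_
    rw [smul_eq_mul, mul_comm]
    simp only
    congr 2
    funext j
    simp [Pi.single_apply, eq_comm]
end DG


namespace DG
open MvPolynomial

lemma taylor {σ : Type*} [Fintype σ] {R : Type*} [CommRing R] (G : MvPolynomial σ R) (u v : σ → R) (h : R) :
    ∃ q, eval (u + h • v) G = eval u G + h * (∑ j, v j * eval u (pderiv j G)) + h ^ 2 * q := by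
  classical
  induction G using MvPolynomial.induction_on with
  | C a => exact ⟨0, by simp⟩
  | add p q hp hq =>
    obtain ⟨a, ha⟩ := hp
    obtain ⟨b, hb⟩ := hq
    refine ⟨a + b, ?_⟩
    simp only [map_add, ha, hb, mul_add, Finset.sum_add_distrib]
    ring
  | mul_X p i hp =>
    obtain ⟨a, ha⟩ := hp
    have : ∑ j, v j * eval u (pderiv j (p * X i)) = (∑ j, v j * eval u (pderiv j p)) * u i + eval u p * v i := by
      simp only [Derivation.leibniz, pderiv_X, smul_eq_mul, map_add, map_mul, eval_X, mul_add,
        Finset.sum_add_distrib, Finset.sum_mul, Pi.single_apply]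
      rw [add_comm]
      congr 1
      · exact Finset.sum_congr rfl fun j _ => by ring
      · rw [Finset.sum_eq_single i]
        · simp; ring
        · intro j _ hj; simp [hj.symm]
        · simp
    rw [this]
    simp only [map_mul, ha, eval_X, Pi.add_apply, Pi.smul_apply, smul_eq_mul]
    exact ⟨(∑ j, v j * eval u (pderiv j p)) * v i + a * u i + h * a * v i, by ring⟩

lemma eval_congr_mod {σ : Type*} (G : MvPolynomial σ ℤ) (u v : σ → ℤ) (m : ℤ)
    (h : ∀ i, m ∣ u i - v i) : m ∣ eval u G - eval v G := by
  induction G using MvPolynomial.induction_on with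
  | C a => simp
  | add p q hp hq =>
    simp only [map_add]
    obtain ⟨a, ha⟩ := hp
    obtain ⟨b, hb⟩ := hq
    exact ⟨a + b, by linear_combination ha + hb⟩
  | mul_X p i hp =>
    simp only [map_mul, eval_X]
    obtain ⟨a, ha⟩ := hp
    obtain ⟨b, hb⟩ := h i
    exact ⟨a * u i + eval v p * b, by linear_combination u i * ha + eval v p * hb⟩

lemma det_congr_mod {s : ℕ} (A B : Matrix (Fin s) (Fin s) ℤ) (M : ℕ)
    (h : ∀ i j, (M : ℤ) ∣ A i j - B i j) (hB : (M : ℤ) ∣ B.det) : (M : ℤ) ∣ A.det := by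
  rw [← ZMod.intCast_zmod_eq_zero_iff_dvd] at hB ⊢
  rw [← hB]
  have h1 := RingHom.map_det (Int.castRingHom (ZMod M)) A
  have h2 := RingHom.map_det (Int.castRingHom (ZMod M)) B
  simp only [eq_intCast] at h1 h2
  rw [h1, h2]
  congr 1
  ext i j
  simp only [RingHom.mapMatrix_apply, Matrix.map_apply, eq_intCast]
  rw [← sub_eq_zero, ← Int.cast_sub, ZMod.intCast_zmod_eq_zero_iff_dvd]
  exact h i j

lemma det_dvd {k s : ℕ} (Ψ : Fin s → MvPolynomial (Fin k) ℤ) (P : Fin s → Fin k → ℤ) (c : Fin k → ℤ)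
    (m : ℤ) (ω : ℕ) (hP : ∀ j l, m ∣ P j l - c l)
    (hω : ∀ ν : Fin s → (Fin k →₀ ℕ), Function.Injective ν → ω ≤ ∑ i, (ν i).degree) :
    m ^ ω ∣ (Matrix.of fun j i => eval (P j) (Ψ i)).det := by
  classical
  choose t ht using hP
  let Φ : Fin s → MvPolynomial (Fin k) ℤ := fun i => bind₁ (fun l => X l + C (c l)) (Ψ i)
  have hΦ : ∀ i j, eval (P j) (Ψ i) = eval (fun l => m * t j l) (Φ i) := by
    intro i j
    simp only [Φ, eval, eval₂Hom_bind₁]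
    congr 2
    funext l
    simp
    linarith [ht j l]
  let T : Finset (Fin k →₀ ℕ) := Finset.univ.biUnion fun i => (Φ i).support
  let Y : (Fin k →₀ ℕ) → Fin s → ℤ := fun ν j => m ^ ν.degree * ∏ l, t j l ^ ν l
  have hexp : ∀ i j, eval (P j) (Ψ i) = ∑ ν ∈ T, coeff ν (Φ i) * Y ν j := by
    intro i j
    rw [hΦ, eval_eq']
    have hsub : (Φ i).support ⊆ T := Finset.subset_biUnion_of_mem (fun i => (Φ i).support) (Finset.mem_univ i)
    rw [← Finset.sum_subset hsub]
    · refine Finset.sum_congr rfl fun ν _ => ?_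
      simp only [Y, mul_pow, Finset.prod_mul_distrib]
      congr 2
      rw [Finset.prod_pow_eq_pow_sum, Finsupp.degree_eq_sum]
    · intro ν _ hν
      rw [notMem_support_iff.1 hν, zero_mul]
  rw [← Matrix.det_transpose]
  have hM : (Matrix.of fun j i => eval (P j) (Ψ i)).transpose =
      fun i => ∑ ν ∈ T, coeff ν (Φ i) • Y ν := by
    funext i j
    simp [Matrix.transpose_apply, hexp, Finset.sum_apply]
  rw [hM]
  have := (Matrix.detRowAlternating (n := Fin s) (R := ℤ)).toMultilinearMap.map_sum_finset
    (fun i ν => coeff ν (Φ i) • Y ν) (fun _ => T)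
  change Matrix.det (fun i => ∑ ν ∈ T, coeff ν (Φ i) • Y ν) = _ at this
  rw [this]
  apply Finset.dvd_sum
  intro ν _
  change m ^ ω ∣ Matrix.det (fun i => coeff (ν i) (Φ i) • Y (ν i))
  have h1 : Matrix.det (fun i => coeff (ν i) (Φ i) • Y (ν i)) =
      (∏ i, coeff (ν i) (Φ i)) * Matrix.det (fun i => Y (ν i)) :=
    Matrix.det_mul_column (fun i => coeff (ν i) (Φ i)) (fun i => Y (ν i))
  rw [h1]
  apply Dvd.dvd.mul_left
  by_cases hinj : Function.Injective ν
  · have h2 : Matrix.det (fun i => Y (ν i)) =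
      (∏ i, m ^ (ν i).degree) * Matrix.det (fun i j => ∏ l, t j l ^ (ν i) l) :=
      Matrix.det_mul_column (fun i => m ^ (ν i).degree) (fun i j => ∏ l, t j l ^ (ν i) l)
    rw [h2, Finset.prod_pow_eq_pow_sum]
    exact Dvd.dvd.mul_right (pow_dvd_pow m (hω ν hinj)) _
  · simp only [Function.Injective, not_forall] at hinj
    obtain ⟨i, j, hij, hne⟩ := hinj
    have h2 : Matrix.det (fun i => Y (ν i)) = 0 :=
      Matrix.det_zero_of_row_eq (M := fun i => Y (ν i)) hne (by funext l; simp only [hij])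
    exact h2 ▸ dvd_zero _

/-- Newton iteration. -/
lemma newton {k : ℕ} (G : MvPolynomial (Fin (k+1)) ℤ) (i : Fin (k+1)) (ρ : ℤ) (u0 : Fin (k+1) → ℤ) (e : ℤ)
    (he : ρ ∣ e * eval u0 (pderiv i G) - 1) (N : ℕ) :
    ∃ ψ : MvPolynomial (Fin k) ℤ, ∀ u : Fin (k+1) → ℤ, (∀ l, ρ ∣ u l - u0 l) → ρ ^ (N+1) ∣ eval u G →
      ρ ^ (N+1) ∣ u i - eval (fun l => u (i.succAbove l)) ψ := by
  classical
  induction N with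
  | zero =>
    refine ⟨C (u0 i), fun u hu _ => ?_⟩
    simpa using hu i
  | succ N ih =>
    obtain ⟨ψ, hψ⟩ := ih
    refine ⟨ψ - C e * bind₁ (i.insertNth ψ X) G, fun u hu hG => ?_⟩
    have hG' : ρ ^ (N+1) ∣ eval u G := (pow_dvd_pow ρ (by omega)).trans hG
    obtain ⟨t, ht⟩ := hψ u hu hG'
    set w := eval (fun l => u (i.succAbove l)) ψ with hw
    have hb : eval (fun l => u (i.succAbove l)) (bind₁ (i.insertNth ψ X) G) =
        eval (u + (w - u i) • (Pi.single i 1)) G := by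
      simp only [eval, eval₂Hom_bind₁]
      congr 2
      funext l
      refine Fin.succAboveCases i ?_ (fun l => ?_) l
      · change eval _ _ = _
        simp [hw]
      · change eval _ _ = _
        simp [Fin.succAbove_ne]
    obtain ⟨q, hq⟩ := taylor G u (Pi.single i 1) (w - u i)
    have hsum : ∑ j, (Pi.single i 1 : Fin (k+1) → ℤ) j * eval u (pderiv j G) = eval u (pderiv i G) := by
      rw [Finset.sum_eq_single i] <;> simp +contextual
    rw [hsum] at hq
    obtain ⟨a, ha⟩ := hG
    obtain ⟨b, hb'⟩ := he
    obtain ⟨c, hc⟩ := eval_congr_mod (pderiv i G) u u0 ρ hu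
    simp only [map_sub, map_mul, eval_C, hb, hq, ← hw, ha]
    have hwu : w - u i = - (ρ ^ (N+1) * t) := by linarith
    have hui : u i = w + ρ^(N+1) * t := by linarith
    have hgi : eval u (pderiv i G) = eval u0 (pderiv i G) + ρ * c := by linarith
    rw [hwu, hgi]
    have heq : e * eval u0 (pderiv i G) = 1 + ρ * b := by linarith
    have hp : ρ ^ (N+1+1) = ρ^(N+1) * ρ := pow_succ _ _
    rw [hp, hui]
    refine ⟨-t * b - e * t * c + e * a + e * ρ^N * t^2 * q, ?_⟩
    have h3 : ρ ^ (N+1) = ρ^N * ρ := pow_succ _ _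
    linear_combination (-ρ^(N+1) * t) * heq + (ρ^(N+1) * t^2 * q * e) * h3

lemma det_abs_le {s : ℕ} (A : Matrix (Fin s) (Fin s) ℤ) (Y : Fin s → ℤ) (h : ∀ i j, |A i j| ≤ Y j) :
    |A.det| ≤ s.factorial * ∏ j, Y j := by
  rw [Matrix.det_apply]
  refine (Finset.abs_sum_le_sum_abs _ _).trans ?_
  refine (Finset.sum_le_card_nsmul _ _ (∏ j, Y j) ?_).trans ?_
  · intro σ _
    rw [Units.smul_def, smul_eq_mul, abs_mul]
    have : |((Equiv.Perm.sign σ : ℤˣ) : ℤ)| = 1 := Int.isUnit_iff_abs_eq.1 (Units.isUnit _)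
    rw [this, one_mul, Finset.abs_prod]
    exact Finset.prod_le_prod (fun i _ => abs_nonneg _) (fun i _ => h _ _)
  · simp [Finset.card_univ, Fintype.card_perm]

lemma class_det_dvd {k s : ℕ} (G : MvPolynomial (Fin (k+1)) ℤ) (i : Fin (k+1)) (ρ m A : ℕ) (u0 : Fin (k+1) → ℤ)
    (e : ℤ) (he : (ρ:ℤ) ∣ e * eval u0 (pderiv i G) - 1) (hρm : ρ ∣ m) (hmρ : m ∣ ρ ^ A) (ω : ℕ)
    (hω : ∀ ν : Fin s → (Fin k →₀ ℕ), Function.Injective ν → ω ≤ ∑ i, (ν i).degree)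
    (φ : Fin s → MvPolynomial (Fin (k+1)) ℤ) (P : Fin s → Fin (k+1) → ℤ)
    (hP : ∀ j l, (m:ℤ) ∣ P j l - u0 l) (hG : ∀ j, (ρ:ℤ) ^ (A * ω + 1) ∣ eval (P j) G) :
    ((m ^ ω : ℕ) : ℤ) ∣ (Matrix.of fun j l => eval (P j) (φ l)).det := by
  obtain ⟨ψ, hψ⟩ := newton G i ρ u0 e he (A * ω)
  have hρm' : (ρ:ℤ) ∣ m := by exact_mod_cast hρm
  have hpow : ((m ^ ω : ℕ) : ℤ) ∣ (ρ:ℤ) ^ (A * ω + 1) := by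
    have : m ^ ω ∣ ρ ^ (A * ω + 1) := by
      refine (pow_dvd_pow_of_dvd hmρ ω).trans ?_
      rw [← pow_mul]; exact pow_dvd_pow _ (by omega)
    exact_mod_cast this
  have h1 : ∀ j, ((m ^ ω : ℕ) : ℤ) ∣ P j i - eval (fun l => P j (i.succAbove l)) ψ := fun j =>
    hpow.trans (hψ (P j) (fun l => hρm'.trans (hP j l)) (hG j))
  let Ψ : Fin s → MvPolynomial (Fin k) ℤ := fun l => bind₁ (i.insertNth ψ X) (φ l)
  refine det_congr_mod _ (Matrix.of fun j l => eval (fun l => P j (i.succAbove l)) (Ψ l)) _ ?_ ?_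
  · intro j l
    have hb : eval (fun l => P j (i.succAbove l)) (bind₁ (i.insertNth ψ X) (φ l)) =
        eval (i.insertNth (eval (fun l => P j (i.succAbove l)) ψ) (fun l => P j (i.succAbove l))) (φ l) := by
      simp only [eval, eval₂Hom_bind₁]
      congr 2
      funext l
      refine Fin.succAboveCases i ?_ (fun l => ?_) l
      · change eval _ _ = _
        simp
      · change eval _ _ = _
        simp
    simp only [Matrix.of_apply, Ψ]
    rw [hb]
    apply eval_congr_mod
    intro l
    refine Fin.succAboveCases i ?_ (fun l => ?_) l
    · simpa using h1 j
    · simp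
  · have := det_dvd Ψ (fun j l => P j (i.succAbove l)) (fun l => u0 (i.succAbove l)) m ω
      (fun j l => hP j _) hω
    exact_mod_cast this

/-- Determinant method: on a residue class there is a nontrivial relation. -/
lemma class_relation {k s : ℕ} (G : MvPolynomial (Fin (k+1)) ℤ) (i : Fin (k+1)) (ρ m A : ℕ) (u0 : Fin (k+1) → ℤ)
    (e : ℤ) (he : (ρ:ℤ) ∣ e * eval u0 (pderiv i G) - 1) (hρm : ρ ∣ m) (hmρ : m ∣ ρ ^ A) (ω : ℕ)
    (hω : ∀ ν : Fin s → (Fin k →₀ ℕ), Function.Injective ν → ω ≤ ∑ i, (ν i).degree)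
    (φ : Fin s → MvPolynomial (Fin (k+1)) ℤ) (S : Set (Fin (k+1) → ℤ)) (Y : Fin s → ℕ)
    (hS : ∀ x ∈ S, (∀ l, (m:ℤ) ∣ x l - u0 l) ∧ eval x G = 0 ∧ ∀ l, |eval x (φ l)| ≤ Y l)
    (hlt : s.factorial * ∏ l, Y l < m ^ ω) :
    ∃ a : Fin s → ℚ, a ≠ 0 ∧ ∀ x ∈ S, ∑ l, a l * (eval x (φ l) : ℤ) = 0 := by
  apply relation_of_det (fun l x => eval x (φ l)) S
  intro P hP
  have hd := class_det_dvd G i ρ m A u0 e he hρm hmρ ω hω φ P (fun j => (hS _ (hP j)).1)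
    (fun j => by rw [(hS _ (hP j)).2.1]; exact dvd_zero _)
  have hb := det_abs_le (Matrix.of fun j l => eval (P j) (φ l)) (fun l => (Y l : ℤ))
    (fun j l => (hS _ (hP j)).2.2 l)
  by_contra hne
  have := Int.le_of_dvd (abs_pos.2 hne) ((dvd_abs _ _).2 hd)
  have h3 : (s.factorial : ℤ) * ∏ l, (Y l : ℤ) < ((m ^ ω : ℕ) : ℤ) := by exact_mod_cast hlt
  linarith

/-- uniqueness of lifts modulo m -/
lemma lift_unique {k : ℕ} (G : MvPolynomial (Fin (k+1)) ℤ) (i : Fin (k+1)) (ρ m A : ℕ) (u v : Fin (k+1) → ℤ)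
    (e : ℤ) (he : (ρ:ℤ) ∣ e * eval u (pderiv i G) - 1) (hρm : ρ ∣ m) (hmρ : m ∣ ρ ^ A)
    (hu : eval u G = 0) (hv : eval v G = 0) (hi : (ρ:ℤ) ∣ v i - u i)
    (hl : ∀ l, (m:ℤ) ∣ v (i.succAbove l) - u (i.succAbove l)) : (m:ℤ) ∣ v i - u i := by
  obtain ⟨ψ, hψ⟩ := newton G i ρ u e he A
  have hρm' : (ρ:ℤ) ∣ m := by exact_mod_cast hρm
  have hpow : (m : ℤ) ∣ (ρ:ℤ) ^ (A + 1) := by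
    have : m ∣ ρ ^ (A + 1) := hmρ.trans (pow_dvd_pow _ (by omega))
    exact_mod_cast this
  have h1 := hpow.trans (hψ u (fun l => by simp) (by simp [hu]))
  have h2 := hpow.trans (hψ v (fun l => by
    refine Fin.succAboveCases i hi (fun l => hρm'.trans (hl l)) l) (by simp [hv]))
  have h3 := eval_congr_mod ψ (fun l => v (i.succAbove l)) (fun l => u (i.succAbove l)) m hl
  obtain ⟨a, ha⟩ := h1
  obtain ⟨b, hb⟩ := h2
  obtain ⟨c, hc⟩ := h3
  exact ⟨b + c - a, by linear_combination hb + hc - ha⟩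
end DG


namespace DG
open MvPolynomial

lemma sum_trunc (n K : ℕ) (h : n ≤ K) : 2 * ∑ b ∈ Finset.range K, (n - b) = n * (n + 1) := by
  induction K, h using Nat.le_induction with
  | base =>
    have := Finset.sum_range_reflect (fun b => b + 1) n
    have h2 : ∑ b ∈ Finset.range n, (n - b) = ∑ b ∈ Finset.range n, (n - 1 - b + 1) := by
      refine Finset.sum_congr rfl fun b hb => ?_
      have := Finset.mem_range.1 hb
      omega
    rw [h2, this]
    clear this h2
    induction n with
    | zero => simp
    | succ n ih => rw [Finset.sum_range_succ, mul_add, ih]; ring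
  | succ K hK ih =>
    rw [Finset.sum_range_succ, Nat.sub_eq_zero_of_le hK, add_zero, ih]

lemma sum_trunc2 (K : ℕ) : 6 * ∑ a ∈ Finset.range K, ∑ b ∈ Finset.range K, (K - (a + b)) = K * (K+1) * (K+2) := by
  have h1 : ∀ a ∈ Finset.range K, 2 * ∑ b ∈ Finset.range K, (K - (a + b)) = (K - 1 - a + 1) * (K - 1 - a + 2) := by
    intro a ha
    have := Finset.mem_range.1 ha
    have h := sum_trunc (K - a) K (by omega)
    simp only [Nat.sub_sub] at h
    rw [h]
    congr 1 <;> omega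
  have h2 : 6 * ∑ a ∈ Finset.range K, ∑ b ∈ Finset.range K, (K - (a + b)) =
    3 * ∑ a ∈ Finset.range K, (2 * ∑ b ∈ Finset.range K, (K - (a + b))) := by
    rw [← Finset.mul_sum]; ring
  rw [h2, Finset.sum_congr rfl h1, Finset.sum_range_reflect (fun a => (a + 1) * (a + 2)) K]
  clear h1 h2
  induction K with
  | zero => simp
  | succ n ih => rw [Finset.sum_range_succ, mul_add, ih]; ring

lemma omega_gen {k s K W : ℕ} (ν : Fin s → (Fin k →₀ ℕ)) (hν : Function.Injective ν)
    (hW : ∀ U : Finset (Fin k →₀ ℕ), ∑ v ∈ U, (K - v.degree) ≤ W) : K * s ≤ (∑ i, (ν i).degree) + W := by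
  classical
  have h1 := hW (Finset.univ.image ν)
  rw [Finset.sum_image (fun a _ b _ h => hν h)] at h1
  have h2 : ∑ i : Fin s, K ≤ ∑ i, ((ν i).degree + (K - (ν i).degree)) :=
    Finset.sum_le_sum fun i _ => by omega
  rw [Finset.sum_add_distrib] at h2
  simp at h2
  rw [mul_comm]; omega

lemma omega2 {s K : ℕ} (ν : Fin s → (Fin 2 →₀ ℕ)) (hν : Function.Injective ν) :
    6 * K * s ≤ 6 * (∑ i, (ν i).degree) + K * (K+1) * (K+2) := by
  classical
  rw [← sum_trunc2 K]
  have := omega_gen (K := K) (W := ∑ a ∈ Finset.range K, ∑ b ∈ Finset.range K, (K - (a + b))) ν hν ?_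
  · have h6 := Nat.mul_le_mul_left 6 this
    rw [mul_add] at h6
    rw [mul_assoc]; exact h6
  intro U
  rw [← Finset.sum_product']
  have hinj : Set.InjOn (fun v : Fin 2 →₀ ℕ => (v 0, v 1)) (U : Set _) := by
    intro a _ b _ h
    simp only [Prod.mk.injEq] at h
    ext i; fin_cases i
    · exact h.1
    · exact h.2
  have hd : ∀ v : Fin 2 →₀ ℕ, v.degree = v 0 + v 1 := by
    intro v; rw [Finsupp.degree_eq_sum, Fin.sum_univ_two]
  rw [← Finset.sum_filter_add_sum_filter_not U (fun v => v.degree < K)]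
  have h0 : ∑ v ∈ U.filter (fun v => ¬ v.degree < K), (K - v.degree) = 0 := by
    apply Finset.sum_eq_zero
    intro v hv
    have := (Finset.mem_filter.1 hv).2
    omega
  rw [h0, add_zero]
  have h1 : ∑ v ∈ U.filter (fun v => v.degree < K), (K - v.degree) =
      ∑ p ∈ (U.filter (fun v => v.degree < K)).image (fun v : Fin 2 →₀ ℕ => (v 0, v 1)), (K - (p.1 + p.2)) := by
    rw [Finset.sum_image]
    · exact Finset.sum_congr rfl fun v _ => by rw [hd]
    · exact fun a ha b hb h => hinj (Finset.mem_of_mem_filter _ ha) (Finset.mem_of_mem_filter _ hb) h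
  rw [h1]
  apply Finset.sum_le_sum_of_subset
  intro p hp
  obtain ⟨v, hv, rfl⟩ := Finset.mem_image.1 hp
  have := (Finset.mem_filter.1 hv).2
  rw [hd] at this
  simp; omega

lemma omega1 {s : ℕ} (ν : Fin s → (Fin 1 →₀ ℕ)) (hν : Function.Injective ν) :
    2 * s * s ≤ 2 * (∑ i, (ν i).degree) + s * (s+1) := by
  classical
  rw [← sum_trunc s s le_rfl]
  have := omega_gen (K := s) (W := ∑ b ∈ Finset.range s, (s - b)) ν hν ?_
  · have h6 := Nat.mul_le_mul_left 2 this
    rw [mul_add] at h6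
    rw [mul_assoc]; exact h6
  intro U
  have hd : ∀ v : Fin 1 →₀ ℕ, v.degree = v 0 := by
    intro v; rw [Finsupp.degree_eq_sum]; simp
  rw [← Finset.sum_filter_add_sum_filter_not U (fun v => v.degree < s)]
  have h0 : ∑ v ∈ U.filter (fun v => ¬ v.degree < s), (s - v.degree) = 0 := by
    apply Finset.sum_eq_zero
    intro v hv
    have := (Finset.mem_filter.1 hv).2
    omega
  rw [h0, add_zero]
  have h1 : ∑ v ∈ U.filter (fun v => v.degree < s), (s - v.degree) =
      ∑ p ∈ (U.filter (fun v => v.degree < s)).image (fun v : Fin 1 →₀ ℕ => v 0), (s - p) := by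
    rw [Finset.sum_image]
    · exact Finset.sum_congr rfl fun v _ => by rw [hd]
    · intro a _ b _ h
      ext; exact h
  rw [h1]
  apply Finset.sum_le_sum_of_subset
  intro p hp
  obtain ⟨v, hv, rfl⟩ := Finset.mem_image.1 hp
  have := (Finset.mem_filter.1 hv).2
  rw [hd] at this
  simp; omega

/-- polynomial form of the determinant method -/
lemma class_poly {k : ℕ} (G : MvPolynomial (Fin (k+1)) ℤ) (i : Fin (k+1)) (ρ m A : ℕ) (u0 : Fin (k+1) → ℤ)
    (e : ℤ) (he : (ρ:ℤ) ∣ e * eval u0 (pderiv i G) - 1) (hρm : ρ ∣ m) (hmρ : m ∣ ρ ^ A) (ω : ℕ)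
    (T : Finset (Fin (k+1) →₀ ℕ))
    (hω : ∀ ν : Fin T.card → (Fin k →₀ ℕ), Function.Injective ν → ω ≤ ∑ i, (ν i).degree)
    (S : Set (Fin (k+1) → ℤ)) (B : ℕ)
    (hS : ∀ x ∈ S, (∀ l, (m:ℤ) ∣ x l - u0 l) ∧ eval x G = 0 ∧ ∀ l, |x l| ≤ B)
    (hlt : T.card.factorial * B ^ (∑ v ∈ T, v.degree) < m ^ ω) :
    ∃ h : MvPolynomial (Fin (k+1)) ℚ, h ≠ 0 ∧ h.support ⊆ T ∧ ∀ x ∈ S, eval (fun l => (x l : ℚ)) h = 0 := by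
  classical
  let E : Fin T.card → (Fin (k+1) →₀ ℕ) := fun l => (T.equivFin.symm l).1
  have hE : Function.Injective E := Subtype.val_injective.comp T.equivFin.symm.injective
  have hET : ∀ l, E l ∈ T := fun l => (T.equivFin.symm l).2
  have hsum : ∑ v ∈ T, v.degree = ∑ l, (E l).degree := by
    rw [← Finset.sum_coe_sort T, ← Equiv.sum_comp T.equivFin.symm]
  obtain ⟨a, ha0, ha⟩ := class_relation G i ρ m A u0 e he hρm hmρ ω hω (fun l => monomial (E l) 1) S
    (fun l => B ^ (E l).degree) (fun x hx => ⟨(hS x hx).1, (hS x hx).2.1, fun l => by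
      rw [eval_monomial, one_mul, Finsupp.prod_fintype _ _ (fun _ => pow_zero _), Finset.abs_prod,
        Finsupp.degree_eq_sum, ← Finset.prod_pow_eq_pow_sum]
      push_cast
      apply Finset.prod_le_prod (fun _ _ => abs_nonneg _)
      intro j _
      rw [abs_pow]
      exact pow_le_pow_left₀ (abs_nonneg _) ((hS x hx).2.2 j) _⟩)
    (by rw [Finset.prod_pow_eq_pow_sum, ← hsum]; exact hlt)
  refine ⟨∑ l, monomial (E l) (a l), ?_, ?_, ?_⟩
  · intro h
    apply ha0
    funext l
    have := congrArg (coeff (E l)) h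
    rw [coeff_sum] at this
    simp only [coeff_monomial, coeff_zero] at this
    rw [Finset.sum_eq_single l] at this
    · simpa using this
    · intro j _ hj; simp [hE.ne hj]
    · simp
  · intro v hv
    have := support_sum hv
    simp only [Finset.mem_biUnion] at this
    obtain ⟨l, _, hl⟩ := this
    have := support_monomial_subset hl
    rw [Finset.mem_singleton] at this
    rw [this]; exact hET l
  · intro x hx
    rw [map_sum, ← ha x hx]
    refine Finset.sum_congr rfl fun l _ => ?_
    rw [eval_monomial, eval_monomial]
    congr 1
    rw [Finsupp.prod_fintype _ _ (fun _ => pow_zero _), Finsupp.prod_fintype _ _ (fun _ => pow_zero _)]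
    push_cast
    simp

/-- exponents used in the surface case -/
noncomputable def expo3 (p : ℕ × (Σ _ : ℕ, ℕ)) : Fin 3 →₀ ℕ :=
  Finsupp.equivFunOnFinite.symm ![p.2.2, p.2.1 - p.2.2, p.1]

noncomputable def T3 (L : ℕ) : Finset (Fin 3 →₀ ℕ) :=
  ((Finset.range 4) ×ˢ ((Finset.range L).sigma (fun t => Finset.range (t+1)))).image expo3

lemma expo3_inj (L : ℕ) : Set.InjOn expo3
    (((Finset.range 4) ×ˢ ((Finset.range L).sigma (fun t => Finset.range (t+1))) : Finset _) : Set _) := by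
  rintro ⟨k, t, i⟩ h ⟨k', t', i'⟩ h' hh
  simp only [expo3, EmbeddingLike.apply_eq_iff_eq] at hh
  have h0 := congrFun hh 0
  have h1 := congrFun hh 1
  have h2 := congrFun hh 2
  simp at h0 h1 h2 h h'
  subst h0 h2
  have : t = t' := by omega
  subst this
  rfl

lemma T3_card (L : ℕ) : (T3 L).card = 2 * (L * (L+1)) := by
  rw [T3, Finset.card_image_of_injOn (expo3_inj L), Finset.card_product, Finset.card_sigma]
  simp only [Finset.card_range]
  have : 2 * ∑ t ∈ Finset.range L, (t + 1) = L * (L+1) := by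
    induction L with
    | zero => simp
    | succ n ih => rw [Finset.sum_range_succ, mul_add, ih]; ring
  omega

lemma T3_deg (L : ℕ) : 3 * ∑ v ∈ T3 L, v.degree = (L * (L+1)) * (4 * L + 5) := by
  rw [T3, Finset.sum_image (fun a ha b hb h => expo3_inj L ha hb h), Finset.sum_product]
  simp only [Finset.sum_sigma]
  have : ∀ k, ∑ t ∈ Finset.range L, ∑ i ∈ Finset.range (t+1), (expo3 (k, ⟨t, i⟩)).degree =
      ∑ t ∈ Finset.range L, (t+1) * (k + t) := by
    intro k
    refine Finset.sum_congr rfl fun t _ => ?_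
    rw [Finset.sum_congr rfl (g := fun _ => k + t)]
    · simp
    · intro i hi
      have := Finset.mem_range.1 hi
      simp [expo3, Finsupp.degree_eq_sum, Fin.sum_univ_three]
      omega
  simp only [this]
  clear this
  simp only [Finset.sum_range_succ _ 3, Finset.sum_range_succ _ 2, Finset.sum_range_succ _ 1, Finset.sum_range_one]
  induction L with
  | zero => simp
  | succ n ih =>
    simp only [Finset.sum_range_succ _ n]
    have h : (n+1) * (n+1+1) * (4 * (n+1) + 5) = n * (n+1) * (4 * n + 5) + 3 * ((n+1) * (0+n) + (n+1) * (1+n) + (n+1)*(2+n) + (n+1)*(3+n)) := by ring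
    rw [h, ← ih]
    ring

lemma T3_mem {L : ℕ} {v : Fin 3 →₀ ℕ} (hv : v ∈ T3 L) : v 2 ≤ 3 ∧ v.degree ≤ L + 2 := by
  obtain ⟨⟨k, t, i⟩, hp, rfl⟩ := Finset.mem_image.1 hv
  simp at hp
  simp [expo3, Finsupp.degree_eq_sum, Fin.sum_univ_three]
  omega

lemma three_dvd (l : ℕ) : ∃ w, 3 * w = l * (l+1) * (l+2) := by
  induction l with
  | zero => exact ⟨0, by simp⟩
  | succ l ih => obtain ⟨w, hw⟩ := ih; exact ⟨w + (l+1)*(l+2), by rw [mul_add, hw]; ring⟩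

lemma pow_ineq {s B L σ ω m : ℕ} (hB : B = 4 ^ L) (hs : s ≤ 4 ^ L) (hm : 2 ^ (L+5) ≤ m)
    (h : 2 * L * s + 2 * L * σ < (L + 5) * ω) : s.factorial * B ^ σ < m ^ ω := by
  have h4 : (4:ℕ) ^ L = 2 ^ (2 * L) := by rw [pow_mul]; norm_num
  calc s.factorial * B ^ σ ≤ s ^ s * B ^ σ := by gcongr; exact Nat.factorial_le_pow s
    _ ≤ (4^L) ^ s * (4^L)^σ := by rw [hB]; gcongr
    _ = 2 ^ (2 * L * s + 2 * L * σ) := by rw [h4, ← pow_mul, ← pow_mul, ← pow_add]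
    _ < 2 ^ ((L+5) * ω) := Nat.pow_lt_pow_right (by norm_num) h
    _ = (2 ^ (L+5)) ^ ω := by rw [pow_mul]
    _ ≤ m ^ ω := by gcongr

lemma card_le_four_pow (L : ℕ) (hL : 1 ≤ L) : 2 * (L * (L+1)) ≤ 4 ^ L := by
  induction L, hL using Nat.le_induction with
  | base => norm_num
  | succ n hn ih => rw [pow_succ]; nlinarith

/-- Determinant method on the surface. -/
lemma aux2 (G : MvPolynomial (Fin 3) ℤ) (L ρ m A : ℕ) (hL : 1 ≤ L) (u0 : Fin 3 → ℤ)
    (e : ℤ) (he : (ρ:ℤ) ∣ e * eval u0 (pderiv 2 G) - 1) (hρm : ρ ∣ m) (hmρ : m ∣ ρ ^ A)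
    (hm : 2 ^ (L+5) ≤ m) (S : Set (Fin 3 → ℤ))
    (hS : ∀ x ∈ S, (∀ l, (m:ℤ) ∣ x l - u0 l) ∧ eval x G = 0 ∧ ∀ l, |x l| ≤ 4 ^ L) :
    ∃ h : MvPolynomial (Fin 3) ℚ, h ≠ 0 ∧ h.degreeOf 2 ≤ 3 ∧ h.totalDegree ≤ L + 2 ∧
      ∀ x ∈ S, eval (fun l => (x l : ℚ)) h = 0 := by
  obtain ⟨ω, hω⟩ : ∃ ω, 3 * ω = L * (L+1) * (8 * L - 2) := by
    obtain ⟨l, rfl⟩ : ∃ l, L = l + 1 := ⟨L - 1, by omega⟩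
    obtain ⟨w, hw⟩ := three_dvd l
    refine ⟨8 * w + 2 * (l+1) * (l+2), ?_⟩
    have : 8 * (l + 1) - 2 = 8 * l + 6 := by omega
    rw [this]
    linear_combination 8 * hw
  have hc := T3_card L
  have hd := T3_deg L
  obtain ⟨h, h0, hT, hv⟩ := class_poly G 2 ρ m A u0 e he hρm hmρ ω (T3 L) (by
      intro ν hν
      have := omega2 (K := 2 * L) ν hν
      generalize (∑ i, (ν i).degree) = D at *
      rw [hc] at this
      obtain ⟨l, rfl⟩ : ∃ l, L = l + 1 := ⟨L - 1, by omega⟩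
      have h8 : 8 * (l + 1) - 2 = 8 * l + 6 := by omega
      rw [h8] at hω
      nlinarith) S (4 ^ L) (fun x hx => ⟨(hS x hx).1, (hS x hx).2.1, fun l => by exact_mod_cast (hS x hx).2.2 l⟩)
    (pow_ineq rfl (hc ▸ card_le_four_pow L hL) hm (by
      rw [hc]
      generalize (∑ v ∈ T3 L, v.degree) = D at *
      obtain ⟨l, rfl⟩ : ∃ l, L = l + 1 := ⟨L - 1, by omega⟩
      have h8 : 8 * (l + 1) - 2 = 8 * l + 6 := by omega
      rw [h8] at hω
      have : 3 * (2 * (l+1) * (2 * ((l+1) * (l+1+1))) + 2 * (l+1) * D) < 3 * ((l+1+5) * ω) := by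
        have e1 : 3 * (2 * (l+1) * (2 * ((l+1) * (l+1+1))) + 2 * (l+1) * D) =
          12 * (l+1) * ((l+1) * (l+1+1)) + 2 * (l+1) * ((l + 1) * (l + 1 + 1) * (4 * (l + 1) + 5)) := by
          rw [← hd]; ring
        have e2 : 3 * ((l+1+5) * ω) = (l+1+5) * ((l + 1) * (l + 1 + 1) * (8 * l + 6)) := by rw [← hω]; ring
        rw [e1, e2]
        nlinarith
      omega))
  refine ⟨h, h0, ?_, ?_, hv⟩
  · rw [degreeOf_le_iff]
    intro v hv
    exact (T3_mem (hT hv)).1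
  · apply Finset.sup_le
    intro v hv
    exact (T3_mem (hT hv)).2
end DG


namespace DG
open MvPolynomial

lemma aux1_gen (G : MvPolynomial (Fin 2) ℤ) (i : Fin 2) (L ρ m A : ℕ) (hL : 1 ≤ L) (u0 : Fin 2 → ℤ)
    (e : ℤ) (he : (ρ:ℤ) ∣ e * eval u0 (pderiv i G) - 1) (hρm : ρ ∣ m) (hmρ : m ∣ ρ ^ A)
    (hm : 2 ^ (L+5) ≤ m) (S : Set (Fin 2 → ℤ))
    (hS : ∀ x ∈ S, (∀ l, (m:ℤ) ∣ x l - u0 l) ∧ eval x G = 0 ∧ ∀ l, |x l| ≤ 4 ^ L)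
    (E : ℕ → (Fin 2 →₀ ℕ)) (hE : Function.Injective E) (hEd : ∀ n, (E n).degree = (n + 1) / 2) :
    ∃ h : MvPolynomial (Fin 2) ℚ, h ≠ 0 ∧ (∀ v ∈ h.support, ∃ n, v = E n) ∧ h.totalDegree ≤ L + 1 ∧
      ∀ x ∈ S, eval (fun l => (x l : ℚ)) h = 0 := by
  classical
  set T := (Finset.range (2 * L + 1)).image E with hT
  have hc : T.card = 2 * L + 1 := by rw [hT, Finset.card_image_of_injective _ hE, Finset.card_range]
  have hd : ∑ v ∈ T, v.degree = L * (L+1) := by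
    rw [hT, Finset.sum_image (fun a _ b _ h => hE h)]
    simp only [hEd]
    clear hc hT hL hS hm T
    induction L with
    | zero => simp
    | succ n ih =>
      rw [show 2 * (n+1) + 1 = (2 * n + 1) + 1 + 1 by ring, Finset.sum_range_succ, Finset.sum_range_succ, ih]
      rw [show (2 * n + 1 + 1) / 2 = n + 1 by omega, show (2 * n + 1 + 1 + 1) / 2 = n + 1 by omega]
      ring
  obtain ⟨h, h0, hsub, hv⟩ := class_poly G i ρ m A u0 e he hρm hmρ (L * (2 * L + 1)) T (by
      intro ν hν
      have := omega1 ν hν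
      generalize (∑ i, (ν i).degree) = D at *
      rw [hc] at this
      nlinarith) S (4 ^ L) (fun x hx => ⟨(hS x hx).1, (hS x hx).2.1, fun l => by exact_mod_cast (hS x hx).2.2 l⟩)
    (pow_ineq rfl (hc ▸ by
        have : ∀ L : ℕ, 2 * L + 1 ≤ 4 ^ L := by
          intro L
          induction L with
          | zero => simp
          | succ n ih => rw [pow_succ]; omega
        exact this L) hm (by
      rw [hc, hd]
      nlinarith))
  refine ⟨h, h0, ?_, ?_, hv⟩
  · intro v hv
    obtain ⟨n, _, rfl⟩ := Finset.mem_image.1 (hsub hv)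
    exact ⟨n, rfl⟩
  · apply Finset.sup_le
    intro v hv
    obtain ⟨n, hn, rfl⟩ := Finset.mem_image.1 (hsub hv)
    have := Finset.mem_range.1 hn
    change (E n).degree ≤ _
    rw [hEd]; omega

/-- Determinant method on a plane curve of degree at least two. -/
lemma aux1 (G : MvPolynomial (Fin 2) ℤ) (hG : 2 ≤ (map (Int.castRingHom ℚ) G).totalDegree) (i : Fin 2)
    (L ρ m A : ℕ) (hL : 1 ≤ L) (u0 : Fin 2 → ℤ)
    (e : ℤ) (he : (ρ:ℤ) ∣ e * eval u0 (pderiv i G) - 1) (hρm : ρ ∣ m) (hmρ : m ∣ ρ ^ A)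
    (hm : 2 ^ (L+5) ≤ m) (S : Set (Fin 2 → ℤ))
    (hS : ∀ x ∈ S, (∀ l, (m:ℤ) ∣ x l - u0 l) ∧ eval x G = 0 ∧ ∀ l, |x l| ≤ 4 ^ L) :
    ∃ h : MvPolynomial (Fin 2) ℚ, ¬ (map (Int.castRingHom ℚ) G) ∣ h ∧ h.totalDegree ≤ L + 1 ∧
      ∀ x ∈ S, eval (fun l => (x l : ℚ)) h = 0 := by
  classical
  set r := map (Int.castRingHom ℚ) G with hr
  have hfin2 : ∀ v : Fin 2 →₀ ℕ, v.degree = v 0 + v 1 := by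
    intro v; rw [Finsupp.degree_eq_sum, Fin.sum_univ_two]
  -- case a
  have caseA : ∀ j j' : Fin 2, j ≠ j' → 2 ≤ r.degreeOf j → ∃ h : MvPolynomial (Fin 2) ℚ, ¬ r ∣ h ∧ h.totalDegree ≤ L + 1 ∧
      ∀ x ∈ S, eval (fun l => (x l : ℚ)) h = 0 := by
    intro j j' hjj hdeg
    have hval : ∀ n, (Finsupp.single j' (n/2) + Finsupp.single j (n % 2) : Fin 2 →₀ ℕ) j = n % 2 := by
      intro n; simp [Finsupp.single_apply, hjj.symm]
    have hval' : ∀ n, (Finsupp.single j' (n/2) + Finsupp.single j (n % 2) : Fin 2 →₀ ℕ) j' = n / 2 := by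
      intro n; simp [Finsupp.single_apply, hjj]
    obtain ⟨h, h0, hs, hd, hv⟩ := aux1_gen G i L ρ m A hL u0 e he hρm hmρ hm S hS
      (fun n => Finsupp.single j' (n/2) + Finsupp.single j (n % 2)) (by
        intro a b hab
        have h1 := hval a
        have h2 := hval' a
        simp only at hab
        rw [hab, hval] at h1
        rw [hab, hval'] at h2
        omega) (by
        intro n
        simp only [map_add, Finsupp.degree_single]
        omega)
    refine ⟨h, ?_, hd, hv⟩
    rintro ⟨w, hw⟩
    have hr0 : r ≠ 0 := by rintro h; rw [h] at hw; simp at hw; exact h0 hw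
    have hw0 : w ≠ 0 := by rintro h; rw [h] at hw; simp at hw; exact h0 hw
    have h1 : h.degreeOf j = r.degreeOf j + w.degreeOf j := by rw [hw, degreeOf_mul_eq hr0 hw0]
    have h2 : h.degreeOf j ≤ 1 := by
      rw [degreeOf_le_iff]
      intro v hv
      obtain ⟨n, rfl⟩ := hs v hv
      rw [hval]; omega
    omega
  by_cases hd1 : 2 ≤ r.degreeOf 1
  · exact caseA 1 0 (by decide) hd1
  by_cases hd0 : 2 ≤ r.degreeOf 0
  · exact caseA 0 1 (by decide) hd0
  -- bilinear
  have hval : ∀ n, (Finsupp.single (0 : Fin 2) ((1 - n % 2) * (n / 2)) + Finsupp.single 1 ((n % 2) * ((n+1) / 2)) : Fin 2 →₀ ℕ) 0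
      = (1 - n % 2) * (n / 2) := by
    intro n; simp [Finsupp.single_apply]
  have hval' : ∀ n, (Finsupp.single (0 : Fin 2) ((1 - n % 2) * (n / 2)) + Finsupp.single 1 ((n % 2) * ((n+1) / 2)) : Fin 2 →₀ ℕ) 1
      = (n % 2) * ((n+1) / 2) := by
    intro n; simp [Finsupp.single_apply]
  obtain ⟨h, h0, hs, hd, hv⟩ := aux1_gen G i L ρ m A hL u0 e he hρm hmρ hm S hS
      (fun n => Finsupp.single 0 ((1 - n % 2) * (n / 2)) + Finsupp.single 1 ((n % 2) * ((n+1) / 2))) (by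
        intro a b hab
        have h1 := hval a
        have h2 := hval' a
        simp only at hab
        rw [hab, hval] at h1
        rw [hab, hval'] at h2
        rcases Nat.mod_two_eq_zero_or_one a with ha | ha <;> rcases Nat.mod_two_eq_zero_or_one b with hb | hb <;>
        simp [ha, hb] at h1 h2 <;> omega) (by
        intro n
        simp only [map_add, Finsupp.degree_single]
        rcases Nat.mod_two_eq_zero_or_one n with ha | ha <;> simp [ha]; omega)
  refine ⟨h, ?_, hd, hv⟩
  rintro ⟨w, hw⟩
  have hr0 : r ≠ 0 := by rintro h; rw [h] at hw; simp at hw; exact h0 hw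
  have hw0 : w ≠ 0 := by rintro h; rw [h] at hw; simp at hw; exact h0 hw
  -- leading coefficients with respect to x
  have hlc : (finSuccEquiv ℚ 1 h).leadingCoeff = (finSuccEquiv ℚ 1 r).leadingCoeff * (finSuccEquiv ℚ 1 w).leadingCoeff := by
    rw [hw, map_mul, Polynomial.leadingCoeff_mul]
  -- the monomial xy
  obtain ⟨v, hvs, hvd⟩ : ∃ v ∈ r.support, 2 ≤ v.degree := by
    by_contra hcon
    push Not at hcon
    have : r.totalDegree ≤ 1 := Finset.sup_le fun v hv => by
      have := hcon v hv
      change v.degree ≤ 1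
      omega
    omega
  have hv0 : v 0 ≤ 1 := (monomial_le_degreeOf 0 hvs).trans (by omega)
  have hv1 : v 1 ≤ 1 := (monomial_le_degreeOf 1 hvs).trans (by omega)
  rw [hfin2] at hvd
  have hnd : (finSuccEquiv ℚ 1 r).natDegree = 1 := by
    rw [natDegree_finSuccEquiv]
    have := monomial_le_degreeOf 0 hvs
    omega
  have hcoef : coeff (Finsupp.single 0 1) ((finSuccEquiv ℚ 1 r).coeff 1) ≠ 0 := by
    rw [finSuccEquiv_coeff_coeff]
    have : Finsupp.cons 1 (Finsupp.single 0 1) = v := by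
      ext l; fin_cases l
      · simp; omega
      · change Finsupp.cons 1 (Finsupp.single 0 1) (Fin.succ 0) = v 1
        rw [Finsupp.cons_succ]; simp; omega
    rw [this]; exact mem_support_iff.1 hvs
  have hrl : 1 ≤ (finSuccEquiv ℚ 1 r).leadingCoeff.totalDegree := by
    rw [Polynomial.leadingCoeff, hnd]
    have := le_totalDegree (mem_support_iff.2 hcoef)
    simpa using this
  have hhn : 1 ≤ (finSuccEquiv ℚ 1 h).natDegree := by
    rw [hw, map_mul, Polynomial.natDegree_mul, hnd]
    · omega
    · simpa using hr0
    · simpa using hw0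
  have hhl : (finSuccEquiv ℚ 1 h).leadingCoeff.totalDegree = 0 := by
    rw [← Nat.le_zero]
    apply Finset.sup_le
    intro u hu
    rw [Polynomial.leadingCoeff, mem_support_coeff_finSuccEquiv] at hu
    obtain ⟨n, hn⟩ := hs _ hu
    have e0 := DFunLike.congr_fun hn 0
    have e1 := DFunLike.congr_fun hn 1
    rw [hval] at e0
    rw [hval'] at e1
    rw [Finsupp.cons_zero] at e0
    change Finsupp.cons _ u (Fin.succ 0) = _ at e1
    rw [Finsupp.cons_succ] at e1
    change u.degree ≤ 0
    rw [Finsupp.degree_eq_sum]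
    simp only [Fin.sum_univ_one]
    rcases Nat.mod_two_eq_zero_or_one n with ha | ha <;> simp [ha] at e0 e1 <;> omega
  rw [hlc, totalDegree_mul_of_isDomain] at hhl
  · omega
  · simpa using hr0
  · simpa using hw0
end DG


namespace DG
open MvPolynomial

/-- cast of an integer point -/
def qp {σ : Type*} (x : σ → ℤ) : σ → ℚ := fun l => (x l : ℚ)

/-- cast of an integral polynomial -/
noncomputable def toQ {σ : Type*} (g : MvPolynomial σ ℤ) : MvPolynomial σ ℚ := map (Int.castRingHom ℚ) g

lemma eval_qp {σ : Type*} (x : σ → ℤ) (g : MvPolynomial σ ℤ) : eval (qp x) (toQ g) = ((eval x g : ℤ) : ℚ) := by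
  have := (eval₂_comp_left (Int.castRingHom ℚ) (RingHom.id ℤ) x g)
  simp only [toQ, eval_map, qp]
  rw [eval₂_id] at this
  simp only [eq_intCast, RingHom.comp_id] at this
  rw [this]; rfl

lemma eval_qp_zero {σ : Type*} (x : σ → ℤ) (g : MvPolynomial σ ℤ) : eval (qp x) (toQ g) = 0 ↔ eval x g = 0 := by
  rw [eval_qp]; exact Int.cast_eq_zero

lemma qp_injective {σ : Type*} : Function.Injective (qp (σ := σ)) := by
  intro a b h
  funext l
  have := congrFun h l
  simp only [qp] at this
  exact_mod_cast this

lemma toQ_pderiv {σ : Type*} (i : σ) (g : MvPolynomial σ ℤ) : pderiv i (toQ g) = toQ (pderiv i g) := by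
  simp [toQ, pderiv_map]

/-- restriction to a coordinate line -/
noncomputable def restr {k : ℕ} (i : Fin k) (x : Fin k → ℚ) (F : MvPolynomial (Fin k) ℚ) : Polynomial ℚ :=
  aeval (fun l => if l = i then Polynomial.X else Polynomial.C (x l)) F

lemma restr_eval {k : ℕ} (i : Fin k) (x : Fin k → ℚ) (F : MvPolynomial (Fin k) ℚ) (t : ℚ) :
    (restr i x F).eval t = eval (Function.update x i t) F := by
  rw [restr, ← Polynomial.coe_aeval_eq_eval, aeval_def, ← coe_eval₂Hom]
  have : (Polynomial.aeval t : Polynomial ℚ →ₐ[ℚ] ℚ) ((eval₂Hom (algebraMap ℚ (Polynomial ℚ)) (fun l => if l = i then Polynomial.X else Polynomial.C (x l))) F)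
    = ((Polynomial.aeval t : Polynomial ℚ →ₐ[ℚ] ℚ).comp (aeval (fun l => if l = i then Polynomial.X else Polynomial.C (x l)))) F := rfl
  rw [this]
  have h2 : ((Polynomial.aeval t : Polynomial ℚ →ₐ[ℚ] ℚ).comp (aeval (fun l => if l = i then Polynomial.X else Polynomial.C (x l)))) = aeval (Function.update x i t) := by
    apply MvPolynomial.algHom_ext
    intro l
    by_cases h : l = i
    · subst h; simp
    · simp [h]
  rw [h2]; rfl

lemma restr_natDegree {k : ℕ} (i : Fin k) (x : Fin k → ℚ) (F : MvPolynomial (Fin k) ℚ) :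
    (restr i x F).natDegree ≤ F.totalDegree := by
  have := aeval_natDegree_le (n := 1) F le_rfl (fun l => if l = i then (Polynomial.X : Polynomial ℚ) else Polynomial.C (x l)) (by
    intro l; split_ifs <;> simp)
  rw [mul_one] at this
  exact this

lemma restr_ne_zero {k : ℕ} (i : Fin k) (x : Fin k → ℚ) (F : MvPolynomial (Fin k) ℚ) (d : ℕ) (hd : F.totalDegree ≤ d)
    (hc : coeff (Finsupp.single i d) F ≠ 0) : restr i x F ≠ 0 := by
  classical
  intro h0
  have h1 : (restr i x F).coeff d = coeff (Finsupp.single i d) F := by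
    rw [restr, aeval_def, eval₂_eq', Polynomial.finsetSum_coeff]
    rw [Finset.sum_eq_single (Finsupp.single i d)]
    · rw [Finset.prod_eq_single i]
      · simp
      · intro b _ hb
        simp [Finsupp.single_apply, hb.symm]
      · simp
    · intro v hv hne
      rw [← Finset.mul_prod_erase _ _ (Finset.mem_univ i)]
      have : ∏ l ∈ Finset.univ.erase i, (if l = i then Polynomial.X else Polynomial.C (x l)) ^ v l =
        Polynomial.C (∏ l ∈ Finset.univ.erase i, (x l) ^ v l) := by
        rw [map_prod]
        refine Finset.prod_congr rfl fun l hl => ?_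
        rw [if_neg (Finset.ne_of_mem_erase hl), map_pow]
      rw [this]
      simp only [if_true, Polynomial.algebraMap_eq]
      rw [Polynomial.coeff_C_mul, Polynomial.coeff_mul_C, Polynomial.coeff_X_pow]
      have hvi : d ≠ v i := by
        intro hvi
        apply hne
        have hdeg : v.degree ≤ d := (le_totalDegree hv).trans hd
        rw [Finsupp.degree_eq_sum, ← Finset.add_sum_erase _ _ (Finset.mem_univ i)] at hdeg
        have hz : ∑ l ∈ Finset.univ.erase i, v l = 0 := by omega
        rw [Finset.sum_eq_zero_iff] at hz
        ext l
        by_cases hl : l = i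
        · subst hl; simp [hvi]
        · rw [hz l (by simp [hl])]; simp [Finsupp.single_apply, Ne.symm hl]
      simp [hvi]
    · intro h; rw [notMem_support_iff.1 h]; simp
  rw [h0] at h1
  exact hc h1.symm

lemma fiber_le {k : ℕ} (i : Fin (k+1)) (F : MvPolynomial (Fin (k+1)) ℚ) (d : ℕ) (hd : F.totalDegree ≤ d)
    (hc : coeff (Finsupp.single i d) F ≠ 0) (T : Finset (Fin (k+1) → ℚ)) (hT : ∀ x ∈ T, eval x F = 0)
    (hπ : ∀ x ∈ T, ∀ y ∈ T, ∀ l, x (i.succAbove l) = y (i.succAbove l)) : T.card ≤ d := by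
  classical
  rcases T.eq_empty_or_nonempty with rfl | ⟨x0, hx0⟩
  · simp
  have hne := restr_ne_zero i x0 F d hd hc
  have hup : ∀ x ∈ T, Function.update x0 i (x i) = x := by
    intro x hx
    funext l
    refine Fin.succAboveCases i ?_ (fun l => ?_) l
    · simp
    · simp [Fin.succAbove_ne, hπ x hx x0 hx0 l]
  have h1 : T.card ≤ (restr i x0 F).roots.toFinset.card := by
    apply Finset.card_le_card_of_injOn (fun x => x i)
    · intro x hx
      simp only [Finset.mem_coe, Multiset.mem_toFinset, Polynomial.mem_roots hne, Polynomial.IsRoot.def, restr_eval]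
      rw [hup x hx]; exact hT x hx
    · intro x hx y hy h
      rw [← hup x hx, ← hup y hy]; simp only at h; rw [h]
  exact h1.trans ((Multiset.toFinset_card_le _).trans ((Polynomial.card_roots' _).trans
    ((restr_natDegree _ _ _).trans hd)))

lemma proj_card_le {k : ℕ} (i : Fin (k+1)) (F : MvPolynomial (Fin (k+1)) ℚ) (d : ℕ) (hd : F.totalDegree ≤ d)
    (hc : coeff (Finsupp.single i d) F ≠ 0) (T : Finset (Fin (k+1) → ℚ)) (hT : ∀ x ∈ T, eval x F = 0) [DecidableEq (Fin k → ℚ)] :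
    T.card ≤ d * (T.image (fun x l => x (i.succAbove l))).card := by
  classical
  refine Finset.card_le_mul_card_image T d ?_
  intro b _
  refine fiber_le i F d hd hc _ (fun x hx => hT x (Finset.mem_of_mem_filter _ hx)) ?_
  intro x hx y hy l
  have h1 := (Finset.mem_filter.1 hx).2
  have h2 := (Finset.mem_filter.1 hy).2
  exact congrFun (h1.trans h2.symm) l

/-- integral version: points over a set of projected points -/
lemma proj_card_le_int (i : Fin 3) (F : MvPolynomial (Fin 3) ℚ) (hd : F.totalDegree ≤ 4)
    (hc : coeff (Finsupp.single i 4) F ≠ 0) (T : Finset (Fin 3 → ℤ)) (hT : ∀ x ∈ T, eval (qp x) F = 0)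
    (N : ℕ) (hN : ∀ U : Finset (Fin 2 → ℚ), (∀ y ∈ U, ∃ x ∈ T, y = fun l => qp x (i.succAbove l)) → U.card ≤ N) :
    T.card ≤ 4 * N := by
  classical
  rw [← Finset.card_image_of_injective T qp_injective]
  refine (proj_card_le i F 4 hd hc _ ?_).trans (Nat.mul_le_mul_left 4 (hN _ ?_))
  · intro x hx
    obtain ⟨y, hy, rfl⟩ := Finset.mem_image.1 hx
    exact hT y hy
  · intro y hy
    obtain ⟨x, hx, rfl⟩ := Finset.mem_image.1 hy
    obtain ⟨z, hz, rfl⟩ := Finset.mem_image.1 hx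
    exact ⟨z, hz, rfl⟩

noncomputable def boxQ (B : ℕ) : Finset ℚ := (Finset.Icc (-(B:ℤ)) B).image (fun t : ℤ => (t:ℚ))

lemma boxQ_card (B : ℕ) : (boxQ B).card = 2 * B + 1 := by
  rw [boxQ, Finset.card_image_of_injective _ Int.cast_injective]
  simp; omega

lemma mem_boxQ {B : ℕ} {t : ℤ} (h : |t| ≤ B) : (t:ℚ) ∈ boxQ B :=
  Finset.mem_image.2 ⟨t, by rw [Finset.mem_Icc]; exact abs_le.1 h, rfl⟩

lemma count3 (i : Fin 3) (F G : MvPolynomial (Fin 3) ℚ) (hF : Irreducible F) (hd : F.totalDegree ≤ 4)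
    (hc : coeff (Finsupp.single i 4) F ≠ 0) (hFG : ¬ F ∣ G) (e : ℕ) (he : G.totalDegree ≤ e)
    (T : Finset (Fin 3 → ℤ)) (B : ℕ) (hT : ∀ x ∈ T, eval (qp x) F = 0 ∧ eval (qp x) G = 0 ∧ ∀ l, |x l| ≤ B) :
    T.card ≤ 4 * ((4 + e) ^ 2 * (2 * B + 1)) := by
  obtain ⟨r, hr0, hrd, hr⟩ := elim i F G 4 e hF hFG hd he
  refine proj_card_le_int i F hd hc T (fun x hx => (hT x hx).1) _ ?_
  intro U hU
  have := zeros_box_le r hr0 (boxQ B) U (by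
    intro y hy
    obtain ⟨x, hx, rfl⟩ := hU y hy
    exact ⟨hr (qp x) (hT x hx).1 (hT x hx).2.1, fun l => mem_boxQ ((hT x hx).2.2 _)⟩)
  rw [boxQ_card, pow_one] at this
  exact this.trans (Nat.mul_le_mul_right _ hrd)

lemma transversal (k a : Fin 3) (hak : a ≠ k) (F G : MvPolynomial (Fin 3) ℚ) (hF : Irreducible F) (hd : F.totalDegree ≤ 4)
    (hc : coeff (Finsupp.single k 4) F ≠ 0) (hFG : ¬ F ∣ G) (e : ℕ) (he : G.totalDegree ≤ e) :
    ∃ t : ℚ, t ≠ 0 ∧ ∀ T : Finset (Fin 3 → ℚ), (∀ y ∈ T, eval y F = 0 ∧ eval y G = 0 ∧ y a = t) →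
      T.card ≤ 4 * (4 + e) ^ 2 := by
  classical
  obtain ⟨r, hr0, hrd, hr⟩ := elim k F G 4 e hF hFG hd he
  obtain ⟨a', ha'⟩ := Fin.exists_succAbove_eq hak
  obtain ⟨b', hb'⟩ : ∃ b' : Fin 2, ∀ l : Fin 2, l ≠ a' → l = b' := by
    fin_cases a'
    · exact ⟨1, by decide⟩
    · exact ⟨0, by decide⟩
  by_cases hab : a' = b'
  · exfalso
    have h1 : ∀ l : Fin 2, l = b' := fun l => by
      by_cases h : l = a'
      · rw [h, hab]
      · exact hb' l h
    have := (h1 0).trans (h1 1).symm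
    exact absurd this (by decide)
  have hne : r * X a' ≠ 0 := mul_ne_zero hr0 (X_ne_zero _)
  obtain ⟨w, hw⟩ : ∃ w, eval w (r * X a') ≠ 0 := by
    by_contra hcon
    push Not at hcon
    exact hne (MvPolynomial.funext (fun w => by rw [hcon w, map_zero]))
  simp only [map_mul, eval_X] at hw
  refine ⟨w a', right_ne_zero_of_mul hw, fun T hT => ?_⟩
  have hq : restr b' w r ≠ 0 := by
    intro h
    have := restr_eval b' w r (w b')
    rw [h, Function.update_eq_self] at this
    simp at this
    exact left_ne_zero_of_mul hw this.symm
  refine (proj_card_le k F 4 hd hc T (fun x hx => (hT x hx).1)).trans (Nat.mul_le_mul_left 4 ?_)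
  have h1 : (T.image (fun x l => x (k.succAbove l))).card ≤ (restr b' w r).roots.toFinset.card := by
    have hup : ∀ y ∈ T.image (fun x l => x (k.succAbove l)), Function.update w b' (y b') = y := by
      intro y hy
      obtain ⟨x, hx, rfl⟩ := Finset.mem_image.1 hy
      funext l
      by_cases hl : l = a'
      · subst hl
        rw [Function.update_of_ne hab]
        simp only [ha']
        exact (hT x hx).2.2.symm
      · rw [hb' l hl]; simp
    apply Finset.card_le_card_of_injOn (fun y => y b')
    · intro y hy
      simp only [Finset.mem_coe, Multiset.mem_toFinset, Polynomial.mem_roots hq, Polynomial.IsRoot.def, restr_eval]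
      rw [hup y hy]
      obtain ⟨x, hx, rfl⟩ := Finset.mem_image.1 hy
      exact hr x (hT x hx).1 (hT x hx).2.1
    · intro x hx y hy h
      rw [← hup x hx, ← hup y hy]; simp only at h; rw [h]
  exact h1.trans ((Multiset.toFinset_card_le _).trans ((Polynomial.card_roots' _).trans
    ((restr_natDegree _ _ _).trans hrd)))
end DG


namespace DG
open MvPolynomial

/-- polynomially bounded functions of `L ≥ 1` -/
def PB (f : ℕ → ℕ) : Prop := ∃ c k : ℕ, ∀ L, 1 ≤ L → f L ≤ c * L ^ k

lemma PB.const (c : ℕ) : PB (fun _ => c) := ⟨c, 0, fun L _ => by simp⟩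
lemma PB.id : PB (fun L => L) := ⟨1, 1, fun L _ => by simp⟩
lemma PB.mono {f g : ℕ → ℕ} (hg : PB g) (h : ∀ L, 1 ≤ L → f L ≤ g L) : PB f := by
  obtain ⟨c, k, hc⟩ := hg
  exact ⟨c, k, fun L hL => (h L hL).trans (hc L hL)⟩
lemma PB.add {f g : ℕ → ℕ} (hf : PB f) (hg : PB g) : PB (fun L => f L + g L) := by
  obtain ⟨c, k, hc⟩ := hf
  obtain ⟨c', k', hc'⟩ := hg
  refine ⟨c + c', k + k', fun L hL => ?_⟩
  have h1 := hc L hL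
  have h2 := hc' L hL
  have h3 : L ^ k ≤ L ^ (k + k') := Nat.pow_le_pow_right hL (by omega)
  have h4 : L ^ k' ≤ L ^ (k + k') := Nat.pow_le_pow_right hL (by omega)
  rw [add_mul]
  exact add_le_add (h1.trans (Nat.mul_le_mul_left _ h3)) (h2.trans (Nat.mul_le_mul_left _ h4))
lemma PB.mul {f g : ℕ → ℕ} (hf : PB f) (hg : PB g) : PB (fun L => f L * g L) := by
  obtain ⟨c, k, hc⟩ := hf
  obtain ⟨c', k', hc'⟩ := hg
  refine ⟨c * c', k + k', fun L hL => ?_⟩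
  calc f L * g L ≤ (c * L ^ k) * (c' * L ^ k') := Nat.mul_le_mul (hc L hL) (hc' L hL)
    _ = _ := by ring
lemma PB.pow {f : ℕ → ℕ} (hf : PB f) (n : ℕ) : PB (fun L => f L ^ n) := by
  induction n with
  | zero => simpa using PB.const 1
  | succ n ih => simpa [pow_succ] using ih.mul hf

/-- bound for the primes in the pool -/
def Qn (X : ℕ) : ℕ := 64 * (X + 1) ^ 2

lemma primeCounting_big (X : ℕ) : X < Nat.primeCounting (Qn X) := by
  have h := Chebyshev.pi_ge (Qn X)
  have hn : ((Qn X : ℕ) : ℝ) = 64 * ((X:ℝ) + 1) ^ 2 := by simp [Qn]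
  have hX : (0:ℝ) ≤ X := Nat.cast_nonneg X
  have hn1 : (64:ℝ) ≤ (Qn X : ℕ) := by rw [hn]; nlinarith
  have hlogpos : 0 < Real.log (Qn X : ℕ) := Real.log_pos (by linarith)
  have hlog : Real.log (Qn X : ℕ) ≤ 16 * ((X:ℝ)+1) := by
    have e : Real.log (Qn X : ℕ) = 2 * Real.log (8 * ((X:ℝ)+1)) := by
      rw [hn, ← Real.log_rpow (by positivity)]
      congr 1
      norm_num
      ring
    have := Real.log_le_sub_one_of_pos (x := 8 * ((X:ℝ)+1)) (by positivity)
    rw [e]; linarith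
  have hlog2 : Real.log ((Qn X : ℕ) + 1) ≤ 2 * Real.log (Qn X : ℕ) := by
    rw [show 2 * Real.log (Qn X : ℕ) = Real.log (((Qn X : ℕ):ℝ)^2) by rw [Real.log_pow]; norm_num]
    apply Real.log_le_log (by linarith)
    nlinarith
  have hl2 := Real.log_two_gt_d9
  have : (X:ℝ) < Nat.primeCounting (Qn X) := by
    refine lt_of_lt_of_le ?_ h
    rw [lt_div_iff₀ hlogpos]
    have h1 : ((X:ℝ) + 2) * Real.log (Qn X : ℕ) ≤ (X+2) * (16 * ((X:ℝ)+1)) := by gcongr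
    have h2 : 64 * ((X:ℝ) + 1) ^ 2 * 0.69 ≤ (Qn X : ℕ) * Real.log 2 := by
      rw [hn]
      apply mul_le_mul_of_nonneg_left _ (by positivity)
      linarith
    nlinarith
  exact_mod_cast this

lemma pool (X : ℕ) (W : ℤ) (hW : W ≠ 0) (hWX : |W| ≤ 2 ^ X) : ∃ p : ℕ, p.Prime ∧ p ≤ Qn X ∧ ¬ (p:ℤ) ∣ W := by
  by_contra hcon
  push Not at hcon
  have h0 : W.natAbs ≠ 0 := by simpa using hW
  have hsub : Nat.primesLE (Qn X) ⊆ W.natAbs.primeFactors := by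
    intro p hp
    rw [Nat.mem_primesLE] at hp
    rw [Nat.mem_primeFactors]
    exact ⟨hp.2, Int.natCast_dvd.1 (hcon p hp.2 hp.1), h0⟩
  have h1 : 2 ^ (Nat.primesLE (Qn X)).card ≤ W.natAbs := by
    calc 2 ^ (Nat.primesLE (Qn X)).card ≤ ∏ p ∈ Nat.primesLE (Qn X), p := by
          rw [← Finset.prod_const]
          exact Finset.prod_le_prod' (fun p hp => (Nat.mem_primesLE.1 hp).2.two_le)
      _ ≤ ∏ p ∈ W.natAbs.primeFactors, p :=
          Finset.prod_le_prod_of_subset_of_one_le' hsub (fun p hp _ => (Nat.prime_of_mem_primeFactors hp).one_le)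
      _ ≤ W.natAbs := Nat.le_of_dvd (Nat.pos_of_ne_zero h0) (Nat.prod_primeFactors_dvd _)
  have h2 : W.natAbs ≤ 2 ^ X := by zify; simpa using hWX
  have h3 := (Nat.pow_le_pow_iff_right (by norm_num : 1 < 2)).1 (h1.trans h2)
  have h4 := primeCounting_big X
  have h5 : (Nat.primesLE (Qn X)).card = Nat.primeCounting (Qn X) := by
    exact Nat.primesLE_card_eq_primeCounting (Qn X)
  omega

lemma card_exps {k : ℕ} {R : Type*} [CommSemiring R] (G : MvPolynomial (Fin k) R) (d : ℕ) (hd : G.totalDegree ≤ d) :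
    G.support.card ≤ (d + 1) ^ k := by
  classical
  have : (d+1)^k = (Fintype.piFinset (fun _ : Fin k => Finset.range (d+1))).card := by
    rw [Fintype.card_piFinset]; simp
  rw [this]
  apply Finset.card_le_card_of_injOn (fun m : Fin k →₀ ℕ => (m : Fin k → ℕ))
  · intro m hm
    simp only [Finset.mem_coe, Fintype.mem_piFinset, Finset.mem_range]
    intro l
    have h1 : m.degree ≤ d := (le_totalDegree hm).trans hd
    have := Finsupp.le_degree l m
    omega
  · intro a _ b _ h
    exact DFunLike.coe_injective h

lemma abs_monomial_le {k : ℕ} (m : Fin k →₀ ℕ) (d B : ℕ) (hB : 1 ≤ B) (hm : m.degree ≤ d) (x : Fin k → ℤ) (hx : ∀ l, |x l| ≤ B) :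
    |∏ l, x l ^ m l| ≤ (B:ℤ) ^ d := by
  rw [Finset.abs_prod]
  calc ∏ l, |x l ^ m l| ≤ ∏ l, (B:ℤ) ^ m l := by
        apply Finset.prod_le_prod (fun _ _ => abs_nonneg _)
        intro l _
        rw [abs_pow]
        exact pow_le_pow_left₀ (abs_nonneg _) (hx l) _
    _ = (B:ℤ) ^ m.degree := by rw [Finset.prod_pow_eq_pow_sum, Finsupp.degree_eq_sum]
    _ ≤ _ := pow_le_pow_right₀ (by exact_mod_cast hB) hm

lemma abs_eval_le {k : ℕ} (G : MvPolynomial (Fin k) ℤ) (d Hh B : ℕ) (hd : G.totalDegree ≤ d) (hc : ∀ m, |coeff m G| ≤ Hh)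
    (hB : 1 ≤ B) (x : Fin k → ℤ) (hx : ∀ l, |x l| ≤ B) : |eval x G| ≤ (((d+1)^k * (Hh * B^d) : ℕ) : ℤ) := by
  rw [eval_eq']
  refine (Finset.abs_sum_le_sum_abs _ _).trans ?_
  have : ∀ m ∈ G.support, |coeff m G * ∏ l, x l ^ m l| ≤ ((Hh * B^d : ℕ) : ℤ) := by
    intro m hm
    rw [abs_mul]
    push_cast
    exact mul_le_mul (hc m) (abs_monomial_le m d B hB ((le_totalDegree hm).trans hd) x hx) (abs_nonneg _) (Int.natCast_nonneg _)
  refine (Finset.sum_le_card_nsmul _ _ _ this).trans ?_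
  rw [nsmul_eq_mul]
  push_cast
  apply mul_le_mul_of_nonneg_right _ (by positivity)
  exact_mod_cast card_exps G d hd

lemma totalDegree_pderiv_le {k : ℕ} {R : Type*} [CommRing R] (G : MvPolynomial (Fin k) R) (j : Fin k) (d : ℕ) (hd : G.totalDegree ≤ d + 1) :
    (pderiv j G).totalDegree ≤ d := by
  refine Finset.sup_le ?_
  intro m hm
  rw [mem_support_iff, coeff_pderiv] at hm
  have h1 : m + Finsupp.single j 1 ∈ G.support := by
    rw [mem_support_iff]; exact left_ne_zero_of_mul hm
  have h2 := (le_totalDegree h1).trans hd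
  have h3 : (m + Finsupp.single j 1).degree = m.degree + 1 := by simp
  have h4 : (m + Finsupp.single j 1).degree ≤ d + 1 := h2
  have : m.degree ≤ d := by omega
  exact this

lemma coeff_pderiv_le {k : ℕ} (G : MvPolynomial (Fin k) ℤ) (j : Fin k) (d Hh : ℕ) (hd : G.totalDegree ≤ d + 1) (hc : ∀ m, |coeff m G| ≤ Hh) (m : Fin k →₀ ℕ) :
    |coeff m (pderiv j G)| ≤ (((d+1) * Hh : ℕ) : ℤ) := by
  by_cases h0 : coeff m (pderiv j G) = 0
  · rw [h0]; simp
  have h1 := (le_totalDegree (mem_support_iff.2 h0)).trans (totalDegree_pderiv_le G j d hd)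
  have h2 : m j ≤ d := (Finsupp.le_degree j m).trans h1
  rw [coeff_pderiv, abs_mul]
  push_cast
  rw [mul_comm]
  apply mul_le_mul _ (hc _) (abs_nonneg _) (by positivity)
  rw [abs_of_nonneg (by positivity)]
  exact_mod_cast Nat.succ_le_succ h2

lemma abs_eval_pderiv_le {k : ℕ} (G : MvPolynomial (Fin k) ℤ) (j : Fin k) (d Hh B : ℕ) (hd : G.totalDegree ≤ d + 1) (hc : ∀ m, |coeff m G| ≤ Hh)
    (hB : 1 ≤ B) (x : Fin k → ℤ) (hx : ∀ l, |x l| ≤ B) : |eval x (pderiv j G)| ≤ (((d+1)^k * (((d+1)*Hh) * B^d) : ℕ) : ℤ) :=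
  abs_eval_le _ d _ B (totalDegree_pderiv_le G j d hd) (coeff_pderiv_le G j d Hh hd hc) hB x hx

/-- Siegel for polynomials -/
lemma heightPoly {k : ℕ} (d B : ℕ) (hB : 1 ≤ B) (P : MvPolynomial (Fin k) ℚ) (hP : P ≠ 0) (hd : P.totalDegree ≤ d)
    (S : Set (Fin k → ℤ)) (hS : ∀ x ∈ S, (∀ l, |x l| ≤ B) ∧ eval (qp x) P = 0) :
    ∃ G : MvPolynomial (Fin k) ℤ, G ≠ 0 ∧ G.totalDegree ≤ d ∧ (∀ m, |coeff m G| ≤ ((((d+1)^k * B^d)^((d+1)^k) : ℕ) : ℤ)) ∧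
      ∀ x ∈ S, eval x G = 0 := by
  classical
  set ι := {m : Fin k →₀ ℕ // m ∈ P.support}
  have hdeg : ∀ i : ι, i.1.degree ≤ d := fun i => (le_totalDegree i.2).trans hd
  have hcard : Fintype.card ι ≤ (d+1)^k := by
    rw [Fintype.card_coe]; exact card_exps P d hd
  obtain ⟨b, hb0, hbn, hbv⟩ := height_lemma (fun (i : ι) (x : Fin k → ℤ) => ∏ l, x l ^ (i.1 l)) S (B^d) (Nat.one_le_pow _ _ hB)
    (fun i x hx => by
      have := abs_monomial_le i.1 d B hB (hdeg i) x (hS x hx).1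
      exact_mod_cast this) (fun i => coeff i.1 P)
    (by
      intro h
      obtain ⟨m, hm⟩ := (support_nonempty.2 hP)
      exact (mem_support_iff.1 hm) (congrFun h ⟨m, hm⟩))
    (by
      intro x hx
      have := (hS x hx).2
      rw [eval_eq', ← Finset.sum_coe_sort] at this
      rw [← this]
      refine Finset.sum_congr rfl fun i _ => ?_
      simp [qp])
  have hco : ∀ m, coeff m (∑ i : ι, monomial i.1 (b i)) = if h : m ∈ P.support then b ⟨m, h⟩ else 0 := by
    intro m
    rw [coeff_sum]
    split_ifs with h
    · rw [Finset.sum_eq_single ⟨m, h⟩]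
      · simp
      · intro i _ hi
        rw [coeff_monomial, if_neg]
        intro h'; exact hi (Subtype.ext h')
      · simp
    · apply Finset.sum_eq_zero
      intro i _
      rw [coeff_monomial, if_neg]
      intro h'; exact h (h' ▸ i.2)
  have hY : 1 ≤ (d+1)^k * B^d := Nat.mul_pos (by positivity) (by positivity)
  refine ⟨∑ i : ι, monomial i.1 (b i), ?_, ?_, ?_, ?_⟩
  · intro h
    apply hb0
    funext i
    have := hco i.1
    rw [h, dif_pos i.2] at this
    simpa using this.symm
  · refine (totalDegree_finsetSum _ _).trans (Finset.sup_le fun i _ => ?_)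
    refine (totalDegree_monomial_le _ _).trans (hdeg i)
  · intro m
    rw [hco]
    split_ifs with h
    · refine (hbn _).trans ?_
      norm_cast
      calc _ ≤ ((d+1)^k * B^d)^(Fintype.card ι) := Nat.pow_le_pow_left (Nat.mul_le_mul_right _ hcard) _
        _ ≤ _ := Nat.pow_le_pow_right hY hcard
    · rw [abs_zero]; positivity
  · intro x hx
    rw [map_sum, ← hbv x hx]
    refine Finset.sum_congr rfl fun i _ => ?_
    rw [eval_monomial, Finsupp.prod_fintype _ _ (by simp)]

/-- canonical representatives of the irreducible factors -/
noncomputable def canon {k : ℕ} (r : MvPolynomial (Fin k) ℚ) : MvPolynomial (Fin k) ℚ := Quotient.out (Associates.mk r)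

lemma canon_assoc {k : ℕ} (r : MvPolynomial (Fin k) ℚ) : Associated (canon r) r := by
  rw [← Associates.mk_eq_mk_iff_associated]
  exact Quotient.out_eq _

lemma canon_eq {k : ℕ} {r s : MvPolynomial (Fin k) ℚ} (h : Associated r s) : canon r = canon s := by
  rw [canon, canon, Associates.mk_eq_mk_iff_associated.2 h]

open Classical in
noncomputable def facs {k : ℕ} (R : MvPolynomial (Fin k) ℚ) : Finset (MvPolynomial (Fin k) ℚ) :=
  ((UniqueFactorizationMonoid.factors R).map canon).toFinset

lemma mem_facs {k : ℕ} {R r : MvPolynomial (Fin k) ℚ} (h : r ∈ facs R) : Irreducible r ∧ r ∣ R ∧ canon r = r := by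
  classical
  rw [facs, Multiset.mem_toFinset, Multiset.mem_map] at h
  obtain ⟨s, hs, rfl⟩ := h
  have ha := canon_assoc s
  exact ⟨ha.irreducible_iff.2 (UniqueFactorizationMonoid.irreducible_of_factor s hs),
    ha.dvd.trans (UniqueFactorizationMonoid.dvd_of_mem_factors hs), canon_eq ha⟩

lemma facs_ndvd {k : ℕ} {R R' r r' : MvPolynomial (Fin k) ℚ} (h : r ∈ facs R) (h' : r' ∈ facs R') (hne : r ≠ r') : ¬ r ∣ r' := by
  intro hd
  have ha : Associated r r' := ((mem_facs h).1.dvd_irreducible_iff_associated (mem_facs h').1).1 hd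
  apply hne
  rw [← (mem_facs h).2.2, ← (mem_facs h').2.2, canon_eq ha]

lemma exists_facs_vanish {k : ℕ} {R : MvPolynomial (Fin k) ℚ} (hR : R ≠ 0) (x : Fin k → ℚ) (hx : eval x R = 0) :
    ∃ r ∈ facs R, eval x r = 0 := by
  classical
  obtain ⟨u, hu⟩ := UniqueFactorizationMonoid.factors_prod hR
  have h1 : eval x (UniqueFactorizationMonoid.factors R).prod = 0 := by
    rw [← hu, map_mul] at hx
    exact (mul_eq_zero.1 hx).resolve_right (by
      have : IsUnit (eval x (u : MvPolynomial (Fin k) ℚ)) := u.isUnit.map _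
      exact this.ne_zero)
  rw [map_multiset_prod, Multiset.prod_eq_zero_iff, Multiset.mem_map] at h1
  obtain ⟨s, hs, hs0⟩ := h1
  refine ⟨canon s, ?_, ?_⟩
  · rw [facs, Multiset.mem_toFinset]; exact Multiset.mem_map_of_mem _ hs
  · obtain ⟨q, hq⟩ := (canon_assoc s).symm.dvd
    rw [hq, map_mul, hs0, zero_mul]

lemma totalDegree_dvd {k : ℕ} {r R : MvPolynomial (Fin k) ℚ} (h : r ∣ R) (hR : R ≠ 0) : r.totalDegree ≤ R.totalDegree := by
  obtain ⟨q, rfl⟩ := h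
  rw [totalDegree_mul_of_isDomain (left_ne_zero_of_mul hR) (right_ne_zero_of_mul hR)]
  omega

lemma totalDegree_pos_of_irreducible {k : ℕ} {r : MvPolynomial (Fin k) ℚ} (h : Irreducible r) : 1 ≤ r.totalDegree := by
  by_contra hc
  have h0 : r.totalDegree = 0 := by omega
  rw [totalDegree_eq_zero_iff_eq_C] at h0
  have hne : coeff 0 r ≠ 0 := by
    intro hz; rw [hz, C_0] at h0; exact h.ne_zero h0
  apply h.not_isUnit
  rw [h0]
  exact (isUnit_iff_ne_zero.2 hne).map C

lemma facs_card {k : ℕ} {R : MvPolynomial (Fin k) ℚ} (hR : R ≠ 0) : (facs R).card ≤ R.totalDegree := by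
  classical
  refine (Multiset.toFinset_card_le _).trans ?_
  rw [Multiset.card_map]
  have key : ∀ s : Multiset (MvPolynomial (Fin k) ℚ), (∀ r ∈ s, Irreducible r) → s.card ≤ s.prod.totalDegree ∧ s.prod ≠ 0 := by
    intro s
    induction s using Multiset.induction_on with
    | empty => intro _; simp
    | cons a s ih =>
      intro h
      have h1 := ih (fun r hr => h r (Multiset.mem_cons_of_mem hr))
      have ha := h a (Multiset.mem_cons_self a s)
      rw [Multiset.card_cons, Multiset.prod_cons, totalDegree_mul_of_isDomain ha.ne_zero h1.2]
      exact ⟨by have := totalDegree_pos_of_irreducible ha; omega, mul_ne_zero ha.ne_zero h1.2⟩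
  refine (key _ (UniqueFactorizationMonoid.irreducible_of_factor)).1.trans ?_
  exact totalDegree_dvd (UniqueFactorizationMonoid.factors_prod hR).dvd hR

end DG


namespace DG
open MvPolynomial

lemma hom_eval {k n : ℕ} {R : Type*} [CommRing R] (F : MvPolynomial (Fin k) R) (hF : F.IsHomogeneous n) (c : R) (v : Fin k → R) :
    eval (fun l => c * v l) F = c ^ n * eval v F := by
  rw [eval_eq', eval_eq', Finset.mul_sum]
  refine Finset.sum_congr rfl fun m hm => ?_
  have h1 : m.degree = n := by
    have := hF (mem_support_iff.1 hm)
    rw [Finsupp.degree_eq_weight_one]; exact this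
  simp only [mul_pow]
  rw [Finset.prod_mul_distrib, Finset.prod_pow_eq_pow_sum, ← Finsupp.degree_eq_sum, h1]
  ring

lemma lift_unique' {k : ℕ} (G : MvPolynomial (Fin (k+1)) ℤ) (i : Fin (k+1)) (ρ m A : ℕ) (u v : Fin (k+1) → ℤ)
    (e : ℤ) (he : (ρ:ℤ) ∣ e * eval u (pderiv i G) - 1) (hρm : ρ ∣ m) (hmρ : m ∣ ρ ^ A)
    (hu : (ρ:ℤ)^(A+1) ∣ eval u G) (hv : (ρ:ℤ)^(A+1) ∣ eval v G) (hi : (ρ:ℤ) ∣ v i - u i)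
    (hl : ∀ l, (m:ℤ) ∣ v (i.succAbove l) - u (i.succAbove l)) : (m:ℤ) ∣ v i - u i := by
  obtain ⟨ψ, hψ⟩ := newton G i ρ u e he A
  have hρm' : (ρ:ℤ) ∣ m := by exact_mod_cast hρm
  have hpow : (m : ℤ) ∣ (ρ:ℤ) ^ (A + 1) := by
    have : m ∣ ρ ^ (A + 1) := hmρ.trans (pow_dvd_pow _ (by omega))
    exact_mod_cast this
  have h1 := hpow.trans (hψ u (fun l => by simp) hu)
  have h2 := hpow.trans (hψ v (fun l => by
    refine Fin.succAboveCases i hi (fun l => hρm'.trans (hl l)) l) hv)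
  have h3 := eval_congr_mod ψ (fun l => v (i.succAbove l)) (fun l => u (i.succAbove l)) m hl
  obtain ⟨a, ha⟩ := h1
  obtain ⟨b, hb⟩ := h2
  obtain ⟨c, hc⟩ := h3
  exact ⟨b + c - a, by linear_combination hb + hc - ha⟩

/-- dehomogenization -/
noncomputable def dehom {R : Type*} [CommRing R] (i : Fin 3) (F : MvPolynomial (Fin 3) R) : MvPolynomial (Fin 2) R :=
  aeval (i.insertNth (α := fun _ => MvPolynomial (Fin 2) R) 1 X) F

lemma eval_dehom {R : Type*} [CommRing R] (i : Fin 3) (F : MvPolynomial (Fin 3) R) (w : Fin 2 → R) :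
    eval w (dehom i F) = eval (i.insertNth (α := fun _ => R) 1 w) F := by
  unfold dehom
  induction F using MvPolynomial.induction_on with
  | C a => simp
  | add p q hp hq => simp only [map_add, hp, hq]
  | mul_X p j hp =>
    simp only [map_mul, hp, aeval_X, eval_X]
    congr 1
    refine Fin.succAboveCases i ?_ (fun l => ?_) j <;> simp

lemma pderiv_dehom {R : Type*} [CommRing R] (i : Fin 3) (j : Fin 2) (F : MvPolynomial (Fin 3) R) :
    pderiv j (dehom i F) = dehom i (pderiv (i.succAbove j) F) := by
  unfold dehom
  induction F using MvPolynomial.induction_on with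
  | C a => simp
  | add p q hp hq => simp only [map_add, hp, hq]
  | mul_X p l hp =>
    simp only [map_mul, aeval_X, Derivation.leibniz, hp, smul_eq_mul, map_add]
    refine Fin.succAboveCases i ?_ (fun l => ?_) l
    · simp [pderiv_X]
    · simp only [Fin.insertNth_apply_succAbove, pderiv_X, Pi.single_apply, Fin.succAbove_right_inj]
      split_ifs <;> simp

/-- one class of directions -/
lemma dir_class (F : MvPolynomial (Fin 3) ℤ) (hF : F.IsHomogeneous 4) (i : Fin 3) (hi2 : i.succAbove 1 = 2)
    (p A l : ℕ) (hp : p.Prime) (hA : 1 ≤ A) (hm : 2 ^ (l+1) ≤ p ^ A) (a : (Fin 3 → ℤ) → ℤ) (S : Set (Fin 3 → ℤ))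
    (hS : ∀ v ∈ S, (∀ l', |v l'| ≤ 2 ^ l) ∧ eval v F = 0 ∧ (p:ℤ)^(3*A+1) ∣ a v * v i - 1 ∧ ¬ (p:ℤ) ∣ eval v (pderiv 2 F))
    (hk : ∀ v ∈ S, ∀ w ∈ S, ((p^A : ℕ):ℤ) ∣ a v * v (i.succAbove 0) - a w * w (i.succAbove 0) ∧
      (p:ℤ) ∣ a v * v 2 - a w * w 2) :
    ∃ b : Fin 3 → ℚ, b ≠ 0 ∧ ∀ v ∈ S, ∑ l, b l * (v (Fin.cons (α := fun _ => Fin 3) i i.succAbove l) : ℚ) = 0 := by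
  rcases S.eq_empty_or_nonempty with rfl | ⟨w, hw⟩
  · exact ⟨fun _ => 1, fun h => by simpa using congrFun h 0, by simp⟩
  set m := p ^ A with hmdef
  have hpZ : Prime (p:ℤ) := Nat.prime_iff_prime_int.1 hp
  have hpa : ∀ v ∈ S, ¬ (p:ℤ) ∣ a v := by
    intro v hv hd
    have h1 : (p:ℤ) ∣ a v * v i - 1 := (dvd_pow_self _ (by omega)).trans (hS v hv).2.2.1
    have h2 : (p:ℤ) ∣ 1 := by
      have := (hd.mul_right (v i)).sub h1
      simpa using this
    exact hpZ.not_dvd_one h2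
  let P : (Fin 3 → ℤ) → Fin 2 → ℤ := fun v j => a v * v (i.succAbove j)
  have hcong : ∀ v ∈ S, ∀ l', (p:ℤ)^(3*A+1) ∣ i.insertNth (α := fun _ => ℤ) 1 (P v) l' - a v * v l' := by
    intro v hv l'
    refine Fin.succAboveCases i ?_ (fun l => ?_) l'
    · simp only [Fin.insertNth_apply_same]
      rw [← dvd_neg, neg_sub]; exact (hS v hv).2.2.1
    · simp [P]
  have hev : ∀ v ∈ S, (p:ℤ)^(3*A+1) ∣ eval (P v) (dehom i F) := by
    intro v hv
    rw [eval_dehom]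
    have h1 := eval_congr_mod F _ _ _ (hcong v hv)
    rw [hom_eval F hF, (hS v hv).2.1, mul_zero, sub_zero] at h1
    exact h1
  have hder : ¬ (p:ℤ) ∣ eval (P w) (pderiv 1 (dehom i F)) := by
    rw [pderiv_dehom, eval_dehom, hi2]
    have h1 := (dvd_pow_self (p:ℤ) (by omega : 3*A+1 ≠ 0)).trans (eval_congr_mod (pderiv 2 F) _ _ _ (hcong w hw))
    rw [hom_eval _ hF.pderiv] at h1
    intro hd
    have h2 := hd.sub h1
    rw [sub_sub_cancel] at h2
    rcases hpZ.dvd_or_dvd h2 with h3 | h3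
    · exact hpa w hw (hpZ.dvd_of_dvd_pow h3)
    · exact (hS w hw).2.2.2 h3
  obtain ⟨e, he⟩ : ∃ e : ℤ, (p:ℤ) ∣ e * eval (P w) (pderiv 1 (dehom i F)) - 1 := by
    have hc : IsCoprime (p:ℤ) (eval (P w) (pderiv 1 (dehom i F))) := (hpZ.coprime_iff_not_dvd).2 hder
    obtain ⟨s, t, hst⟩ := hc
    exact ⟨t, -s, by linear_combination hst⟩
  have hpm : p ∣ m := dvd_pow_self _ (by omega)
  have hlift : ∀ v ∈ S, ∀ j, (m:ℤ) ∣ P v j - P w j := by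
    intro v hv
    have h0 : (m:ℤ) ∣ P v 0 - P w 0 := (hk v hv w hw).1
    have h1 : (m:ℤ) ∣ P v 1 - P w 1 := by
      apply lift_unique' (dehom i F) 1 p m A (P w) (P v) e he hpm dvd_rfl
      · exact (pow_dvd_pow _ (by omega)).trans (hev w hw)
      · exact (pow_dvd_pow _ (by omega)).trans (hev v hv)
      · simp only [P, hi2]; exact (hk v hv w hw).2
      · intro l'
        have : (1 : Fin 2).succAbove l' = 0 := by revert l'; decide
        rw [this]; exact h0
    intro j
    fin_cases j
    · exact h0
    · exact h1
  apply relation_of_det (fun l v => v (Fin.cons (α := fun _ => Fin 3) i i.succAbove l)) S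
  intro V hV
  have hd := class_det_dvd (dehom i F) 1 p m A (P w) e he hpm dvd_rfl 3 (fun ν hν => by
      have := omega1 ν hν
      omega) (Fin.cons (α := fun _ => MvPolynomial (Fin 2) ℤ) 1 X) (fun j => P (V j)) (fun j => hlift _ (hV j))
      (fun j => by rw [mul_comm A 3]; exact hev _ (hV j))
  have hd2 : ((m^3 : ℕ):ℤ) ∣ (Matrix.of fun j l' => a (V j) * V j (Fin.cons (α := fun _ => Fin 3) i i.succAbove l')).det := by
    refine det_congr_mod _ _ _ ?_ hd
    intro j l'
    have hpm3 : ((m^3:ℕ):ℤ) ∣ (p:ℤ)^(3*A+1) := by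
      rw [hmdef, ← pow_mul, mul_comm A 3]
      push_cast
      exact pow_dvd_pow _ (by omega)
    refine Fin.cases ?_ (fun l' => ?_) l'
    · simp only [Matrix.of_apply, Fin.cons_zero, map_one]
      exact hpm3.trans (hS _ (hV j)).2.2.1
    · simp [P]
  have hdm := Matrix.det_mul_column (fun j => a (V j)) (Matrix.of fun j l' => V j (Fin.cons (α := fun _ => Fin 3) i i.succAbove l'))
  simp only [Matrix.of_apply] at hdm
  rw [hdm] at hd2
  have hcop : IsCoprime ((m^3:ℕ):ℤ) (∏ j, a (V j)) := by
    apply IsCoprime.prod_right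
    intro j _
    have : IsCoprime (p:ℤ) (a (V j)) := (hpZ.coprime_iff_not_dvd).2 (hpa _ (hV j))
    rw [hmdef]
    push_cast
    exact (this.pow_left).pow_left
  have hd3 := hcop.dvd_of_dvd_mul_left hd2
  have hb := det_abs_le (Matrix.of fun j l' => V j (Fin.cons (α := fun _ => Fin 3) i i.succAbove l')) (fun _ => 2^l) (fun j l' => (hS _ (hV j)).1 _)
  by_contra hne
  have h5 := Int.le_of_dvd (abs_pos.2 hne) ((dvd_abs _ _).2 hd3)
  have h6 : (8:ℤ) * (2^l)^3 ≤ ((m^3:ℕ):ℤ) := by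
    have : (2^(l+1))^3 ≤ m^3 := Nat.pow_le_pow_left hm 3
    have h7 : (((2^(l+1))^3 : ℕ):ℤ) ≤ ((m^3:ℕ):ℤ) := by exact_mod_cast this
    refine le_trans (le_of_eq ?_) h7
    push_cast; ring
  have h8 : (0:ℤ) < (2^l)^3 := by positivity
  simp [Nat.factorial] at hb
  linarith

lemma totalDegree_eq_four {F : MvPolynomial (Fin 3) ℚ} (hd : F.totalDegree ≤ 4) {i : Fin 3} (hc : coeff (Finsupp.single i 4) F ≠ 0) :
    F.totalDegree = 4 := by
  have h1 := le_totalDegree (mem_support_iff.2 hc)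
  have h2 : (Finsupp.single i 4).degree = 4 := by simp
  have h3 : (Finsupp.single i 4).degree ≤ F.totalDegree := h1
  omega

lemma not_dvd_of_degree {F G : MvPolynomial (Fin 3) ℚ} (hd : F.totalDegree = 4) (hG : G ≠ 0) (hGd : G.totalDegree ≤ 3) : ¬ F ∣ G := by
  intro h
  have := totalDegree_dvd h hG
  omega

lemma pderiv_ne_zero {F : MvPolynomial (Fin 3) ℚ} {i : Fin 3} (hc : coeff (Finsupp.single i 4) F ≠ 0) : pderiv i F ≠ 0 := by
  intro h
  have h1 := coeff_pderiv (i := i) F (Finsupp.single i 3)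
  rw [h, ← Finsupp.single_add] at h1
  simp at h1
  rcases h1 with h1 | h1
  · exact hc h1
  · norm_num at h1

lemma clog_bound (p n : ℕ) (hp : 2 ≤ p) (hn : 2 ≤ n) : 1 ≤ Nat.clog p n ∧ n ≤ p ^ Nat.clog p n ∧ p ^ Nat.clog p n ≤ p * n := by
  have h1 : 1 ≤ Nat.clog p n := Nat.clog_pos hp hn
  refine ⟨h1, Nat.le_pow_clog hp n, ?_⟩
  have h2 := Nat.pow_pred_clog_lt_self hp hn
  calc p ^ Nat.clog p n = p * p ^ (Nat.clog p n).pred := by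
        rw [← pow_succ', Nat.pred_eq_sub_one, Nat.sub_add_cancel h1]
    _ ≤ p * n := Nat.mul_le_mul_left _ h2.le

lemma emod_key {m : ℕ} (hm : 0 < m) (a : ℤ) : (a % m).toNat < m := by
  have h1 := Int.emod_nonneg a (by omega : (m:ℤ) ≠ 0)
  have h2 := Int.emod_lt_of_pos a (by omega : (0:ℤ) < m)
  omega

lemma dvd_of_key {m : ℕ} (hm : 0 < m) (a b : ℤ) (h : (a % m).toNat = (b % m).toNat) : (m:ℤ) ∣ a - b := by
  have h1 := Int.emod_nonneg a (by omega : (m:ℤ) ≠ 0)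
  have h2 := Int.emod_nonneg b (by omega : (m:ℤ) ≠ 0)
  apply Int.ModEq.dvd
  show b % m = a % m
  omega

lemma dirs_count (F : MvPolynomial (Fin 3) ℤ) (hF : F.IsHomogeneous 4) (hirr : Irreducible (toQ F))
    (hc : ∀ i, coeff (Finsupp.single i 4) (toQ F) ≠ 0) (Xn l : ℕ)
    (hX : ∀ v : Fin 3 → ℤ, (∀ j, |v j| ≤ 2^l) → |eval v (pderiv 2 F)| ≤ 2^Xn) (T : Finset (Fin 3 → ℤ))
    (hT : ∀ v ∈ T, Finset.univ.gcd v = 1 ∧ (∀ j, |v j| ≤ 2^l) ∧ eval v F = 0) :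
    T.card ≤ 4 * (49 * (2 * 2^l + 1)) + 100 * (4 * (Qn Xn + 1) * (Qn Xn * 2^(l+1)) * Qn Xn) := by
  classical
  have hdeg : (toQ F).totalDegree ≤ 4 := by
    have : (toQ F).IsHomogeneous 4 := hF.map _
    exact this.totalDegree_le
  have hdeg4 := totalDegree_eq_four hdeg (hc 2)
  have hpd : (pderiv 2 (toQ F)).totalDegree ≤ 3 := totalDegree_pderiv_le _ _ _ hdeg
  set T0 := T.filter (fun v => eval v (pderiv 2 F) = 0)
  set T1 := T.filter (fun v => ¬ eval v (pderiv 2 F) = 0)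
  have hT0 : T0.card ≤ 4 * (49 * (2 * 2^l + 1)) := by
    have := count3 2 (toQ F) (pderiv 2 (toQ F)) hirr hdeg (hc 2) (not_dvd_of_degree hdeg4 (pderiv_ne_zero (hc 2)) hpd) 3 hpd T0 (2^l) (by
      intro v hv
      rw [Finset.mem_filter] at hv
      obtain ⟨h1, h2⟩ := hv
      refine ⟨(eval_qp_zero _ _).2 (hT v h1).2.2, ?_, ?_⟩
      · rw [toQ_pderiv]; exact (eval_qp_zero _ _).2 h2
      · push_cast; exact (hT v h1).2.1)
    simpa using this
  have hsum : T.card = T0.card + T1.card := (Finset.card_filter_add_card_filter_not _).symm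
  -- choices
  have hch : ∀ v : Fin 3 → ℤ, ∃ (i : Fin 3) (p : ℕ) (a : ℤ), v ∈ T1 → (p.Prime ∧ p ≤ Qn Xn ∧ ¬ (p:ℤ) ∣ eval v (pderiv 2 F) ∧ i.succAbove 1 = 2 ∧
      i ≠ 2 ∧ ¬ (p:ℤ) ∣ v i ∧ (p:ℤ)^(3*(Nat.clog p (2^(l+1)))+1) ∣ a * v i - 1) := by
    intro v
    by_cases hv : v ∈ T1
    swap
    · exact ⟨0, 0, 0, fun h => absurd h hv⟩
    rw [Finset.mem_filter] at hv
    obtain ⟨h1, h2⟩ := hv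
    obtain ⟨hg, hbox, hz⟩ := hT v h1
    obtain ⟨p, hp, hpQ, hpd⟩ := pool Xn _ h2 (hX v hbox)
    have hpZ : Prime (p:ℤ) := Nat.prime_iff_prime_int.1 hp
    have hex : ∃ i : Fin 3, i.succAbove 1 = 2 ∧ i ≠ 2 ∧ ¬ (p:ℤ) ∣ v i := by
      by_contra hcon
      push Not at hcon
      have e0 := hcon 0 (by decide) (by decide)
      have e1 := hcon 1 (by decide) (by decide)
      have eu := congrArg (eval v) hF.sum_X_mul_pderiv
      rw [Fin.sum_univ_three] at eu
      simp only [map_add, map_mul, eval_X, map_nsmul, hz, smul_zero] at eu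
      have e2 : (p:ℤ) ∣ v 2 * eval v (pderiv 2 F) := by
        have : v 2 * eval v (pderiv 2 F) = - (v 0 * eval v (pderiv 0 F)) - v 1 * eval v (pderiv 1 F) := by linarith
        rw [this]
        exact ((e0.mul_right _).neg_right).sub (e1.mul_right _)
      have e3 := (hpZ.dvd_or_dvd e2).resolve_right hpd
      have : (p:ℤ) ∣ Finset.univ.gcd v := by
        apply Finset.dvd_gcd
        intro b _
        fin_cases b
        · exact e0
        · exact e1
        · exact e3
      rw [hg] at this
      exact hpZ.not_dvd_one this
    obtain ⟨i, hi1, hi2, hi3⟩ := hex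
    have hcop : IsCoprime ((p:ℤ)^(3*(Nat.clog p (2^(l+1)))+1)) (v i) := ((hpZ.coprime_iff_not_dvd).2 hi3).pow_left
    obtain ⟨s, t, hst⟩ := hcop
    exact ⟨i, p, t, fun _ => ⟨hp, hpQ, hpd, hi1, hi2, hi3, -s, by linear_combination hst⟩⟩
  choose fi fp fa hf using hch
  let key : (Fin 3 → ℤ) → Fin 3 × Bool × ℕ × ℕ × ℕ := fun v =>
    (fi v, decide (0 < v (fi v)), fp v, ((fa v * v ((fi v).succAbove 0)) % ((fp v)^(Nat.clog (fp v) (2^(l+1))) : ℕ)).toNat,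
      ((fa v * v 2) % (fp v : ℕ)).toNat)
  let K : Finset (Fin 3 × Bool × ℕ × ℕ × ℕ) := ({0, 1} : Finset (Fin 3)) ×ˢ Finset.univ ×ˢ Finset.range (Qn Xn + 1) ×ˢ
    Finset.range (Qn Xn * 2^(l+1)) ×ˢ Finset.range (Qn Xn)
  have hK : K.card = 4 * (Qn Xn + 1) * (Qn Xn * 2^(l+1)) * Qn Xn := by
    simp only [K, Finset.card_product, Finset.card_range, Finset.card_univ, Fintype.card_bool]
    rw [show ({0, 1} : Finset (Fin 3)).card = 2 by decide]
    ring
  have h2l : 2 ≤ 2 ^ (l+1) := by rw [pow_succ]; have := Nat.one_le_two_pow (n := l); omega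
  have hkey : ∀ v ∈ T1, key v ∈ K := by
    intro v hv
    obtain ⟨hp, hpQ, -, -, hi2, -, -⟩ := hf v hv
    obtain ⟨c1, c2, c3⟩ := clog_bound (fp v) (2^(l+1)) hp.two_le h2l
    simp only [K, key, Finset.mem_product, Finset.mem_univ, Finset.mem_range, true_and]
    refine ⟨?_, by omega, ?_, ?_⟩
    · have : ∀ j : Fin 3, j ≠ 2 → j ∈ ({0,1} : Finset (Fin 3)) := by decide
      exact this _ hi2
    · exact lt_of_lt_of_le (emod_key (Nat.pow_pos hp.pos) _) (c3.trans (Nat.mul_le_mul_right _ hpQ))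
    · exact lt_of_lt_of_le (emod_key hp.pos _) hpQ
  have hfib : ∀ κ ∈ K, (T1.filter (fun v => key v = κ)).card ≤ 100 := by
    rintro ⟨i, s, p, k0, k1⟩ -
    set U := T1.filter (fun v => key v = (i, s, p, k0, k1)) with hU
    rcases U.eq_empty_or_nonempty with hUe | ⟨w, hw⟩
    · rw [hUe]; simp
    have hU' : ∀ v ∈ U, v ∈ T1 ∧ fi v = i ∧ decide (0 < v i) = s ∧ fp v = p ∧
        ((fa v * v (i.succAbove 0)) % (p^(Nat.clog p (2^(l+1))) : ℕ)).toNat = k0 ∧ ((fa v * v 2) % (p : ℕ)).toNat = k1 := by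
      intro v hv
      rw [hU, Finset.mem_filter] at hv
      obtain ⟨h1, h2⟩ := hv
      simp only [key, Prod.mk.injEq] at h2
      obtain ⟨e1, e2, e3, e4, e5⟩ := h2
      subst e1
      subst e3
      exact ⟨h1, rfl, e2, rfl, e4, e5⟩
    have hUp : ∀ v ∈ U, (p.Prime ∧ p ≤ Qn Xn ∧ ¬ (p:ℤ) ∣ eval v (pderiv 2 F) ∧ i.succAbove 1 = 2 ∧
      i ≠ 2 ∧ ¬ (p:ℤ) ∣ v i ∧ (p:ℤ)^(3*(Nat.clog p (2^(l+1)))+1) ∣ fa v * v i - 1) := by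
      intro v hv
      obtain ⟨h1, h2, -, h3, -, -⟩ := hU' v hv
      have := hf v h1
      rw [h2, h3] at this
      exact this
    obtain ⟨hp, -, -, hi1, hi2, -, -⟩ := hUp w hw
    obtain ⟨c1, c2, c3⟩ := clog_bound p (2^(l+1)) hp.two_le h2l
    have hTU : ∀ v ∈ U, v ∈ T := fun v hv => (Finset.mem_filter.1 (hU' v hv).1).1
    obtain ⟨b, hb0, hb⟩ := dir_class F hF i hi1 p _ l hp c1 c2 fa (U : Set (Fin 3 → ℤ)) (by
        intro v hv
        obtain ⟨-, -, q1, -, -, -, q2⟩ := hUp v hv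
        exact ⟨(hT v (hTU v hv)).2.1, (hT v (hTU v hv)).2.2, q2, q1⟩) (by
        intro v hv v' hv'
        obtain ⟨-, -, -, -, a1, a2⟩ := hU' v hv
        obtain ⟨-, -, -, -, b1, b2⟩ := hU' v' hv'
        exact ⟨dvd_of_key (Nat.pow_pos hp.pos) _ _ (a1.trans b1.symm), dvd_of_key hp.pos _ _ (a2.trans b2.symm)⟩)
    let prm : Fin 3 → Fin 3 := Fin.cons (α := fun _ => Fin 3) i i.succAbove
    have hprm : Function.Injective prm := by
      have : ∀ i : Fin 3, Function.Injective (Fin.cons (α := fun _ => Fin 3) i i.succAbove : Fin 3 → Fin 3) := by decide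
      exact this i
    let Λ : MvPolynomial (Fin 3) ℚ := ∑ j, C (b j) * X (prm j)
    have hΛe : ∀ y : Fin 3 → ℚ, eval y Λ = ∑ j, b j * y (prm j) := by intro y; simp [Λ]
    have hΛ0 : Λ ≠ 0 := by
      intro h
      apply hb0
      funext j
      have := hΛe (Pi.single (prm j) 1)
      rw [h, map_zero] at this
      rw [Finset.sum_eq_single j] at this
      · simpa using this.symm
      · intro j' _ hj'
        rw [Pi.single_eq_of_ne (fun h => hj' (hprm h)), mul_zero]
      · simp
    have hΛd : Λ.totalDegree ≤ 1 := by
      refine (totalDegree_finsetSum _ _).trans (Finset.sup_le fun j _ => ?_)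
      refine (totalDegree_mul _ _).trans ?_
      simp
    obtain ⟨t, ht0, ht⟩ := transversal 2 i hi2 (toQ F) Λ hirr hdeg (hc 2) (not_dvd_of_degree hdeg4 hΛ0 (by omega)) 1 hΛd
    have hvi : ∀ v ∈ U, (v i : ℚ) ≠ 0 := by
      intro v hv h0
      obtain ⟨-, -, -, -, -, q, -⟩ := hUp v hv
      apply q
      have : v i = 0 := by exact_mod_cast h0
      rw [this]; exact dvd_zero _
    have hcard : (U.image (fun v j => t / (v i:ℚ) * (v j : ℚ))).card ≤ 4 * (4+1)^2 := by
      apply ht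
      intro y hy
      obtain ⟨v, hv, rfl⟩ := Finset.mem_image.1 hy
      refine ⟨?_, ?_, ?_⟩
      · rw [hom_eval (toQ F) (hF.map _) (t / (v i:ℚ)) (fun j => (v j : ℚ))]
        have := (eval_qp_zero v F).2 (hT v (hTU v hv)).2.2
        have e : eval (fun j => (v j : ℚ)) (toQ F) = 0 := this
        rw [e, mul_zero]
      · rw [hΛe]
        have := hb v hv
        calc _ = t / (v i:ℚ) * ∑ j, b j * (v (prm j) : ℚ) := by
              rw [Finset.mul_sum]; refine Finset.sum_congr rfl fun j _ => by ring
          _ = 0 := by rw [this, mul_zero]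
      · exact div_mul_cancel₀ _ (hvi v hv)
    rw [Finset.card_image_of_injOn] at hcard
    · simpa using hcard
    intro v hv v' hv' h
    have hcross : ∀ j, v' i * v j = v i * v' j := by
      intro j
      have h1 := congrFun h j
      simp only at h1
      have n1 := hvi v hv
      have n2 := hvi v' hv'
      field_simp at h1
      have : (v' i : ℚ) * v j = v i * v' j := by linarith
      exact_mod_cast this
    have hg : (Finset.univ.gcd fun j => v' i * v j) = Finset.univ.gcd fun j => v i * v' j := by simp only [hcross]
    rw [Finset.gcd_mul_left, Finset.gcd_mul_left, (hT v (hTU v hv)).1, (hT v' (hTU v' hv')).1, mul_one, mul_one,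
      ← Int.abs_eq_normalize, ← Int.abs_eq_normalize] at hg
    have hs : v' i = v i := by
      have s1 := (hU' v hv).2.2.1
      have s2 := (hU' v' hv').2.2.1
      rw [← s2] at s1
      have s3 : 0 < v i ↔ 0 < v' i := by simpa using s1
      rcases abs_eq_abs.1 hg with h | h
      · exact h
      · have n1 := hvi v hv
        have n3 : v i ≠ 0 := by exact_mod_cast n1
        omega
    funext j
    have h1 := hcross j
    rw [hs] at h1
    have n1 := hvi v hv
    exact mul_left_cancel₀ (by exact_mod_cast n1) h1
  have h1 : T1.card ≤ 100 * K.card := Finset.card_le_mul_card_image_of_maps_to hkey _ hfib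
  rw [hK] at h1
  omega
end DG


namespace DG
open MvPolynomial

/-- hypotheses on the affine quartic surface -/
structure Good (g : MvPolynomial (Fin 3) ℤ) : Prop where
  hd : (toQ g).totalDegree ≤ 4
  irr : Irreducible (toQ g)
  irrF : Irreducible (homogeneousComponent 4 (toQ g))
  hc : ∀ i, coeff (Finsupp.single i 4) (toQ g) ≠ 0
  nc : ∀ v : Fin 3 → ℚ, v ≠ 0 → ∑ j, C (v j) * pderiv j (homogeneousComponent 4 (toQ g)) ≠ 0

lemma toQ_hom (n : ℕ) (g : MvPolynomial (Fin 3) ℤ) : toQ (homogeneousComponent n g) = homogeneousComponent n (toQ g) := by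
  ext m
  simp only [toQ, coeff_map, coeff_homogeneousComponent]
  split_ifs <;> simp

lemma deriv_zero (G : MvPolynomial (Fin 3) ℚ) (u v : Fin 3 → ℚ) (h : ∀ s : ℚ, eval (fun l => u l + s * v l) G = 0) :
    ∑ j, v j * eval u (pderiv j G) = 0 := by
  obtain ⟨q, hq⟩ := taylor (map Polynomial.C G) (fun l => Polynomial.C (u l)) (fun l => Polynomial.C (v l)) (Polynomial.X : Polynomial ℚ)
  have hCe : ∀ H : MvPolynomial (Fin 3) ℚ, eval (fun l => Polynomial.C (u l)) (map Polynomial.C H) = Polynomial.C (eval u H) := by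
    intro H
    rw [eval_map, eval₂_eq', eval_eq', map_sum]
    simp
  have hzero : eval ((fun l => Polynomial.C (u l)) + (Polynomial.X : Polynomial ℚ) • (fun l => Polynomial.C (v l))) (map Polynomial.C G) = 0 := by
    apply Polynomial.funext
    intro s
    rw [Polynomial.eval_zero, ← h s, eval_map, eval₂_eq', eval_eq', Polynomial.eval_finsetSum]
    refine Finset.sum_congr rfl fun m _ => ?_
    simp [Polynomial.eval_prod]
    left
    exact Finset.prod_congr rfl fun i _ => by ring
  rw [hzero] at hq
  simp only [pderiv_map, hCe] at hq
  have h1 := congrArg (fun P => Polynomial.coeff P 1) hq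
  simp only [← map_mul, ← map_sum] at h1
  rw [show (Polynomial.X:Polynomial ℚ)^2 * q = q * Polynomial.X^2 by ring] at h1
  simp [Polynomial.coeff_mul_X_pow'] at h1
  rw [← h1]

lemma top_zero (G : MvPolynomial (Fin 3) ℚ) (hd : G.totalDegree ≤ 4) (u v : Fin 3 → ℚ) (h : ∀ s : ℚ, eval (fun l => u l + s * v l) G = 0) :
    eval v (homogeneousComponent 4 G) = 0 := by
  let P : Polynomial ℚ := ∑ i ∈ Finset.range 5, Polynomial.X ^ (4 - i) *
    aeval (fun l => Polynomial.C (u l) * Polynomial.X + Polynomial.C (v l)) (homogeneousComponent i G)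
  have hev : ∀ τ : ℚ, P.eval τ = ∑ i ∈ Finset.range 5, τ ^ (4 - i) * eval (fun l => u l * τ + v l) (homogeneousComponent i G) := by
    intro τ
    simp only [P, Polynomial.eval_finsetSum, Polynomial.eval_mul, Polynomial.eval_pow, Polynomial.eval_X]
    refine Finset.sum_congr rfl fun i _ => ?_
    congr 1
    rw [aeval_def, eval₂_eq', eval_eq', Polynomial.eval_finsetSum]
    refine Finset.sum_congr rfl fun m _ => ?_
    simp [Polynomial.eval_prod]
  have hG : G = ∑ i ∈ Finset.range 5, homogeneousComponent i G := by
    conv_lhs => rw [← sum_homogeneousComponent G]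
    apply Finset.sum_subset
    · intro i hi; rw [Finset.mem_range] at *; omega
    · intro i _ hi
      rw [Finset.mem_range] at hi
      exact homogeneousComponent_eq_zero _ _ (by omega)
  have hz : ∀ τ : ℚ, τ ≠ 0 → P.eval τ = 0 := by
    intro τ hτ
    have h1 := h τ⁻¹
    rw [hG, map_sum] at h1
    rw [hev]
    have : (∑ i ∈ Finset.range 5, τ ^ (4 - i) * eval (fun l => u l * τ + v l) (homogeneousComponent i G)) =
      τ ^ 4 * ∑ i ∈ Finset.range 5, eval (fun l => u l + τ⁻¹ * v l) (homogeneousComponent i G) := by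
      rw [Finset.mul_sum]
      refine Finset.sum_congr rfl fun i hi => ?_
      have e : (fun l => u l * τ + v l) = fun l => τ * (u l + τ⁻¹ * v l) := by
        funext l; field_simp
      rw [e, hom_eval _ (homogeneousComponent_isHomogeneous i G), ← mul_assoc, ← pow_add]
      rw [Finset.mem_range] at hi
      rw [show 4 - i + i = 4 by omega]
    rw [this, h1, mul_zero]
  have hP : P = 0 := by
    by_contra hne
    have hinf : ({0}ᶜ : Set ℚ) ⊆ {x | P.IsRoot x} := by
      intro τ hτ
      exact hz τ (by simpa using hτ)
    exact (Set.Finite.infinite_compl (Set.finite_singleton (0:ℚ))) ((Polynomial.finite_setOfPred_isRoot hne).subset hinf)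
  have h0 := hev 0
  rw [hP, Polynomial.eval_zero, Finset.sum_range_succ, Finset.sum_eq_zero] at h0
  · simpa using h0.symm
  · intro i hi
    rw [Finset.mem_range] at hi
    rw [zero_pow (by omega), zero_mul]

lemma Dv_ne_zero (G : MvPolynomial (Fin 3) ℚ) (v : Fin 3 → ℚ) (h : ∑ j, C (v j) * pderiv j (homogeneousComponent 4 G) ≠ 0) :
    ∑ j, C (v j) * pderiv j G ≠ 0 := by
  intro h0
  apply h
  ext m
  rw [coeff_zero, coeff_sum]
  by_cases hm : m.degree = 3
  · have := congrArg (coeff m) h0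
    rw [coeff_zero, coeff_sum] at this
    rw [← this]
    refine Finset.sum_congr rfl fun j _ => ?_
    rw [coeff_C_mul, coeff_C_mul, coeff_pderiv, coeff_pderiv, coeff_homogeneousComponent, if_pos]
    simp [hm]
  · apply Finset.sum_eq_zero
    intro j _
    rw [coeff_C_mul, coeff_pderiv, coeff_homogeneousComponent, if_neg, zero_mul, mul_zero]
    simp
    omega

lemma residue_count (T : Finset ℤ) (B V : ℕ) (hV : 1 ≤ V) (hT : ∀ x ∈ T, |x| ≤ B) (hm : ∀ x ∈ T, ∀ y ∈ T, (V:ℤ) ∣ x - y) :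
    T.card ≤ 2 * B / V + 1 := by
  rw [← Finset.card_range (2 * B / V + 1)]
  apply Finset.card_le_card_of_injOn (fun x : ℤ => ((x + B) / V).toNat)
  · intro x hx
    have := abs_le.1 (hT x hx)
    simp only [Finset.coe_range, Set.mem_Iio]
    rw [Nat.lt_succ_iff, Int.toNat_le]
    push_cast
    exact Int.ediv_le_ediv (by omega) (by omega)
  · intro x hx y hy h
    have h1 := abs_le.1 (hT x hx)
    have h2 := abs_le.1 (hT y hy)
    have e1 : 0 ≤ (x + B) / (V:ℤ) := Int.ediv_nonneg (by omega) (by omega)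
    have e2 : 0 ≤ (y + B) / (V:ℤ) := Int.ediv_nonneg (by omega) (by omega)
    simp only at h
    have h3 : (x + B) / (V:ℤ) = (y + B) / (V:ℤ) := by omega
    have h4 : (x + B) % (V:ℤ) = (y + B) % (V:ℤ) := by
      exact (Int.modEq_iff_dvd.2 (by simpa using hm y hy x hx))
    have := Int.emod_add_mul_ediv (x + B) V
    have := Int.emod_add_mul_ediv (y + B) V
    rw [h3, h4] at *
    omega

lemma line_count (g : MvPolynomial (Fin 3) ℤ) (hg : Good g) (v : Fin 3 → ℤ) (hv : Finset.univ.gcd v = 1) (j : Fin 3) (hj : v j ≠ 0) (B : ℕ)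
    (T : Finset (Fin 3 → ℤ)) (hT : ∀ x ∈ T, (∀ l, |x l| ≤ B) ∧ ∀ s : ℚ, eval (fun l => qp x l + s * qp v l) (toQ g) = 0) :
    T.card ≤ (2 * B / (v j).natAbs + 1) * 196 := by
  classical
  have hjq : qp v j ≠ 0 := by simp only [qp]; exact_mod_cast hj
  have hvq : qp v ≠ 0 := fun h => hjq (congrFun h j)
  set D := ∑ l, C (qp v l) * pderiv l (toQ g) with hD
  have hD0 : D ≠ 0 := Dv_ne_zero _ _ (hg.nc _ hvq)
  have hDd : D.totalDegree ≤ 3 := by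
    refine (totalDegree_finsetSum _ _).trans (Finset.sup_le fun l _ => ?_)
    refine (totalDegree_mul _ _).trans ?_
    rw [totalDegree_C, zero_add]
    exact totalDegree_pderiv_le _ _ _ hg.hd
  obtain ⟨k, hk⟩ : ∃ k : Fin 3, j ≠ k := ⟨j + 1, (by decide : ∀ j : Fin 3, j ≠ j + 1) j⟩
  have hd4 := totalDegree_eq_four hg.hd (hg.hc 0)
  obtain ⟨t, -, ht⟩ := transversal k j hk (toQ g) D hg.irr hg.hd (hg.hc k) (not_dvd_of_degree hd4 hD0 hDd) 3 hDd
  let y : (Fin 3 → ℤ) → Fin 3 → ℚ := fun x l => qp x l + ((t - qp x j) / qp v j) * qp v l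
  have hcard : (T.image y).card ≤ 196 := by
    have := ht (T.image y) (by
      intro z hz
      obtain ⟨x, hx, rfl⟩ := Finset.mem_image.1 hz
      refine ⟨(hT x hx).2 _, ?_, ?_⟩
      · have := deriv_zero (toQ g) (y x) (qp v) (by
          intro s
          have := (hT x hx).2 ((t - qp x j) / qp v j + s)
          rw [← this]
          congr 1
          congr 1
          funext l
          simp only [y]; ring)
        rw [hD, map_sum, ← this]
        simp
      · simp only [y]
        rw [div_mul_cancel₀ _ hjq]; ring)
    simpa using this
  refine (Finset.card_le_mul_card_image T (2 * B / (v j).natAbs + 1) (f := y) ?_).trans (Nat.mul_le_mul_left _ hcard)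
  intro b _
  have hcr : ∀ x ∈ T.filter (fun x => y x = b), ∀ x' ∈ T.filter (fun x => y x = b), ∀ l, v j * (x l - x' l) = (x j - x' j) * v l := by
    intro x hx x' hx' l
    have h1 := congrFun ((Finset.mem_filter.1 hx).2.trans (Finset.mem_filter.1 hx').2.symm) l
    simp only [y] at h1
    field_simp at h1
    simp only [qp] at h1
    have : (v j : ℚ) * (x l - x' l) = (x j - x' j) * v l := by linarith
    exact_mod_cast this
  have hinj : Set.InjOn (fun x : Fin 3 → ℤ => x j) (T.filter (fun x => y x = b)) := by
    intro x hx x' hx' h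
    funext l
    have h1 := hcr x hx x' hx' l
    simp only at h
    rw [h, sub_self, zero_mul] at h1
    have := (mul_eq_zero.1 h1).resolve_left hj
    omega
  rw [← Finset.card_image_of_injOn hinj]
  apply residue_count
  · omega
  · intro z hz
    obtain ⟨x, hx, rfl⟩ := Finset.mem_image.1 hz
    exact (hT x (Finset.mem_filter.1 hx).1).1 j
  · intro z hz z' hz'
    obtain ⟨x, hx, rfl⟩ := Finset.mem_image.1 hz
    obtain ⟨x', hx', rfl⟩ := Finset.mem_image.1 hz'
    have h1 : v j ∣ Finset.univ.gcd (fun l => (x j - x' j) * v l) :=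
      Finset.dvd_gcd (fun l _ => ⟨_, (hcr x hx x' hx' l).symm⟩)
    rw [Finset.gcd_mul_left, hv, mul_one, ← Int.abs_eq_normalize, dvd_abs] at h1
    exact Int.natAbs_dvd.2 h1

def OnLine (g : MvPolynomial (Fin 3) ℤ) (L : ℕ) (x : Fin 3 → ℤ) : Prop :=
  ∃ v : Fin 3 → ℤ, Finset.univ.gcd v = 1 ∧ (∀ l, |v l| ≤ 2 ^ L) ∧ ∀ s : ℚ, eval (fun l => qp x l + s * qp v l) (toQ g) = 0

lemma lines_total (g : MvPolynomial (Fin 3) ℤ) (hg : Good g) (L Xn : ℕ)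
    (hX : ∀ v : Fin 3 → ℤ, (∀ j, |v j| ≤ 2^(L+1)) → |eval v (pderiv 2 (homogeneousComponent 4 g))| ≤ 2^Xn) (T : Finset (Fin 3 → ℤ))
    (hT : ∀ x ∈ T, (∀ l, |x l| ≤ 4^L) ∧ OnLine g L x) :
    T.card ≤ (1176 * (588 + 800 * (Qn Xn + 1)^3)) * 4^L * (L+1) := by
  classical
  have hch : ∀ x : Fin 3 → ℤ, ∃ (v : Fin 3 → ℤ) (j : Fin 3), x ∈ T → (Finset.univ.gcd v = 1 ∧ (∀ l, |v l| ≤ 2 ^ L) ∧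
      (∀ s : ℚ, eval (fun l => qp x l + s * qp v l) (toQ g) = 0) ∧ v j ≠ 0 ∧ ∀ l, |v l| ≤ |v j|) := by
    intro x
    by_cases hx : x ∈ T
    swap
    · exact ⟨0, 0, fun h => absurd h hx⟩
    obtain ⟨v, h1, h2, h3⟩ := (hT x hx).2
    obtain ⟨j, -, hj⟩ := Finset.exists_max_image Finset.univ (fun l => |v l|) ⟨0, Finset.mem_univ _⟩
    refine ⟨v, j, fun _ => ⟨h1, h2, h3, ?_, fun l => hj l (Finset.mem_univ _)⟩⟩
    intro h0
    have : v = fun _ => 0 := by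
      funext l
      have := hj l (Finset.mem_univ _)
      rw [h0, abs_zero] at this
      simpa using this
    rw [this] at h1
    have h2 : (Finset.univ.gcd fun _ : Fin 3 => (0:ℤ)) = 0 := Finset.gcd_eq_zero_iff.2 (by simp)
    rw [h2] at h1
    exact absurd h1 (by norm_num)
  choose fv fj hf using hch
  let ll : (Fin 3 → ℤ) → ℕ := fun x => Nat.log 2 (fv x (fj x)).natAbs
  have hll : ∀ x ∈ T, 2 ^ ll x ≤ (fv x (fj x)).natAbs ∧ (fv x (fj x)).natAbs < 2 ^ (ll x + 1) ∧ ll x ≤ L := by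
    intro x hx
    obtain ⟨-, h2, -, h4, -⟩ := hf x hx
    have h5 : (fv x (fj x)).natAbs ≠ 0 := by simpa using h4
    have h6 : (fv x (fj x)).natAbs ≤ 2 ^ L := by
      have := h2 (fj x)
      zify; exact_mod_cast this
    have a1 := Nat.pow_log_le_self 2 h5
    refine ⟨a1, Nat.lt_pow_succ_log_self (by norm_num) _, ?_⟩
    exact (Nat.pow_le_pow_iff_right (by norm_num)).1 (a1.trans h6)
  set c := 588 + 800 * (Qn Xn + 1)^3 with hc
  have main : ∀ l ∈ Finset.range (L+1), (T.filter (fun x => ll x = l)).card ≤ (1176 * c) * 4^L := by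
    intro l hl
    rw [Finset.mem_range] at hl
    set U := T.filter (fun x => ll x = l) with hU
    have hUT : ∀ x ∈ U, x ∈ T ∧ ll x = l := fun x hx => Finset.mem_filter.1 hx
    have hD : (U.image fv).card ≤ 2^(l+1) * c := by
      have := dirs_count (homogeneousComponent 4 g) (homogeneousComponent_isHomogeneous 4 g) (by rw [toQ_hom]; exact hg.irrF)
        (by
          intro i
          rw [toQ_hom, coeff_homogeneousComponent, if_pos (by simp)]
          exact hg.hc i) Xn (l+1) (by
          intro v hv
          exact hX v (fun j => (hv j).trans (pow_le_pow_right₀ (by norm_num) (by omega)))) (U.image fv) (by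
          intro v hv
          obtain ⟨x, hx, rfl⟩ := Finset.mem_image.1 hv
          obtain ⟨hxT, hxl⟩ := hUT x hx
          obtain ⟨h1, h2, h3, h4, h5⟩ := hf x hxT
          refine ⟨h1, ?_, ?_⟩
          · intro j
            have e := (hll x hxT).2.1
            rw [hxl] at e
            have e2 := h5 j
            have e3 : ((fv x (fj x)).natAbs : ℤ) < 2 ^ (l+1) := by exact_mod_cast e
            rw [Int.natCast_natAbs] at e3
            linarith
          · have := top_zero (toQ g) hg.hd (qp x) (qp (fv x)) h3
            rw [← toQ_hom] at this
            exact (eval_qp_zero _ _).1 this)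
      refine this.trans ?_
      have e1 : 1 ≤ 2^(l+1) := Nat.one_le_two_pow
      have e2 : 100 * (4 * (Qn Xn + 1) * (Qn Xn * 2^(l+1+1)) * Qn Xn) ≤ 2^(l+1) * (800 * (Qn Xn + 1)^3) := by
        calc 100 * (4 * (Qn Xn + 1) * (Qn Xn * 2^(l+1+1)) * Qn Xn) = 2^(l+1) * (800 * ((Qn Xn + 1) * (Qn Xn * Qn Xn))) := by
              rw [pow_succ 2 (l+1)]; ring
          _ ≤ 2^(l+1) * (800 * ((Qn Xn + 1) * ((Qn Xn + 1) * (Qn Xn + 1)))) := by gcongr <;> omega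
          _ = _ := by ring
      rw [hc, mul_add (2^(l+1)) 588]
      omega
    have hL : U.card ≤ ((2 * 4^L / 2^l + 1) * 196) * (U.image fv).card := by
      refine Finset.card_le_mul_card_image U _ ?_
      intro v hv
      rcases (U.filter (fun x => fv x = v)).eq_empty_or_nonempty with he | ⟨x0, hx0⟩
      · rw [he]; simp
      obtain ⟨hx0U, rfl⟩ := Finset.mem_filter.1 hx0
      obtain ⟨hx0T, hx0l⟩ := hUT x0 hx0U
      obtain ⟨h1, h2, h3, h4, h5⟩ := hf x0 hx0T
      refine (line_count g hg (fv x0) h1 (fj x0) h4 (4^L) _ ?_).trans ?_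
      · intro x hx
        obtain ⟨hxU, hxv⟩ := Finset.mem_filter.1 hx
        obtain ⟨hxT, -⟩ := hUT x hxU
        refine ⟨by push_cast; exact (hT x hxT).1, ?_⟩
        have := (hf x hxT).2.2.1
        rw [hxv] at this
        exact this
      · apply Nat.mul_le_mul_right
        apply Nat.succ_le_succ
        apply Nat.div_le_div_left
        · rw [← hx0l]; exact (hll x0 hx0T).1
        · positivity
    have hb : (2 * 4^L / 2^l + 1) * 2^(l+1) ≤ 6 * 4^L := by
      have e1 := Nat.div_mul_le_self (2 * 4^L) (2^l)
      have e2 : 2^l ≤ 4^L := (Nat.pow_le_pow_right (by norm_num) (by omega : l ≤ L)).trans (Nat.pow_le_pow_left (by norm_num) L)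
      rw [pow_succ]
      nlinarith
    calc U.card ≤ ((2 * 4^L / 2^l + 1) * 196) * (2^(l+1) * c) := hL.trans (Nat.mul_le_mul_left _ hD)
      _ = ((2 * 4^L / 2^l + 1) * 2^(l+1)) * (196 * c) := by ring
      _ ≤ (6 * 4^L) * (196 * c) := Nat.mul_le_mul_right _ hb
      _ = _ := by ring
  have := Finset.card_le_mul_card_image_of_maps_to (s := T) (t := Finset.range (L+1)) (f := ll) (fun x hx => by
    simp only [Finset.mem_range]; have := (hll x hx).2.2; omega) _ main
  rwa [Finset.card_range] at this
end DG


namespace DG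
open MvPolynomial

lemma card_cover {α β : Type*} [DecidableEq α] (T : Finset α) (I : Finset β) (P : β → α → Prop) [∀ b, DecidablePred (P b)] (N : ℕ)
    (h : ∀ x ∈ T, ∃ b ∈ I, P b x) (hN : ∀ b ∈ I, (T.filter (P b)).card ≤ N) : T.card ≤ I.card * N := by
  have : T ⊆ I.biUnion (fun b => T.filter (P b)) := by
    intro x hx
    obtain ⟨b, hb, hP⟩ := h x hx
    simp only [Finset.mem_biUnion, Finset.mem_filter]
    exact ⟨b, hb, hx, hP⟩
  exact (Finset.card_le_card this).trans (Finset.card_biUnion_le_card_mul _ _ _ hN)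

/-- residue vector -/
def key (m : ℕ) (x : Fin 3 → ℤ) : Fin 3 → ℤ := fun l => x l % m

/-- drop a coordinate -/
def pr (i : Fin 3) (x : Fin 3 → ℤ) : Fin 2 → ℤ := fun l => x (i.succAbove l)

/-- good modulus -/
def gd (g : MvPolynomial (Fin 3) ℤ) (m : ℕ) (x : Fin 3 → ℤ) : Prop := IsCoprime (m:ℤ) (eval x (pderiv 2 g))

lemma key_dvd {m : ℕ} {x y : Fin 3 → ℤ} (h : key m x = key m y) (l : Fin 3) : (m:ℤ) ∣ x l - y l :=
  (Int.modEq_iff_dvd.1 (congrFun h l).symm)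

lemma gd_unit {g : MvPolynomial (Fin 3) ℤ} {m ρ : ℕ} {x : Fin 3 → ℤ} (h : gd g m x) (hρ : ρ ∣ m) :
    ∃ e : ℤ, (ρ:ℤ) ∣ e * eval x (pderiv 2 g) - 1 := by
  obtain ⟨a, b, hab⟩ := h
  have : (ρ:ℤ) ∣ m := by exact_mod_cast hρ
  refine ⟨b, ?_⟩
  rw [← hab]
  obtain ⟨c, hc⟩ := this
  exact ⟨-(a*c), by rw [hc]; ring⟩

open Classical in
lemma keys_card (g : MvPolynomial (Fin 3) ℤ) (m ρ A : ℕ) (hm0 : 0 < m) (hρ0 : 0 < ρ) (hρm : ρ ∣ m) (hmρ : m ∣ ρ ^ A)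
    (S : Finset (Fin 3 → ℤ)) (hS : ∀ x ∈ S, eval x g = 0 ∧ gd g m x) :
    (S.image (key m)).card ≤ m ^ 2 * ρ := by
  have : (Finset.range m ×ˢ Finset.range m ×ˢ Finset.range ρ).card = m ^ 2 * ρ := by
    simp only [Finset.card_product, Finset.card_range]; ring
  rw [← this]
  apply Finset.card_le_card_of_injOn (fun κ : Fin 3 → ℤ => ((κ 0 % m).toNat, (κ 1 % m).toNat, (κ 2 % ρ).toNat))
  · intro κ _
    simp only [Finset.coe_product, Finset.coe_range, Set.mem_prod, Set.mem_Iio]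
    exact ⟨emod_key hm0 _, emod_key hm0 _, emod_key hρ0 _⟩
  · intro κ hκ κ' hκ' h
    simp only [Finset.coe_image, Set.mem_image, Finset.mem_coe] at hκ hκ'
    obtain ⟨x, hx, rfl⟩ := hκ
    obtain ⟨y, hy, rfl⟩ := hκ'
    simp only [Prod.mk.injEq] at h
    obtain ⟨h0, h1, h2⟩ := h
    have hρmz : (ρ:ℤ) ∣ m := by exact_mod_cast hρm
    have hk : ∀ (z : Fin 3 → ℤ) l, (m:ℤ) ∣ z l - key m z l := fun z l => by
      simp only [key]; exact Int.dvd_self_sub_emod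
    have d0 := dvd_of_key hm0 _ _ h0
    have d1 := dvd_of_key hm0 _ _ h1
    have d2 := dvd_of_key hρ0 _ _ h2
    have comb : ∀ (q : ℤ), q ∣ m → ∀ l, q ∣ key m x l - key m y l → q ∣ x l - y l := by
      intro q hq l hl
      have := ((hq.trans (hk x l)).add hl).sub (hq.trans (hk y l))
      obtain ⟨c, hc⟩ := this
      exact ⟨c, by linear_combination hc⟩
    obtain ⟨e, he⟩ := gd_unit (hS y hy).2 hρm
    have h3 := lift_unique g 2 ρ m A y x e he hρm hmρ (hS y hy).1 (hS x hx).1 (comb _ hρmz 2 d2) (by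
      intro l
      fin_cases l
      · exact comb _ dvd_rfl 0 d0
      · exact comb _ dvd_rfl 1 d1)
    funext l
    simp only [key]
    apply Int.ModEq.symm
    apply Int.modEq_iff_dvd.2
    fin_cases l
    · exact comb _ dvd_rfl 0 d0
    · exact comb _ dvd_rfl 1 d1
    · exact h3

lemma class_R (g : MvPolynomial (Fin 3) ℤ) (hg : Good g) (L m ρ A : ℕ) (hL : 1 ≤ L) (hρm : ρ ∣ m) (hmρ : m ∣ ρ ^ A) (hm : 2 ^ (L+5) ≤ m)
    (S : Set (Fin 3 → ℤ)) (hS : ∀ x ∈ S, eval x g = 0 ∧ gd g m x ∧ ∀ l, |x l| ≤ 4 ^ L) (hk : ∀ x ∈ S, ∀ y ∈ S, key m x = key m y) (i : Fin 3) :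
    ∃ R : MvPolynomial (Fin 2) ℚ, R ≠ 0 ∧ R.totalDegree ≤ (L + 6) ^ 2 ∧ ∀ x ∈ S, eval (qp (pr i x)) R = 0 := by
  rcases S.eq_empty_or_nonempty with rfl | ⟨u0, hu0⟩
  · exact ⟨1, one_ne_zero, by simp, by simp⟩
  obtain ⟨e, he⟩ := gd_unit (hS u0 hu0).2.1 hρm
  obtain ⟨h, h0, h1, h2, h3⟩ := aux2 g L ρ m A hL u0 e he hρm hmρ hm S (fun x hx => ⟨key_dvd (hk x hx u0 hu0), (hS x hx).1, (hS x hx).2.2⟩)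
  have hnd : ¬ toQ g ∣ h := by
    rintro ⟨q, rfl⟩
    have hq0 : q ≠ 0 := by rintro rfl; simp at h0
    rw [degreeOf_mul_eq hg.irr.ne_zero hq0] at h1
    have h4 : 4 ≤ (toQ g).degreeOf 2 := by
      have := monomial_le_degreeOf 2 (mem_support_iff.2 (hg.hc 2))
      simpa using this
    omega
  obtain ⟨r, r0, r1, r2⟩ := elim i (toQ g) h 4 (L+2) hg.irr hnd hg.hd h2
  refine ⟨r, r0, r1.trans (by apply Nat.pow_le_pow_left; omega), fun x hx => ?_⟩
  exact r2 (qp x) ((eval_qp_zero x g).2 (hS x hx).1) (h3 x hx)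

end DG


namespace DG
open MvPolynomial

lemma pairCell (g : MvPolynomial (Fin 3) ℤ) (hg : Good g) (i : Fin 3) (r q : MvPolynomial (Fin 2) ℚ) (hr : Irreducible r) (hrq : ¬ r ∣ q)
    (d e : ℕ) (hd : r.totalDegree ≤ d) (he : q.totalDegree ≤ e) (T : Finset (Fin 3 → ℤ))
    (hT : ∀ x ∈ T, eval x g = 0 ∧ eval (qp (pr i x)) r = 0 ∧ eval (qp (pr i x)) q = 0) : T.card ≤ 4 * (d + e) ^ 4 := by
  apply proj_card_le_int i (toQ g) hg.hd (hg.hc i) T (fun x hx => (eval_qp_zero x g).2 (hT x hx).1)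
  intro U hU
  apply bezout r q d e hr hrq hd he
  intro y hy
  obtain ⟨x, hx, rfl⟩ := hU y hy
  exact (hT x hx).2

lemma eval_linear (r : MvPolynomial (Fin 2) ℚ) (hr : r.totalDegree ≤ 1) (u : Fin 2 → ℚ) :
    eval u r = coeff 0 r + coeff (Finsupp.single 0 1) r * u 0 + coeff (Finsupp.single 1 1) r * u 1 := by
  classical
  rw [eval_eq']
  have hsub : r.support ⊆ {0, Finsupp.single 0 1, Finsupp.single 1 1} := by
    intro m hm
    have h1 := (le_totalDegree hm).trans hr
    rw [Finsupp.sum_fintype _ _ (by simp)] at h1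
    simp only [Fin.sum_univ_two] at h1
    simp only [Finset.mem_insert, Finset.mem_singleton]
    have e : (m 0 = 0 ∧ m 1 = 0) ∨ (m 0 = 1 ∧ m 1 = 0) ∨ (m 0 = 0 ∧ m 1 = 1) := by omega
    rcases e with h | h | h
    · left; ext l; fin_cases l <;> simp [h]
    · right; left; ext l; fin_cases l <;> simp [h]
    · right; right; ext l; fin_cases l <;> simp [h]
  have ne1 : (0 : Fin 2 →₀ ℕ) ≠ Finsupp.single 0 1 := by
    intro h; have := DFunLike.congr_fun h 0; simp at this
  have ne2 : (0 : Fin 2 →₀ ℕ) ≠ Finsupp.single 1 1 := by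
    intro h; have := DFunLike.congr_fun h 1; simp at this
  have ne3 : (Finsupp.single 0 1 : Fin 2 →₀ ℕ) ≠ Finsupp.single 1 1 := by
    intro h; have := DFunLike.congr_fun h 1; simp at this
  rw [Finset.sum_subset hsub (fun m _ hm => by rw [notMem_support_iff.1 hm, zero_mul])]
  rw [Finset.sum_insert (by simp [ne1, ne2]), Finset.sum_insert (by simp [ne3]), Finset.sum_singleton]
  simp [Fin.prod_univ_two]
  ring

lemma linear_minor (r : MvPolynomial (Fin 2) ℚ) (hr : r.totalDegree ≤ 1) (hirr : Irreducible r) (x y z : Fin 2 → ℚ)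
    (hx : eval x r = 0) (hy : eval y r = 0) (hz : eval z r = 0) : (y 0 - x 0) * (z 1 - x 1) - (y 1 - x 1) * (z 0 - x 0) = 0 := by
  have h1 := eval_linear r hr x
  have h2 := eval_linear r hr y
  have h3 := eval_linear r hr z
  rw [hx] at h1; rw [hy] at h2; rw [hz] at h3
  set a := coeff (Finsupp.single 0 1) r
  set b := coeff (Finsupp.single 1 1) r
  set c := coeff 0 r
  have hab : a ≠ 0 ∨ b ≠ 0 := by
    by_contra! h
    have : r = C c := by
      apply MvPolynomial.funext
      intro u
      rw [eval_linear r hr u, eval_C]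
      change c + a * _ + b * _ = c
      rw [h.1, h.2]; ring
    have := totalDegree_pos_of_irreducible hirr
    rw [‹r = C c›, totalDegree_C] at this
    omega
  rcases hab with h | h
  · apply mul_left_cancel₀ h
    linear_combination (z 1 - x 1) * (h1 - h2) - (y 1 - x 1) * (h1 - h3)
  · apply mul_left_cancel₀ h
    linear_combination -(z 0 - x 0) * (h1 - h2) + (y 0 - x 0) * (h1 - h3)

lemma line_vanish (G : MvPolynomial (Fin 3) ℚ) (hd : G.totalDegree ≤ 4) (u v : Fin 3 → ℚ) (T : Finset ℚ) (hT : 5 ≤ T.card)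
    (h : ∀ s ∈ T, eval (fun l => u l + s * v l) G = 0) (s : ℚ) : eval (fun l => u l + s * v l) G = 0 := by
  let P : Polynomial ℚ := aeval (fun l => Polynomial.C (u l) + Polynomial.X * Polynomial.C (v l)) G
  have hev : ∀ s, P.eval s = eval (fun l => u l + s * v l) G := by
    intro s
    simp only [P]
    rw [aeval_def, eval₂_eq', eval_eq', Polynomial.eval_finsetSum]
    refine Finset.sum_congr rfl fun m _ => ?_
    simp [Polynomial.eval_prod]
    left
    exact Finset.prod_congr rfl fun i _ => by ring
  have hdeg : P.natDegree ≤ 4 := by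
    have := aeval_natDegree_le (n := 1) G le_rfl (fun l => Polynomial.C (u l) + Polynomial.X * Polynomial.C (v l)) (by
      intro l
      compute_degree)
    refine this.trans ?_
    omega
  have hP : P = 0 := by
    apply Polynomial.eq_zero_of_natDegree_lt_card_of_eval_eq_zero' P T
    · intro t ht; rw [hev]; exact h t ht
    · omega
  rw [← hev, hP, Polynomial.eval_zero]

lemma lineCell (g : MvPolynomial (Fin 3) ℤ) (hg : Good g) (L m : ℕ) (hm : 2 ^ (L+5) ≤ m) (r : Fin 3 → MvPolynomial (Fin 2) ℚ)
    (hr : ∀ i, Irreducible (r i)) (hr1 : ∀ i, (r i).totalDegree ≤ 1) (T : Finset (Fin 3 → ℤ))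
    (hT : ∀ x ∈ T, eval x g = 0 ∧ (∀ l, |x l| ≤ 4 ^ L) ∧ (∀ i, eval (qp (pr i x)) (r i) = 0) ∧ ¬ OnLine g L x)
    (hk : ∀ x ∈ T, ∀ y ∈ T, key m x = key m y) : T.card ≤ 4 := by
  classical
  by_contra hcard
  push Not at hcard
  obtain ⟨x, hx, y, hy, hxy⟩ := Finset.one_lt_card.1 (by omega : 1 < T.card)
  let w : Fin 3 → ℤ := fun l => y l - x l
  obtain ⟨l0, hl0⟩ : ∃ l, w l ≠ 0 := by
    by_contra! h
    exact hxy (funext fun l => by have := h l; simp only [w] at this; omega)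
  obtain ⟨v, hwv, hv⟩ := Finset.extract_gcd w (Finset.univ_nonempty (α := Fin 3))
  set c := Finset.univ.gcd w with hc
  have hmc : (m:ℤ) ∣ c := Finset.dvd_gcd fun l _ => key_dvd (hk y hy x hx) l
  have hc0 : c ≠ 0 := by
    intro h
    exact hl0 (Finset.gcd_eq_zero_iff.1 h l0 (Finset.mem_univ _))
  have hmc' : (m:ℤ) ≤ |c| := Int.le_of_dvd (abs_pos.2 hc0) ((dvd_abs _ _).2 hmc)
  have hw : ∀ l, w l = c * v l := fun l => by simpa using hwv l (Finset.mem_univ _)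
  refine (hT x hx).2.2.2 ⟨v, hv, ?_, ?_⟩
  · intro l
    have h1 := abs_le.1 ((hT x hx).2.1 l)
    have h2 := abs_le.1 ((hT y hy).2.1 l)
    have h3 : |w l| ≤ 2 * 4 ^ L := by simp only [w]; rw [abs_le]; constructor <;> linarith
    rw [hw, abs_mul] at h3
    have h5 : (2:ℤ) ^ (L+5) ≤ m := by exact_mod_cast hm
    have h6 : (2:ℤ)^(L+5) * |v l| ≤ 2 * 4 ^ L := le_trans (mul_le_mul_of_nonneg_right (h5.trans hmc') (abs_nonneg _)) h3
    have h7 : (4:ℤ)^L = 2^L * 2^L := by rw [← mul_pow]; norm_num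
    rw [h7, pow_add] at h6
    have h8 : (0:ℤ) < 2^L := by positivity
    by_contra! h9
    nlinarith
  · have hzs : ∀ z ∈ T, ∀ l, qp z l = qp x l + (qp z l0 - qp x l0) / qp v l0 * qp v l := by
      intro z hz l
      have hmin : ∀ i : Fin 3, (qp y (i.succAbove 0) - qp x (i.succAbove 0)) * (qp z (i.succAbove 1) - qp x (i.succAbove 1))
        - (qp y (i.succAbove 1) - qp x (i.succAbove 1)) * (qp z (i.succAbove 0) - qp x (i.succAbove 0)) = 0 := fun i =>
        linear_minor (r i) (hr1 i) (hr i) (qp (pr i x)) (qp (pr i y)) (qp (pr i z)) ((hT x hx).2.2.1 i) ((hT y hy).2.2.1 i) ((hT z hz).2.2.1 i)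
      have hwq : ∀ l, qp y l - qp x l = c * qp v l := by
        intro l
        have := hw l
        simp only [w] at this
        simp only [qp]
        exact_mod_cast this
      simp only [hwq] at hmin
      have hcq : (c:ℚ) ≠ 0 := by exact_mod_cast hc0
      have hv0 : qp v l0 ≠ 0 := by
        intro h
        apply hl0
        rw [hw]
        simp only [qp] at h
        rw [show v l0 = 0 by exact_mod_cast h, mul_zero]
      have hm2 : ∀ i : Fin 3, qp v (i.succAbove 0) * (qp z (i.succAbove 1) - qp x (i.succAbove 1))
        - qp v (i.succAbove 1) * (qp z (i.succAbove 0) - qp x (i.succAbove 0)) = 0 := by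
        intro i
        apply mul_left_cancel₀ hcq
        linear_combination hmin i
      have m0 := hm2 0
      have m1 := hm2 1
      have m2 := hm2 2
      have key : qp v l0 * (qp z l - qp x l) - qp v l * (qp z l0 - qp x l0) = 0 := by
        have e0 : (0:Fin 3).succAbove 0 = 1 ∧ (0:Fin 3).succAbove 1 = 2 ∧ (1:Fin 3).succAbove 0 = 0 ∧ (1:Fin 3).succAbove 1 = 2 ∧
          (2:Fin 3).succAbove 0 = 0 ∧ (2:Fin 3).succAbove 1 = 1 := by decide
        simp only [e0] at m0 m1 m2
        fin_cases l0 <;> fin_cases l <;> simp only [Fin.zero_eta, Fin.mk_one, Fin.reduceFinMk] <;> linarith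
      field_simp
      linear_combination key
    intro s
    refine line_vanish (toQ g) hg.hd (qp x) (qp v) (T.image fun z => (qp z l0 - qp x l0) / qp v l0) ?_ ?_ s
    · rw [Finset.card_image_of_injOn]
      · omega
      · intro z hz z' hz' h
        simp only at h
        apply qp_injective
        funext l
        rw [hzs z hz, hzs z' hz', h]
    · intro s hs
      obtain ⟨z, hz, rfl⟩ := Finset.mem_image.1 hs
      rw [← funext (hzs z hz)]
      exact (eval_qp_zero z g).2 (hT z hz).1

/-- a polynomial divisible by `r` of no larger degree is an associate -/
lemma assoc_of_dvd {k : ℕ} {r s : MvPolynomial (Fin k) ℚ} (hs : s ≠ 0) (h : r ∣ s) (hd : s.totalDegree ≤ r.totalDegree) :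
    ∃ c : ℚ, c ≠ 0 ∧ s = C c * r := by
  obtain ⟨q, rfl⟩ := h
  have hr0 : r ≠ 0 := by rintro rfl; simp at hs
  have hq0 : q ≠ 0 := by rintro rfl; simp at hs
  rw [totalDegree_mul_of_isDomain hr0 hq0] at hd
  have h0 : q.totalDegree = 0 := by omega
  rw [totalDegree_eq_zero_iff_eq_C] at h0
  refine ⟨coeff 0 q, ?_, ?_⟩
  · intro h; rw [h, C_0] at h0; exact hq0 h0
  · rw [← h0, mul_comm]

lemma degCell (g : MvPolynomial (Fin 3) ℤ) (hg : Good g) (L : ℕ) (hL : 1 ≤ L) (p k : ℕ) (hp : p.Prime) (hk : 1 ≤ k) (hm : 2 ^ (L+5) ≤ p ^ k)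
    (i : Fin 3) (r : MvPolynomial (Fin 2) ℚ) (hr : Irreducible r) (hr2 : 2 ≤ r.totalDegree) (Δ : ℕ) (hΔ : r.totalDegree ≤ Δ)
    (s : MvPolynomial (Fin 2) ℤ) (hs : toQ s ≠ 0) (hsd : (toQ s).totalDegree ≤ r.totalDegree) (hrs : r ∣ toQ s) (j : Fin 2)
    (T : Finset (Fin 3 → ℤ))
    (hT : ∀ x ∈ T, eval x g = 0 ∧ (∀ l, |x l| ≤ 4 ^ L) ∧ eval (qp (pr i x)) r = 0 ∧ ¬ (p:ℤ) ∣ eval (pr i x) (pderiv j s))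
    (hkey : ∀ x ∈ T, ∀ y ∈ T, key (p ^ k) x = key (p ^ k) y) : T.card ≤ 4 * (Δ + (L + 1)) ^ 4 := by
  classical
  rcases T.eq_empty_or_nonempty with rfl | ⟨u0, hu0⟩
  · simp
  obtain ⟨c, hc0, hc⟩ := assoc_of_dvd hs hrs hsd
  have hirr : ∀ y, eval y r = 0 → eval y (toQ s) = 0 := by intro y hy; rw [hc, map_mul, hy, mul_zero]
  have hsdeg : (toQ s).totalDegree = r.totalDegree := by
    rw [hc, totalDegree_mul_of_isDomain (by simpa using hc0) hr.ne_zero, totalDegree_C, zero_add]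
  obtain ⟨e, he⟩ : ∃ e : ℤ, (p:ℤ) ∣ e * eval (pr i u0) (pderiv j s) - 1 := by
    have hcop : IsCoprime (p:ℤ) (eval (pr i u0) (pderiv j s)) :=
      (Nat.prime_iff_prime_int.1 hp).irreducible.coprime_iff_not_dvd.2 (hT u0 hu0).2.2.2
    obtain ⟨a, b, hab⟩ := hcop
    exact ⟨b, ⟨-a, by linear_combination hab⟩⟩
  obtain ⟨h, h1, h2, h3⟩ := aux1 s (by rw [show map (Int.castRingHom ℚ) s = toQ s from rfl, hsdeg]; exact hr2) j L p (p^k) k hL (pr i u0) e he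
    (dvd_pow_self p (by omega)) dvd_rfl hm ((pr i) '' (T : Set (Fin 3 → ℤ))) (by
      rintro _ ⟨x, hx, rfl⟩
      have hx' : x ∈ T := hx
      refine ⟨fun l => key_dvd (hkey x hx' u0 hu0) _, ?_, fun l => (hT x hx').2.1 _⟩
      exact (eval_qp_zero _ s).1 (hirr _ (hT x hx').2.2.1))
  refine pairCell g hg i r h hr ?_ Δ (L+1) hΔ h2 T (fun x hx => ⟨(hT x hx).1, (hT x hx).2.2.1, h3 _ ⟨x, hx, rfl⟩⟩)
  intro hdv
  apply h1
  rw [show map (Int.castRingHom ℚ) s = toQ s from rfl, hc]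
  obtain ⟨q, rfl⟩ := hdv
  refine ⟨C c⁻¹ * q, ?_⟩
  rw [show C c * r * (C c⁻¹ * q) = C (c * c⁻¹) * (r * q) by rw [C_mul]; ring, mul_inv_cancel₀ hc0, C_1, one_mul]

end DG


namespace DG
open MvPolynomial

/-- admissible moduli -/
def IsMod (L Q m : ℕ) : Prop := ∃ p q a b : ℕ, p.Prime ∧ q.Prime ∧ p ≤ Q ∧ q ≤ Q ∧ m = p ^ a * q ^ b ∧ 2 ^ (L+5) ≤ m ∧ m ≤ 2 ^ (L+5) * Q ^ 2

lemma IsMod.pos {L Q m : ℕ} (h : IsMod L Q m) : 0 < m := by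
  obtain ⟨_, _, _, _, _, _, _, _, _, h, _⟩ := h
  exact lt_of_lt_of_le (by positivity) h

lemma IsMod.ge {L Q m : ℕ} (h : IsMod L Q m) : 2 ^ (L+5) ≤ m := by
  obtain ⟨_, _, _, _, _, _, _, _, _, h, _⟩ := h
  exact h

lemma IsMod.rad {L Q m : ℕ} (h : IsMod L Q m) : ∃ ρ : ℕ, 0 < ρ ∧ ρ ∣ m ∧ m ∣ ρ ^ m ∧ ρ ≤ Q ^ 2 := by
  have hm := h.pos
  obtain ⟨p, q, a, b, hp, hq, hpQ, hqQ, rfl, -, -⟩ := h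
  refine ⟨UniqueFactorizationMonoid.radical (p ^ a * q ^ b), ?_, UniqueFactorizationMonoid.radical_dvd_self, ?_, ?_⟩
  · exact Nat.pos_of_dvd_of_pos UniqueFactorizationMonoid.radical_dvd_self hm
  · exact Nat.dvd_radical_pow_self (by omega)
  · have h1 : UniqueFactorizationMonoid.radical (p ^ a * q ^ b) ∣ p * q := by
      refine UniqueFactorizationMonoid.radical_mul_dvd.trans (mul_dvd_mul ?_ ?_)
      · exact UniqueFactorizationMonoid.radical_pow_dvd.trans UniqueFactorizationMonoid.radical_dvd_self
      · exact UniqueFactorizationMonoid.radical_pow_dvd.trans UniqueFactorizationMonoid.radical_dvd_self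
    refine (Nat.le_of_dvd (Nat.mul_pos hp.pos hq.pos) h1).trans ?_
    rw [sq]
    exact Nat.mul_le_mul hpQ hqQ

open Classical in
lemma mods_finset (L Q : ℕ) : ∃ I : Finset ℕ, (∀ m, IsMod L Q m → m ∈ I) ∧ I.card ≤ (Q+1)^2 * (L + 6 + 2 * Q)^2 := by
  set N := L + 6 + 2 * Q with hN
  refine ⟨(Finset.range (Q+1) ×ˢ Finset.range (Q+1) ×ˢ Finset.range N ×ˢ Finset.range N).image (fun t => t.1 ^ t.2.2.1 * t.2.1 ^ t.2.2.2), ?_, ?_⟩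
  · rintro m ⟨p, q, a, b, hp, hq, hpQ, hqQ, rfl, h1, h2⟩
    have hlt : p ^ a * q ^ b < 2 ^ N := by
      have h3 : Q < 2 ^ Q := Nat.lt_two_pow_self
      have h4 : Q ^ 2 ≤ 2 ^ (2 * Q) := by
        rw [mul_comm 2 Q, pow_mul]; exact Nat.pow_le_pow_left h3.le 2
      calc p ^ a * q ^ b ≤ 2 ^ (L+5) * Q ^ 2 := h2
        _ ≤ 2 ^ (L+5) * 2 ^ (2 * Q) := Nat.mul_le_mul_left _ h4
        _ = 2 ^ (L + 5 + 2 * Q) := by rw [← pow_add]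
        _ < 2 ^ N := Nat.pow_lt_pow_right (by norm_num) (by omega)
    have ha : a < N := by
      apply (Nat.pow_lt_pow_iff_right (by norm_num : 1 < 2)).1
      refine lt_of_le_of_lt ?_ hlt
      exact (Nat.pow_le_pow_left hp.two_le a).trans (Nat.le_mul_of_pos_right _ (pow_pos hq.pos b))
    have hb : b < N := by
      apply (Nat.pow_lt_pow_iff_right (by norm_num : 1 < 2)).1
      refine lt_of_le_of_lt ?_ hlt
      exact (Nat.pow_le_pow_left hq.two_le b).trans (Nat.le_mul_of_pos_left _ (pow_pos hp.pos a))
    refine Finset.mem_image.2 ⟨(p, q, a, b), ?_, rfl⟩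
    simp only [Finset.mem_product, Finset.mem_range]
    exact ⟨by omega, by omega, ha, hb⟩
  · refine Finset.card_image_le.trans ?_
    simp only [Finset.card_product, Finset.card_range]
    apply le_of_eq; ring

lemma isMod_clog (L Q p : ℕ) (hp : p.Prime) (hpQ : p ≤ Q) : IsMod L Q (p ^ Nat.clog p (2^(L+5))) := by
  obtain ⟨-, h2, h3⟩ := clog_bound p (2^(L+5)) hp.two_le (by
    calc 2 = 2 ^ 1 := rfl
      _ ≤ 2 ^ (L+5) := Nat.pow_le_pow_right (by norm_num) (by omega))
  refine ⟨p, p, Nat.clog p (2^(L+5)), 0, hp, hp, hpQ, hpQ, (mul_one _).symm, h2, h3.trans ?_⟩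
  rw [mul_comm]
  apply Nat.mul_le_mul_left
  have := hp.pos
  nlinarith

lemma path {α : Type*} (L Q p q : ℕ) (hp : p.Prime) (hq : q.Prime) (hpQ : p ≤ Q) (hqQ : q ≤ Q) (lab : ℕ → α)
    (h : ∀ a b a' b', a' ≤ a → b' ≤ b → IsMod L Q (p ^ a * q ^ b) → IsMod L Q (p ^ a' * q ^ b') → lab (p ^ a' * q ^ b') = lab (p ^ a * q ^ b)) :
    lab (p ^ Nat.clog p (2^(L+5))) = lab (q ^ Nat.clog q (2^(L+5))) := by
  set M := 2^(L+5) with hM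
  have hM2 : 2 ≤ M := by
    calc 2 = 2 ^ 1 := rfl
      _ ≤ 2 ^ (L+5) := Nat.pow_le_pow_right (by norm_num) (by omega)
  obtain ⟨-, p2, p3⟩ := clog_bound p M hp.two_le hM2
  obtain ⟨-, q2, q3⟩ := clog_bound q M hq.two_le hM2
  have hQ1 : 1 ≤ Q := hp.pos.trans_le hpQ
  have hmod : ∀ a b, M ≤ p ^ a * q ^ b → p ^ a * q ^ b ≤ M * Q ^ 2 → IsMod L Q (p ^ a * q ^ b) :=
    fun a b h1 h2 => ⟨p, q, a, b, hp, hq, hpQ, hqQ, rfl, h1, h2⟩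
  have hMQ : M * Q ≤ M * Q ^ 2 := Nat.mul_le_mul_left _ (by nlinarith)
  have main : ∀ b, b ≤ Nat.clog q M → ∃ a, M ≤ p ^ a * q ^ b ∧ p ^ a * q ^ b ≤ M * Q ∧ lab (p ^ a * q ^ b) = lab (p ^ Nat.clog p M) := by
    intro b
    induction b with
    | zero =>
      intro _
      refine ⟨Nat.clog p M, by simpa using p2, ?_, by simp⟩
      rw [pow_zero, mul_one]
      refine p3.trans ?_
      rw [mul_comm]; exact Nat.mul_le_mul_left _ hpQ
    | succ b ih =>
      intro hb
      obtain ⟨a, a1, a2, a3⟩ := ih (by omega)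
      have hex : ∃ a', M ≤ p ^ a' * q ^ (b+1) := ⟨a, by rw [pow_succ, ← mul_assoc]; exact a1.trans (Nat.le_mul_of_pos_right _ hq.pos)⟩
      classical
      have hle : Nat.find hex ≤ a := Nat.find_le (by rw [pow_succ, ← mul_assoc]; exact a1.trans (Nat.le_mul_of_pos_right _ hq.pos))
      have hsp := Nat.find_spec hex
      have hmin := fun k => Nat.find_min (m := k) hex
      set a' := Nat.find hex
      have hup : p ^ a' * q ^ (b+1) ≤ M * Q := by
        rcases Nat.eq_zero_or_pos a' with h0 | h0
        · rw [h0, pow_zero, one_mul]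
          refine (Nat.pow_le_pow_right hq.pos hb).trans (q3.trans ?_)
          rw [mul_comm]; exact Nat.mul_le_mul_left _ hqQ
        · have := hmin (a' - 1) (by omega)
          push Not at this
          have e : p ^ a' = p ^ (a' - 1) * p := by rw [← pow_succ]; congr 1; omega
          rw [e]
          calc p ^ (a'-1) * p * q ^ (b+1) = p ^ (a'-1) * q ^ (b+1) * p := by ring
            _ ≤ M * Q := Nat.mul_le_mul this.le hpQ
      have m1 : IsMod L Q (p ^ a * q ^ b) := hmod _ _ a1 (a2.trans hMQ)
      have m2 : IsMod L Q (p ^ a' * q ^ (b+1)) := hmod _ _ hsp (hup.trans hMQ)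
      have m3 : IsMod L Q (p ^ a * q ^ (b+1)) := by
        apply hmod
        · rw [pow_succ, ← mul_assoc]; exact a1.trans (Nat.le_mul_of_pos_right _ hq.pos)
        · rw [pow_succ, ← mul_assoc, sq, ← mul_assoc]
          exact Nat.mul_le_mul a2 hqQ
      refine ⟨a', hsp, hup, ?_⟩
      rw [h a (b+1) a' (b+1) hle le_rfl m3 m2, ← h a (b+1) a b le_rfl (by omega) m3 m1, a3]
  obtain ⟨a, a1, a2, a3⟩ := main _ le_rfl
  rw [← a3, ← h a (Nat.clog q M) 0 (Nat.clog q M) (by omega) le_rfl (hmod _ _ a1 (a2.trans hMQ)) (by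
    have := isMod_clog L Q q hq hqQ
    simpa using this)]
  simp

open Classical in
/-- cover by residue classes -/
lemma key_cover (g : MvPolynomial (Fin 3) ℤ) (L Q m : ℕ) (hm : IsMod L Q m) (T : Finset (Fin 3 → ℤ))
    (hT : ∀ x ∈ T, eval x g = 0 ∧ gd g m x) (N : ℕ) (hN : ∀ κ, (T.filter (fun x => key m x = κ)).card ≤ N) :
    T.card ≤ 1024 * 4 ^ L * Q ^ 6 * N := by
  obtain ⟨ρ, h1, h2, h3, h4⟩ := hm.rad
  have := card_cover T (T.image (key m)) (fun κ x => key m x = κ) N (fun x hx => ⟨_, Finset.mem_image_of_mem _ hx, rfl⟩) (fun κ _ => hN κ)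
  refine this.trans (Nat.mul_le_mul_right _ ?_)
  refine (keys_card g m ρ m hm.pos h1 h2 h3 T hT).trans ?_
  have hm2 : m ≤ 2 ^ (L+5) * Q ^ 2 := by
    obtain ⟨_, _, _, _, _, _, _, _, _, _, h⟩ := hm
    exact h
  calc m ^ 2 * ρ ≤ (2 ^ (L+5) * Q ^ 2) ^ 2 * Q ^ 2 := Nat.mul_le_mul (Nat.pow_le_pow_left hm2 2) h4
    _ = 1024 * 4 ^ L * Q ^ 6 := by
      rw [show 4 = 2 ^ 2 by norm_num, ← pow_mul]; ring

lemma gd_dvd {g : MvPolynomial (Fin 3) ℤ} {m m' : ℕ} {x : Fin 3 → ℤ} (h : gd g m' x) (hd : m ∣ m') : gd g m x :=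
  IsCoprime.of_isCoprime_of_dvd_left h (by exact_mod_cast hd)

end DG


namespace DG
open MvPolynomial

/-- labels attached to points -/
structure LabelData (g : MvPolynomial (Fin 3) ℤ) (L Q Δ : ℕ) (S : Finset (Fin 3 → ℤ))
    (R : ℕ → (Fin 3 → ℤ) → Fin 3 → MvPolynomial (Fin 2) ℚ) (lab : (Fin 3 → ℤ) → ℕ → Fin 3 → MvPolynomial (Fin 2) ℚ) : Prop where
  R0 : ∀ m κ i, R m κ i ≠ 0
  Rd : ∀ m κ i, (R m κ i).totalDegree ≤ Δ
  mem : ∀ x ∈ S, ∀ m, IsMod L Q m → gd g m x → ∀ i, lab x m i ∈ facs (R m (key m x) i)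
  van : ∀ x ∈ S, ∀ m, IsMod L Q m → gd g m x → ∀ i, eval (qp (pr i x)) (lab x m i) = 0

lemma LabelData.card {g L Q Δ S R lab} (D : LabelData g L Q Δ S R lab) (m κ i) : (facs (R m κ i)).card ≤ Δ :=
  (facs_card (D.R0 m κ i)).trans (D.Rd m κ i)

lemma LabelData.deg {g L Q Δ S R lab} (D : LabelData g L Q Δ S R lab) {m κ i r} (h : r ∈ facs (R m κ i)) : r.totalDegree ≤ Δ :=
  (totalDegree_dvd (mem_facs h).2.1 (D.R0 m κ i)).trans (D.Rd m κ i)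

open Classical in
lemma exists_labels (g : MvPolynomial (Fin 3) ℤ) (hg : Good g) (L Q : ℕ) (hL : 1 ≤ L) (S : Finset (Fin 3 → ℤ))
    (hS : ∀ x ∈ S, eval x g = 0 ∧ ∀ l, |x l| ≤ 4 ^ L) : ∃ R lab, LabelData g L Q ((L+6)^2) S R lab := by
  have hR : ∀ (m : ℕ) (κ : Fin 3 → ℤ) (i : Fin 3), ∃ R : MvPolynomial (Fin 2) ℚ, R ≠ 0 ∧ R.totalDegree ≤ (L + 6) ^ 2 ∧
      (IsMod L Q m → ∀ x ∈ S, gd g m x → key m x = κ → eval (qp (pr i x)) R = 0) := by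
    intro m κ i
    by_cases hm : IsMod L Q m
    · obtain ⟨ρ, h1, h2, h3, h4⟩ := hm.rad
      obtain ⟨R, R0, R1, R2⟩ := class_R g hg L m ρ m hL h2 h3 hm.ge {x | x ∈ S ∧ gd g m x ∧ key m x = κ}
        (fun x hx => ⟨(hS x hx.1).1, hx.2.1, (hS x hx.1).2⟩) (fun x hx y hy => hx.2.2.trans hy.2.2.symm) i
      exact ⟨R, R0, R1, fun _ x hx h5 h6 => R2 x ⟨hx, h5, h6⟩⟩
    · exact ⟨1, one_ne_zero, by simp, fun h => absurd h hm⟩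
  choose R R0 R1 R2 using hR
  have hlab : ∀ (x : Fin 3 → ℤ) (m : ℕ) (i : Fin 3), ∃ r : MvPolynomial (Fin 2) ℚ, x ∈ S → IsMod L Q m → gd g m x →
      r ∈ facs (R m (key m x) i) ∧ eval (qp (pr i x)) r = 0 := by
    intro x m i
    by_cases h : x ∈ S ∧ IsMod L Q m ∧ gd g m x
    · obtain ⟨r, r1, r2⟩ := exists_facs_vanish (R0 m (key m x) i) (qp (pr i x)) (R2 m (key m x) i h.2.1 x h.1 h.2.2 rfl)
      exact ⟨r, fun _ _ _ => ⟨r1, r2⟩⟩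
    · exact ⟨0, fun h1 h2 h3 => absurd ⟨h1, h2, h3⟩ h⟩
  choose lab hlab using hlab
  exact ⟨R, lab, R0, R1, fun x hx m hm hgd i => (hlab x m i hx hm hgd).1, fun x hx m hm hgd i => (hlab x m i hx hm hgd).2⟩

lemma key_of_dvd {m m' : ℕ} (h : m ∣ m') (x : Fin 3 → ℤ) : key m (key m' x) = key m x := by
  funext l
  simp only [key]
  exact Int.emod_emod_of_dvd _ (by exact_mod_cast h)

open Classical in
lemma E_count {g : MvPolynomial (Fin 3) ℤ} (hg : Good g) {L Q Δ : ℕ} {S R lab} (D : LabelData g L Q Δ S R lab)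
    (hS : ∀ x ∈ S, eval x g = 0) (T : Finset (Fin 3 → ℤ)) (hTS : T ⊆ S)
    (hT : ∀ x ∈ T, ∃ m m' i, IsMod L Q m ∧ IsMod L Q m' ∧ m ∣ m' ∧ gd g m' x ∧ lab x m i ≠ lab x m' i) :
    T.card ≤ ((Q+1)^2 * (L + 6 + 2 * Q)^2) ^ 2 * 3 * (1024 * 4 ^ L * Q ^ 6 * (Δ ^ 2 * (4 * (Δ + Δ) ^ 4))) := by
  obtain ⟨I, hI, hIc⟩ := mods_finset L Q
  have := card_cover T (I ×ˢ I ×ˢ (Finset.univ : Finset (Fin 3))) (fun t x => IsMod L Q t.1 ∧ IsMod L Q t.2.1 ∧ t.1 ∣ t.2.1 ∧ gd g t.2.1 x ∧ lab x t.1 t.2.2 ≠ lab x t.2.1 t.2.2)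
    (1024 * 4 ^ L * Q ^ 6 * (Δ ^ 2 * (4 * (Δ + Δ) ^ 4))) ?_ ?_
  · refine this.trans (Nat.mul_le_mul_right _ ?_)
    simp only [Finset.card_product, Finset.card_univ, Fintype.card_fin]
    rw [sq, mul_assoc]
    exact Nat.mul_le_mul hIc (Nat.mul_le_mul_right _ hIc)
  · intro x hx
    obtain ⟨m, m', i, h⟩ := hT x hx
    refine ⟨(m, m', i), ?_, h⟩
    simp only [Finset.mem_product, Finset.mem_univ, and_true]
    exact ⟨hI _ h.1, hI _ h.2.1⟩
  · rintro ⟨m, m', i⟩ -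
    simp only
    by_cases hmm : IsMod L Q m ∧ IsMod L Q m' ∧ m ∣ m'
    swap
    · rw [Finset.filter_false_of_mem]
      · simp
      · intro x _ h; exact hmm ⟨h.1, h.2.1, h.2.2.1⟩
    obtain ⟨hm, hm', hdvd⟩ := hmm
    apply key_cover g L Q m' hm'
    · intro x hx
      rw [Finset.mem_filter] at hx
      exact ⟨hS x (hTS hx.1), hx.2.2.2.2.1⟩
    · intro κ
      have := card_cover ((T.filter (fun x => IsMod L Q m ∧ IsMod L Q m' ∧ m ∣ m' ∧ gd g m' x ∧ lab x m i ≠ lab x m' i)).filter (fun x => key m' x = κ))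
        (facs (R m (key m κ) i) ×ˢ facs (R m' κ i)) (fun t x => t.1 = lab x m i ∧ t.2 = lab x m' i) (4 * (Δ + Δ) ^ 4) ?_ ?_
      · refine this.trans (Nat.mul_le_mul_right _ ?_)
        rw [Finset.card_product, sq]
        exact Nat.mul_le_mul (D.card _ _ _) (D.card _ _ _)
      · intro x hx
        simp only [Finset.mem_filter] at hx
        obtain ⟨⟨hxT, -, -, -, hgd, hne⟩, rfl⟩ := hx
        refine ⟨(lab x m i, lab x m' i), ?_, rfl, rfl⟩
        rw [Finset.mem_product]
        constructor
        · simp only [key_of_dvd hdvd]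
          exact D.mem x (hTS hxT) m hm (gd_dvd hgd hdvd) i
        · exact D.mem x (hTS hxT) m' hm' hgd i
      · rintro ⟨r, r'⟩ hrr
        rw [Finset.mem_product] at hrr
        obtain ⟨hr, hr'⟩ := hrr
        simp only at hr hr'
        by_cases hne : r = r'
        · rw [Finset.filter_false_of_mem]
          · simp
          · intro x hx h
            simp only [Finset.mem_filter] at hx
            exact hx.1.2.2.2.2.2 (h.1.symm.trans (hne.trans h.2))
        apply pairCell g hg i r r' (mem_facs hr).1 (facs_ndvd hr hr' hne) Δ Δ (D.deg hr) (D.deg hr')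
        intro x hx
        simp only [Finset.mem_filter] at hx
        obtain ⟨⟨⟨hxT, -, -, -, hgd, -⟩, -⟩, h1, h2⟩ := hx
        refine ⟨hS x (hTS hxT), ?_, ?_⟩
        · rw [h1]; exact D.van x (hTS hxT) m hm (gd_dvd hgd hdvd) i
        · rw [h2]; exact D.van x (hTS hxT) m' hm' hgd i

open Classical in
lemma A_count {g : MvPolynomial (Fin 3) ℤ} (hg : Good g) {L Q Δ : ℕ} {S R lab} (D : LabelData g L Q Δ S R lab)
    (hS : ∀ x ∈ S, eval x g = 0 ∧ ∀ l, |x l| ≤ 4 ^ L) (T : Finset (Fin 3 → ℤ)) (hTS : T ⊆ S)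
    (hT : ∀ x ∈ T, ¬ OnLine g L x ∧ ∃ p m, p ≤ Q ∧ m = p ^ Nat.clog p (2^(L+5)) ∧ IsMod L Q m ∧ gd g m x ∧ ∀ i, (lab x m i).totalDegree ≤ 1) :
    T.card ≤ (Q+1) * (1024 * 4 ^ L * Q ^ 6 * (Δ ^ 3 * 4)) := by
  have := card_cover T (Finset.range (Q+1)) (fun p x => ∃ m, m = p ^ Nat.clog p (2^(L+5)) ∧ IsMod L Q m ∧ gd g m x ∧ ∀ i, (lab x m i).totalDegree ≤ 1)
    (1024 * 4 ^ L * Q ^ 6 * (Δ ^ 3 * 4)) ?_ ?_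
  · simpa using this
  · intro x hx
    obtain ⟨-, p, m, h1, h2⟩ := hT x hx
    exact ⟨p, Finset.mem_range.2 (by omega), m, h2⟩
  · intro p _
    set m := p ^ Nat.clog p (2^(L+5)) with hmdef
    simp only [exists_eq_left]
    by_cases hm : IsMod L Q m
    swap
    · rw [Finset.filter_false_of_mem]
      · simp
      · intro x _ h; exact hm h.1
    apply key_cover g L Q m hm
    · intro x hx
      rw [Finset.mem_filter] at hx
      exact ⟨(hS x (hTS hx.1)).1, hx.2.2.1⟩
    intro κ
    have := card_cover ((T.filter (fun x => IsMod L Q m ∧ gd g m x ∧ ∀ i, (lab x m i).totalDegree ≤ 1)).filter (fun x => key m x = κ))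
      (Fintype.piFinset fun i => facs (R m κ i)) (fun r x => ∀ i, r i = lab x m i) 4 ?_ ?_
    · refine this.trans (Nat.mul_le_mul_right _ ?_)
      rw [Fintype.card_piFinset]
      refine (Finset.prod_le_pow_card _ _ Δ (fun i _ => D.card m κ i)).trans ?_
      simp
    · intro x hx
      simp only [Finset.mem_filter] at hx
      obtain ⟨⟨hxT, -, hgd, -⟩, rfl⟩ := hx
      refine ⟨fun i => lab x m i, ?_, fun i => rfl⟩
      rw [Fintype.mem_piFinset]
      exact fun i => D.mem x (hTS hxT) m hm hgd i
    · intro r hr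
      rw [Fintype.mem_piFinset] at hr
      by_cases hr1 : ∀ i, (r i).totalDegree ≤ 1
      swap
      · rw [Finset.filter_false_of_mem]
        · simp
        · intro x hx h
          simp only [Finset.mem_filter] at hx
          exact hr1 (fun i => by rw [h i]; exact hx.1.2.2.2 i)
      apply lineCell g hg L m hm.ge r (fun i => (mem_facs (hr i)).1) hr1
      · intro x hx
        simp only [Finset.mem_filter] at hx
        obtain ⟨⟨⟨hxT, -, hgd, -⟩, -⟩, h⟩ := hx
        refine ⟨(hS x (hTS hxT)).1, (hS x (hTS hxT)).2, fun i => ?_, (hT x hxT).1⟩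
        rw [h i]; exact D.van x (hTS hxT) m hm hgd i
      · intro x hx y hy
        simp only [Finset.mem_filter] at hx hy
        exact hx.1.2.trans hy.1.2.symm

end DG


namespace DG
open MvPolynomial

/-- the three ways a nonlinear label is controlled -/
def BProp (p : ℕ) (i : Fin 3) (r : MvPolynomial (Fin 2) ℚ) (s : MvPolynomial (Fin 2) ℤ) (t : Fin 3 × Fin 2) (x : Fin 3 → ℤ) : Prop :=
  (t.1 = 0 ∧ ¬ r ∣ toQ s) ∨ (t.1 = 1 ∧ pderiv t.2 r ≠ 0 ∧ eval (qp (pr i x)) (pderiv t.2 r) = 0) ∨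
    (t.1 = 2 ∧ r ∣ toQ s ∧ ¬ (p:ℤ) ∣ eval (pr i x) (pderiv t.2 s))

lemma not_dvd_of_lt {k : ℕ} {r q : MvPolynomial (Fin k) ℚ} (hq : q ≠ 0) (h : q.totalDegree < r.totalDegree) : ¬ r ∣ q := by
  intro hd
  have := totalDegree_dvd hd hq
  omega

open Classical in
lemma B_count {g : MvPolynomial (Fin 3) ℤ} (hg : Good g) {L Q Δ : ℕ} (hL : 1 ≤ L) {S R lab} (D : LabelData g L Q Δ S R lab)
    (hS : ∀ x ∈ S, eval x g = 0 ∧ ∀ l, |x l| ≤ 4 ^ L)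
    (sh : Fin 3 → MvPolynomial (Fin 2) ℚ → MvPolynomial (Fin 2) ℤ)
    (hsh : ∀ i r, r ≠ 0 → toQ (sh i r) ≠ 0 ∧ (toQ (sh i r)).totalDegree ≤ r.totalDegree ∧ ∀ x ∈ S, eval (qp (pr i x)) r = 0 → eval (pr i x) (sh i r) = 0)
    (T : Finset (Fin 3 → ℤ)) (hTS : T ⊆ S)
    (hT : ∀ x ∈ T, ∃ p m i t, p ≤ Q ∧ m = p ^ Nat.clog p (2^(L+5)) ∧ p.Prime ∧ IsMod L Q m ∧ gd g m x ∧ 2 ≤ (lab x m i).totalDegree ∧ BProp p i (lab x m i) (sh i (lab x m i)) t x) :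
    T.card ≤ (Q+1) * 3 * 6 * (1024 * 4 ^ L * Q ^ 6 * (Δ * (4 * (Δ + (Δ + (L + 1))) ^ 4))) := by
  have := card_cover T (Finset.range (Q+1) ×ˢ (Finset.univ : Finset (Fin 3)) ×ˢ (Finset.univ : Finset (Fin 3 × Fin 2)))
    (fun b x => ∃ m, m = b.1 ^ Nat.clog b.1 (2^(L+5)) ∧ b.1.Prime ∧ IsMod L Q m ∧ gd g m x ∧ 2 ≤ (lab x m b.2.1).totalDegree ∧ BProp b.1 b.2.1 (lab x m b.2.1) (sh b.2.1 (lab x m b.2.1)) b.2.2 x)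
    (1024 * 4 ^ L * Q ^ 6 * (Δ * (4 * (Δ + (Δ + (L + 1))) ^ 4))) ?_ ?_
  · simpa [Finset.card_product, mul_assoc] using this
  · intro x hx
    obtain ⟨p, m, i, t, h1, h2⟩ := hT x hx
    exact ⟨(p, i, t), by simp; omega, m, h2⟩
  · rintro ⟨p, i, t⟩ _
    simp only
    set m := p ^ Nat.clog p (2^(L+5)) with hmdef
    simp only [exists_eq_left]
    by_cases hm : p.Prime ∧ IsMod L Q m
    swap
    · rw [Finset.filter_false_of_mem]
      · simp
      · intro x _ h; exact hm ⟨h.1, h.2.1⟩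
    obtain ⟨hp, hm⟩ := hm
    apply key_cover g L Q m hm
    · intro x hx
      rw [Finset.mem_filter] at hx
      exact ⟨(hS x (hTS hx.1)).1, hx.2.2.2.1⟩
    intro κ
    refine (card_cover _ (facs (R m κ i)) (fun r x => r = lab x m i) (4 * (Δ + (Δ + (L + 1))) ^ 4) ?_ ?_).trans (Nat.mul_le_mul_right _ (D.card m κ i))
    · intro x hx
      simp only [Finset.mem_filter] at hx
      obtain ⟨⟨hxT, -, -, hgd, -⟩, rfl⟩ := hx
      exact ⟨lab x m i, D.mem x (hTS hxT) m hm hgd i, rfl⟩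
    intro r hr
    have hirr := (mem_facs hr).1
    have hdeg := D.deg hr
    obtain ⟨s1, s2, s3⟩ := hsh i r hirr.ne_zero
    set U := Finset.filter (fun x => r = lab x m i) (Finset.filter (fun x => key m x = κ) (Finset.filter (fun x => Nat.Prime p ∧ IsMod L Q m ∧ gd g m x ∧ 2 ≤ (lab x m i).totalDegree ∧ BProp p i (lab x m i) (sh i (lab x m i)) t x) T)) with hU
    have hUm : ∀ x ∈ U, x ∈ S ∧ gd g m x ∧ 2 ≤ r.totalDegree ∧ BProp p i r (sh i r) t x ∧ key m x = κ ∧ eval (qp (pr i x)) r = 0 := by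
      intro x hx
      simp only [hU, Finset.mem_filter] at hx
      obtain ⟨⟨⟨hxT, -, -, hgd, h2, hB⟩, hk⟩, h⟩ := hx
      have := D.van x (hTS hxT) m hm hgd i
      rw [← h] at h2 hB this
      exact ⟨hTS hxT, hgd, h2, hB, hk, this⟩
    rcases U.eq_empty_or_nonempty with h0 | ⟨u, hu⟩
    · rw [h0]; simp
    have h2 := (hUm u hu).2.2.1
    obtain ⟨t1, j⟩ := t
    rcases (hUm u hu).2.2.2.1 with ⟨ht, hnd⟩ | ⟨ht, hj, -⟩ | ⟨ht, hd, -⟩ <;> simp only at ht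
    · refine (pairCell g hg i r _ hirr hnd Δ Δ hdeg (s2.trans hdeg) U ?_).trans ?_
      · intro x hx
        obtain ⟨hxS, _, _, _, _, h0⟩ := hUm x hx
        exact ⟨(hS x hxS).1, h0, (eval_qp_zero _ _).2 (s3 x hxS h0)⟩
      · gcongr; omega
    · simp only at hj
      have hd1 : (pderiv j r).totalDegree ≤ r.totalDegree - 1 := totalDegree_pderiv_le r j _ (by omega)
      refine (pairCell g hg i r (pderiv j r) hirr (not_dvd_of_lt hj (by omega)) Δ Δ hdeg (by omega) U ?_).trans ?_
      · intro x hx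
        obtain ⟨hxS, _, _, hB, _, h0⟩ := hUm x hx
        refine ⟨(hS x hxS).1, h0, ?_⟩
        rcases hB with ⟨h, -⟩ | ⟨-, -, h⟩ | ⟨h, -⟩ <;> simp only at h
        · rw [ht] at h; simp at h
        · exact h
        · rw [ht] at h; simp at h
      · gcongr; omega
    · have hk1 : 1 ≤ Nat.clog p (2^(L+5)) := (clog_bound p (2^(L+5)) hp.two_le (by
        calc 2 = 2 ^ 1 := rfl
          _ ≤ 2 ^ (L+5) := Nat.pow_le_pow_right (by norm_num) (by omega))).1
      refine (degCell g hg L hL p _ hp hk1 hm.ge i r hirr h2 Δ hdeg (sh i r) s1 s2 hd j U ?_ ?_).trans ?_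
      · intro x hx
        obtain ⟨hxS, _, _, hB, _, h0⟩ := hUm x hx
        refine ⟨(hS x hxS).1, (hS x hxS).2, h0, ?_⟩
        rcases hB with ⟨h, -⟩ | ⟨h, -⟩ | ⟨-, -, h⟩ <;> simp only at h
        · rw [ht] at h; simp at h
        · rw [ht] at h; simp at h
        · exact h
      · intro x hx y hy
        exact (hUm x hx).2.2.2.2.1.trans (hUm y hy).2.2.2.2.1.symm
      · apply Nat.mul_le_mul_left; apply Nat.pow_le_pow_left; omega

/-- height bound for labels -/
def Hs (L Δ : ℕ) : ℕ := ((Δ+1)^2 * (4^L)^Δ)^((Δ+1)^2)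

lemma exists_pderiv_ne {r : MvPolynomial (Fin 2) ℚ} (h : 1 ≤ r.totalDegree) : ∃ j, pderiv j r ≠ 0 := by
  by_contra! h0
  obtain ⟨m, hm, hmd⟩ : ∃ m ∈ r.support, 1 ≤ m.sum fun _ e => e := by
    by_contra! h1
    have : r.totalDegree ≤ 0 := Finset.sup_le fun m hm => by have := h1 m hm; omega
    omega
  rw [Finsupp.sum_fintype _ _ (by simp)] at hmd
  obtain ⟨j, hj⟩ : ∃ j, 1 ≤ m j := by
    by_contra! h1
    rw [Finset.sum_eq_zero (fun j _ => by have := h1 j; omega)] at hmd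
    omega
  have h2 := congrArg (coeff (m - Finsupp.single j 1)) (h0 j)
  rw [coeff_pderiv, coeff_zero] at h2
  rw [tsub_add_cancel_of_le (by rwa [Finsupp.single_le_iff])] at h2
  have h3 := mem_support_iff.1 hm
  rcases mul_eq_zero.1 h2 with h | h
  · exact h3 h
  · have : (0:ℚ) ≤ (((m - Finsupp.single j 1 : Fin 2 →₀ ℕ) j : ℕ) : ℚ) := by positivity
    linarith

open Classical in
lemma labels_total (g : MvPolynomial (Fin 3) ℤ) (hg : Good g) (L X : ℕ) (hL : 1 ≤ L) (S : Finset (Fin 3 → ℤ))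
    (hS : ∀ x ∈ S, eval x g = 0 ∧ (∀ l, |x l| ≤ 4 ^ L) ∧ eval x (pderiv 2 g) ≠ 0 ∧ ¬ OnLine g L x)
    (hX1 : ∀ x ∈ S, |eval x (pderiv 2 g)| ≤ 2 ^ X)
    (hX2 : ∀ x ∈ S, ∀ (i : Fin 3) (s : MvPolynomial (Fin 2) ℤ) (j : Fin 2), s.totalDegree ≤ (L+6)^2 → (∀ m, |coeff m s| ≤ Hs L ((L+6)^2)) →
      |eval x (pderiv 2 g) * eval (pr i x) (pderiv j s)| ≤ 2 ^ X) :
    ∀ Δ Q, Δ = (L+6)^2 → Q = Qn X → S.card ≤ ((Q+1)^2 * (L + 6 + 2 * Q)^2) ^ 2 * 3 * (1024 * 4 ^ L * Q ^ 6 * (Δ ^ 2 * (4 * (Δ + Δ) ^ 4)))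
      + ((Q+1) * (1024 * 4 ^ L * Q ^ 6 * (Δ ^ 3 * 4)) + (Q+1) * 3 * 6 * (1024 * 4 ^ L * Q ^ 6 * (Δ * (4 * (Δ + (Δ + (L + 1))) ^ 4)))) := by
  intro Δ Q hΔ hQ
  have hS' : ∀ x ∈ S, eval x g = 0 ∧ ∀ l, |x l| ≤ 4 ^ L := fun x hx => ⟨(hS x hx).1, (hS x hx).2.1⟩
  obtain ⟨R, lab, D⟩ := exists_labels g hg L Q hL S hS'
  rw [← hΔ] at D hX2
  -- integral representatives
  have hsh : ∀ (i : Fin 3) (r : MvPolynomial (Fin 2) ℚ), ∃ s : MvPolynomial (Fin 2) ℤ, r ≠ 0 → s ≠ 0 ∧ s.totalDegree ≤ r.totalDegree ∧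
      (r.totalDegree ≤ Δ → ∀ m, |coeff m s| ≤ Hs L Δ) ∧ ∀ x ∈ S, eval (qp (pr i x)) r = 0 → eval (pr i x) s = 0 := by
    intro i r
    by_cases h0 : r = 0
    · exact ⟨0, fun h => absurd h0 h⟩
    obtain ⟨s, h1, h2, h3, h4⟩ := heightPoly r.totalDegree (4^L) (Nat.one_le_pow _ _ (by norm_num)) r h0 le_rfl
      {y | ∃ x ∈ S, y = pr i x ∧ eval (qp y) r = 0} (by
        rintro y ⟨x, hx, rfl, h⟩
        refine ⟨fun l => ?_, h⟩
        have := (hS' x hx).2 (i.succAbove l)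
        simpa [pr] using this)
    refine ⟨s, fun _ => ⟨h1, h2, fun hd m => (h3 m).trans ?_, fun x hx h => h4 _ ⟨x, hx, rfl, h⟩⟩⟩
    have : ((r.totalDegree + 1) ^ 2 * (4 ^ L) ^ r.totalDegree) ^ (r.totalDegree + 1) ^ 2 ≤ Hs L Δ := by
      unfold Hs
      have p4 : 1 ≤ 4 ^ L := Nat.one_le_pow _ _ (by norm_num)
      have a1 : (r.totalDegree + 1) ^ 2 ≤ (Δ + 1) ^ 2 := Nat.pow_le_pow_left (by omega) 2
      have a2 : (4 ^ L) ^ r.totalDegree ≤ (4 ^ L) ^ Δ := Nat.pow_le_pow_right p4 hd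
      refine (Nat.pow_le_pow_left (Nat.mul_le_mul a1 a2) _).trans (Nat.pow_le_pow_right ?_ a1)
      exact Nat.mul_pos (by positivity) (by positivity)
    exact_mod_cast this
  choose sh hsh using hsh
  have toQ0 : ∀ s : MvPolynomial (Fin 2) ℤ, s ≠ 0 → toQ s ≠ 0 := by
    intro s hs h
    apply hs
    apply map_injective (Int.castRingHom ℚ) (RingHom.injective_int _)
    simpa [toQ] using h
  have hsh' : ∀ i r, r ≠ 0 → toQ (sh i r) ≠ 0 ∧ (toQ (sh i r)).totalDegree ≤ r.totalDegree ∧ ∀ x ∈ S, eval (qp (pr i x)) r = 0 → eval (pr i x) (sh i r) = 0 := by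
    intro i r hr
    obtain ⟨h1, h2, -, h4⟩ := hsh i r hr
    refine ⟨toQ0 _ h1, le_trans ?_ h2, h4⟩
    exact Finset.sup_mono (support_map_subset _ _)
  have gdp : ∀ (x : Fin 3 → ℤ) (p k : ℕ), p.Prime → ¬ (p:ℤ) ∣ eval x (pderiv 2 g) → gd g (p ^ k) x := by
    intro x p k hp h
    unfold gd
    rw [Nat.cast_pow]
    exact ((Nat.prime_iff_prime_int.1 hp).irreducible.coprime_iff_not_dvd.2 h).pow_left
  set E := S.filter (fun x => ∃ m m' i, IsMod L Q m ∧ IsMod L Q m' ∧ m ∣ m' ∧ gd g m' x ∧ lab x m i ≠ lab x m' i) with hE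
  set A := S.filter (fun x => ¬ OnLine g L x ∧ ∃ p m, p ≤ Q ∧ m = p ^ Nat.clog p (2^(L+5)) ∧ IsMod L Q m ∧ gd g m x ∧ ∀ i, (lab x m i).totalDegree ≤ 1) with hA
  set B := S.filter (fun x => ∃ p m i t, p ≤ Q ∧ m = p ^ Nat.clog p (2^(L+5)) ∧ p.Prime ∧ IsMod L Q m ∧ gd g m x ∧ 2 ≤ (lab x m i).totalDegree ∧ BProp p i (lab x m i) (sh i (lab x m i)) t x) with hB
  have hsub : S ⊆ E ∪ (A ∪ B) := by
    intro x hx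
    obtain ⟨hx1, hx2, hx3, hx4⟩ := hS x hx
    simp only [Finset.mem_union]
    by_cases hxE : x ∈ E
    · exact Or.inl hxE
    right
    obtain ⟨p, hp, hpQ, hpW⟩ := pool X _ hx3 (hX1 x hx)
    rw [← hQ] at hpQ
    have hmp := isMod_clog L Q p hp hpQ
    have hgp := gdp x p (Nat.clog p (2^(L+5))) hp hpW
    by_cases hlin : ∀ i, (lab x (p ^ Nat.clog p (2^(L+5))) i).totalDegree ≤ 1
    · left
      exact Finset.mem_filter.2 ⟨hx, hx4, p, _, hpQ, rfl, hmp, hgp, hlin⟩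
    right
    push Not at hlin
    obtain ⟨i, hi⟩ := hlin
    set r := lab x (p ^ Nat.clog p (2^(L+5))) i with hr
    have hrm := D.mem x hx _ hmp hgp i
    have hirr := (mem_facs hrm).1
    have hdeg := D.deg hrm
    by_cases hdv : r ∣ toQ (sh i r)
    swap
    · exact Finset.mem_filter.2 ⟨hx, p, _, i, (0, 0), hpQ, rfl, hp, hmp, hgp, hi, Or.inl ⟨rfl, hdv⟩⟩
    obtain ⟨j, hj⟩ := exists_pderiv_ne (r := r) (by omega)
    by_cases hj0 : eval (qp (pr i x)) (pderiv j r) = 0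
    · exact Finset.mem_filter.2 ⟨hx, p, _, i, (1, j), hpQ, rfl, hp, hmp, hgp, hi, Or.inr (Or.inl ⟨rfl, hj, hj0⟩)⟩
    obtain ⟨s1, s2, s3, s4⟩ := hsh i r hirr.ne_zero
    obtain ⟨c, hc0, hc⟩ := assoc_of_dvd (hsh' i r hirr.ne_zero).1 hdv (hsh' i r hirr.ne_zero).2.1
    have hjs : eval (pr i x) (pderiv j (sh i r)) ≠ 0 := by
      rw [Ne, ← eval_qp_zero, ← toQ_pderiv, hc, pderiv_C_mul, map_mul, eval_C]
      exact mul_ne_zero hc0 hj0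
    obtain ⟨q, hq, hqQ, hqW⟩ := pool X _ (mul_ne_zero hx3 hjs) (hX2 x hx i (sh i r) j (s2.trans hdeg) (s3 hdeg))
    rw [← hQ] at hqQ
    have hq1 : ¬ (q:ℤ) ∣ eval x (pderiv 2 g) := fun h => hqW (h.mul_right _)
    have hq2 : ¬ (q:ℤ) ∣ eval (pr i x) (pderiv j (sh i r)) := fun h => hqW (h.mul_left _)
    have hmq := isMod_clog L Q q hq hqQ
    have hgq := gdp x q (Nat.clog q (2^(L+5))) hq hq1
    have heq : r = lab x (q ^ Nat.clog q (2^(L+5))) i := by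
      rw [hr]
      apply path L Q p q hp hq hpQ hqQ (fun m => lab x m i)
      intro a b a' b' haa hbb h1 h2
      by_contra hne
      apply hxE
      refine Finset.mem_filter.2 ⟨hx, _, _, i, h2, h1, mul_dvd_mul (pow_dvd_pow _ haa) (pow_dvd_pow _ hbb), ?_, hne⟩
      have e1 := gdp x p a hp hpW
      have e2 := gdp x q b hq hq1
      unfold gd at *
      rw [Nat.cast_mul]
      exact e1.mul_left e2
    refine Finset.mem_filter.2 ⟨hx, q, _, i, (2, j), hqQ, rfl, hq, hmq, hgq, ?_, ?_⟩
    · rw [← heq]; exact hi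
    · rw [← heq]; exact Or.inr (Or.inr ⟨rfl, hdv, hq2⟩)
  refine (Finset.card_le_card hsub).trans ((Finset.card_union_le _ _).trans (Nat.add_le_add ?_ ((Finset.card_union_le _ _).trans (Nat.add_le_add ?_ ?_))))
  · exact E_count hg D (fun x hx => (hS' x hx).1) E (Finset.filter_subset _ _) (fun x hx => (Finset.mem_filter.1 hx).2)
  · exact A_count hg D hS' A (Finset.filter_subset _ _) (fun x hx => (Finset.mem_filter.1 hx).2)
  · exact B_count hg hL D hS' sh hsh' B (Finset.filter_subset _ _) (fun x hx => (Finset.mem_filter.1 hx).2)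

end DG


namespace DG
open MvPolynomial

/-- exponent bound -/
def XL (L : ℕ) : ℕ := (8 + 125 * (8 * L + 7) + 6 * L) + (3 * (L+6)^2 + 2 * L * (L+6)^2 + (2 * (L+6)^2 + 2 * L * (L+6)^2) * ((L+6)^2 + 1)^2)

/-- the polylogarithmic factor -/
def fA (L : ℕ) : ℕ := 256 * 3 + (588 + (1176 * (588 + 800 * (Qn (XL L) + 1)^3) * (L+1) +
  (((Qn (XL L)+1)^2 * (L + 6 + 2 * Qn (XL L))^2) ^ 2 * 3 * (1024 * Qn (XL L) ^ 6 * (((L+6)^2) ^ 2 * (4 * ((L+6)^2 + (L+6)^2) ^ 4)))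
      + ((Qn (XL L)+1) * (1024 * Qn (XL L) ^ 6 * (((L+6)^2) ^ 3 * 4)) + (Qn (XL L)+1) * 3 * 6 * (1024 * Qn (XL L) ^ 6 * ((L+6)^2 * (4 * ((L+6)^2 + ((L+6)^2 + (L + 1))) ^ 4)))))))

lemma PB_XL : PB XL := by
  unfold XL
  repeat (first | exact PB.const _ | exact PB.id | refine PB.pow ?_ _ | refine PB.mul ?_ ?_ | refine PB.add ?_ ?_)

lemma PB_Q : PB (fun L => Qn (XL L)) := by
  unfold Qn
  repeat (first | exact PB_XL | exact PB.const _ | exact PB.id | refine PB.pow ?_ _ | refine PB.mul ?_ ?_ | refine PB.add ?_ ?_)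

lemma PB_fA_aux (q : ℕ → ℕ) (hq : PB q) : PB (fun L => 256 * 3 + (588 + (1176 * (588 + 800 * (q L + 1)^3) * (L+1) +
  (((q L+1)^2 * (L + 6 + 2 * q L)^2) ^ 2 * 3 * (1024 * q L ^ 6 * (((L+6)^2) ^ 2 * (4 * ((L+6)^2 + (L+6)^2) ^ 4)))
      + ((q L+1) * (1024 * q L ^ 6 * (((L+6)^2) ^ 3 * 4)) + (q L+1) * 3 * 6 * (1024 * q L ^ 6 * ((L+6)^2 * (4 * ((L+6)^2 + ((L+6)^2 + (L + 1))) ^ 4)))))))) := by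
  have hd : PB (fun L => (L+6)^2) := PB.pow (PB.add PB.id (PB.const 6)) 2
  have h1 : PB (fun L => q L + 1) := PB.add hq (PB.const 1)
  have e1 : PB (fun L => 1176 * (588 + 800 * (q L + 1)^3) * (L+1)) :=
    PB.mul (PB.mul (PB.const _) (PB.add (PB.const _) (PB.mul (PB.const _) (PB.pow h1 3)))) (PB.add PB.id (PB.const 1))
  have e0 : PB (fun L => 1024 * q L ^ 6) := PB.mul (PB.const _) (PB.pow hq 6)
  have e2 : PB (fun L => ((q L+1)^2 * (L + 6 + 2 * q L)^2) ^ 2 * 3) :=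
    PB.mul (PB.pow (PB.mul (PB.pow h1 2) (PB.pow (PB.add (PB.add PB.id (PB.const 6)) (PB.mul (PB.const 2) hq)) 2)) 2) (PB.const 3)
  have e3 : PB (fun L => ((L+6)^2) ^ 2 * (4 * ((L+6)^2 + (L+6)^2) ^ 4)) :=
    PB.mul (PB.pow hd 2) (PB.mul (PB.const 4) (PB.pow (PB.add hd hd) 4))
  have e4 : PB (fun L => ((L+6)^2) ^ 3 * 4) := PB.mul (PB.pow hd 3) (PB.const 4)
  have e5 : PB (fun L => (L+6)^2 * (4 * ((L+6)^2 + ((L+6)^2 + (L + 1))) ^ 4)) :=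
    PB.mul hd (PB.mul (PB.const 4) (PB.pow (PB.add hd (PB.add hd (PB.add PB.id (PB.const 1)))) 4))
  have e6 := PB.mul e2 (PB.mul e0 e3)
  have e7 := PB.mul h1 (PB.mul e0 e4)
  have e8 := PB.mul (PB.mul (PB.mul h1 (PB.const 3)) (PB.const 6)) (PB.mul e0 e5)
  exact PB.add (PB.const (256*3)) (PB.add (PB.const 588) (PB.add e1 (PB.add e6 (PB.add e7 e8))))

lemma PB_fA : PB fA := PB_fA_aux _ PB_Q

lemma totalDegree_toQ {k : ℕ} (g : MvPolynomial (Fin k) ℤ) : (toQ g).totalDegree = g.totalDegree := by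
  unfold toQ totalDegree
  rw [support_map_of_injective _ (RingHom.injective_int (Int.castRingHom ℚ))]

/-- height of the quartic -/
def H0 (L : ℕ) : ℕ := ((4+1)^3 * (4^L)^4)^((4+1)^3)

lemma H0_le (L : ℕ) : H0 L ≤ 2 ^ (125 * (8 * L + 7)) := by
  unfold H0
  rw [mul_comm 125, pow_mul]
  norm_num only
  apply Nat.pow_le_pow_left
  rw [← pow_mul, show (4:ℕ) = 2 ^ 2 by norm_num, ← pow_mul, pow_add, show 2 * (L * 2 ^ 2) = 8 * L by ring, mul_comm]
  apply Nat.mul_le_mul_left; norm_num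

lemma Hs_le (L Δ : ℕ) : Hs L Δ ≤ 2 ^ ((2 * Δ + 2 * L * Δ) * (Δ + 1) ^ 2) := by
  unfold Hs
  rw [pow_mul 2]
  apply Nat.pow_le_pow_left
  rw [pow_add]
  apply Nat.mul_le_mul
  · rw [mul_comm 2 Δ, pow_mul]
    exact Nat.pow_le_pow_left (Nat.lt_two_pow_self) 2
  · rw [← pow_mul, show (4:ℕ) = 2 ^ 2 by norm_num, ← pow_mul, ← mul_assoc]

open Classical in
lemma claimA_bdd (g : MvPolynomial (Fin 3) ℤ) (hg : Good g) (L : ℕ) (hL : 1 ≤ L) (hH : ∀ m, |coeff m g| ≤ H0 L) (S : Finset (Fin 3 → ℤ))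
    (hS : ∀ x ∈ S, eval x g = 0 ∧ ∀ l, |x l| ≤ 4 ^ L) :
    S.card ≤ (588 + (1176 * (588 + 800 * (Qn (XL L) + 1)^3) * (L+1) +
  (((Qn (XL L)+1)^2 * (L + 6 + 2 * Qn (XL L))^2) ^ 2 * 3 * (1024 * Qn (XL L) ^ 6 * (((L+6)^2) ^ 2 * (4 * ((L+6)^2 + (L+6)^2) ^ 4)))
      + ((Qn (XL L)+1) * (1024 * Qn (XL L) ^ 6 * (((L+6)^2) ^ 3 * 4)) + (Qn (XL L)+1) * 3 * 6 * (1024 * Qn (XL L) ^ 6 * ((L+6)^2 * (4 * ((L+6)^2 + ((L+6)^2 + (L + 1))) ^ 4))))))) * 4 ^ L := by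
  have hgd : g.totalDegree ≤ 3 + 1 := by rw [← totalDegree_toQ]; exact hg.hd
  have p4 : 1 ≤ 4 ^ L := Nat.one_le_pow _ _ (by norm_num)
  have e1 : 8 + 125 * (8 * L + 7) + 6 * L ≤ XL L := by unfold XL; omega
  have cst : ∀ B, B ≤ 4 ^ L → (3+1)^3 * (((3+1) * H0 L) * B ^ 3) ≤ 2 ^ (8 + 125 * (8 * L + 7) + 6 * L) := by
    intro B hB
    have : B ^ 3 ≤ 2 ^ (6 * L) := by
      refine (Nat.pow_le_pow_left hB 3).trans (le_of_eq ?_)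
      rw [show (4:ℕ) = 2 ^ 2 by norm_num, ← pow_mul, ← pow_mul]; congr 1; ring
    calc (3+1)^3 * (((3+1) * H0 L) * B ^ 3) = 2 ^ 8 * H0 L * B ^ 3 := by ring
      _ ≤ 2 ^ 8 * 2 ^ (125 * (8 * L + 7)) * 2 ^ (6 * L) := Nat.mul_le_mul (Nat.mul_le_mul_left _ (H0_le L)) this
      _ = _ := by rw [← pow_add, ← pow_add]
  have hW : ∀ x ∈ S, |eval x (pderiv 2 g)| ≤ 2 ^ (8 + 125 * (8 * L + 7) + 6 * L) := by
    intro x hx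
    refine (abs_eval_pderiv_le g 2 3 (H0 L) (4^L) hgd hH p4 x (by simpa using (hS x hx).2)).trans ?_
    exact_mod_cast cst (4^L) le_rfl
  have hX1 : ∀ x ∈ S, |eval x (pderiv 2 g)| ≤ 2 ^ (XL L) := fun x hx => (hW x hx).trans (pow_le_pow_right₀ (by norm_num) e1)
  have hXn : ∀ v : Fin 3 → ℤ, (∀ j, |v j| ≤ 2 ^ (L+1)) → |eval v (pderiv 2 (homogeneousComponent 4 g))| ≤ 2 ^ (XL L) := by
    intro v hv
    refine (abs_eval_pderiv_le (homogeneousComponent 4 g) 2 3 (H0 L) (2 ^ (L+1)) ?_ ?_ (Nat.one_le_pow _ _ (by norm_num)) v (by simpa using hv)).trans ?_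
    · exact (homogeneousComponent_isHomogeneous 4 g).totalDegree_le
    · intro m
      rw [coeff_homogeneousComponent]
      split_ifs
      · exact hH m
      · simp
    · have := (cst (2 ^ (L+1)) (by
        rw [show (4:ℕ) = 2 ^ 2 by norm_num, ← pow_mul]
        exact Nat.pow_le_pow_right (by norm_num) (by omega))).trans (Nat.pow_le_pow_right (by norm_num) e1)
      exact_mod_cast this
  have hX2 : ∀ x ∈ S, ∀ (i : Fin 3) (s : MvPolynomial (Fin 2) ℤ) (j : Fin 2), s.totalDegree ≤ (L+6)^2 → (∀ m, |coeff m s| ≤ Hs L ((L+6)^2)) →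
      |eval x (pderiv 2 g) * eval (pr i x) (pderiv j s)| ≤ 2 ^ (XL L) := by
    intro x hx i s j hs hc
    have h1 := abs_eval_pderiv_le s j ((L+6)^2) (Hs L ((L+6)^2)) (4^L) (by omega) hc p4 (pr i x) (by
      intro l; simpa [pr] using (hS x hx).2 (i.succAbove l))
    set Δ := (L+6)^2 with hΔ
    have h2 : (Δ+1)^2 * (((Δ+1) * Hs L Δ) * (4^L)^Δ) ≤ 2 ^ (3 * Δ + 2 * L * Δ + (2 * Δ + 2 * L * Δ) * (Δ + 1)^2) := by
      have a1 : Δ + 1 ≤ 2 ^ Δ := Nat.lt_two_pow_self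
      have a2 : (4^L)^Δ = 2 ^ (2 * L * Δ) := by rw [← pow_mul, show (4:ℕ) = 2 ^ 2 by norm_num, ← pow_mul, ← mul_assoc]
      rw [a2]
      calc (Δ+1)^2 * (((Δ+1) * Hs L Δ) * 2 ^ (2 * L * Δ)) = (Δ+1)^3 * 2 ^ (2 * L * Δ) * Hs L Δ := by ring
        _ ≤ (2 ^ Δ)^3 * 2 ^ (2 * L * Δ) * 2 ^ ((2 * Δ + 2 * L * Δ) * (Δ + 1) ^ 2) :=
          Nat.mul_le_mul (Nat.mul_le_mul_right _ (Nat.pow_le_pow_left a1 3)) (Hs_le L Δ)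
        _ = _ := by rw [← pow_mul, ← pow_add, ← pow_add]; congr 1; ring
    have h3 : |eval (pr i x) (pderiv j s)| ≤ 2 ^ (3 * Δ + 2 * L * Δ + (2 * Δ + 2 * L * Δ) * (Δ + 1)^2) := by
      refine h1.trans ?_
      exact_mod_cast h2
    rw [abs_mul]
    unfold XL
    rw [pow_add]
    exact mul_le_mul (hW x hx) h3 (abs_nonneg _) (by positivity)
  set S0 := S.filter (fun x => eval x (pderiv 2 g) = 0) with hS0
  set S1 := S.filter (fun x => OnLine g L x) with hS1
  set S2 := S.filter (fun x => eval x (pderiv 2 g) ≠ 0 ∧ ¬ OnLine g L x) with hS2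
  have hsub : S ⊆ S0 ∪ (S1 ∪ S2) := by
    intro x hx
    simp only [hS0, hS1, hS2, Finset.mem_union, Finset.mem_filter]
    tauto
  have c0 : S0.card ≤ 588 * 4 ^ L := by
    have := count3 2 (toQ g) (pderiv 2 (toQ g)) hg.irr hg.hd (hg.hc 2)
      (not_dvd_of_degree (totalDegree_eq_four hg.hd (hg.hc 0)) (pderiv_ne_zero (hg.hc 2)) (totalDegree_pderiv_le _ _ 3 hg.hd)) 3
      (totalDegree_pderiv_le _ _ 3 hg.hd) S0 (4^L) (by
        intro x hx
        rw [hS0, Finset.mem_filter] at hx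
        refine ⟨(eval_qp_zero x g).2 (hS x hx.1).1, ?_, by simpa using (hS x hx.1).2⟩
        rw [toQ_pderiv]; exact (eval_qp_zero x _).2 hx.2)
    refine this.trans ?_
    norm_num only
    omega
  have c1 : S1.card ≤ (1176 * (588 + 800 * (Qn (XL L) + 1)^3)) * 4 ^ L * (L+1) :=
    lines_total g hg L (XL L) hXn S1 (by
      intro x hx
      rw [hS1, Finset.mem_filter] at hx
      exact ⟨(hS x hx.1).2, hx.2⟩)
  have c2 := labels_total g hg L (XL L) hL S2 (by
      intro x hx
      rw [hS2, Finset.mem_filter] at hx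
      exact ⟨(hS x hx.1).1, (hS x hx.1).2, hx.2⟩)
    (fun x hx => hX1 x (Finset.filter_subset _ _ hx)) (fun x hx => hX2 x (Finset.filter_subset _ _ hx)) _ _ rfl rfl
  refine (Finset.card_le_card hsub).trans ((Finset.card_union_le _ _).trans ((Nat.add_le_add c0 ((Finset.card_union_le _ _).trans (Nat.add_le_add c1 c2))).trans (le_of_eq ?_)))
  generalize (L+6)^2 = Δ
  generalize Qn (XL L) = Q
  generalize 4 ^ L = P
  ring

lemma Good.scale {g g' : MvPolynomial (Fin 3) ℤ} (hg : Good g) (c : ℚ) (hc : c ≠ 0) (h : toQ g' = C c * toQ g) : Good g' := by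
  have hu : IsUnit (C c : MvPolynomial (Fin 3) ℚ) := (Ne.isUnit hc).map C
  have hF : homogeneousComponent 4 (toQ g') = C c * homogeneousComponent 4 (toQ g) := by
    rw [h, homogeneousComponent_C_mul]
  refine ⟨?_, ?_, ?_, ?_, ?_⟩
  · rw [h]
    refine (totalDegree_mul _ _).trans ?_
    rw [totalDegree_C, zero_add]; exact hg.hd
  · rw [h]; exact (irreducible_isUnit_mul hu).2 hg.irr
  · rw [hF]; exact (irreducible_isUnit_mul hu).2 hg.irrF
  · intro i
    rw [h, coeff_C_mul]
    exact mul_ne_zero hc (hg.hc i)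
  · intro v hv
    rw [hF]
    have : ∑ j, C (v j) * pderiv j (C c * homogeneousComponent 4 (toQ g)) = C c * ∑ j, C (v j) * pderiv j (homogeneousComponent 4 (toQ g)) := by
      rw [Finset.mul_sum]
      refine Finset.sum_congr rfl fun j _ => ?_
      rw [pderiv_C_mul]
      ring
    rw [this]
    exact mul_ne_zero hu.ne_zero (hg.nc v hv)

theorem claimA : ∃ c k : ℕ, ∀ g : MvPolynomial (Fin 3) ℤ, Good g → ∀ L, 1 ≤ L → ∀ S : Finset (Fin 3 → ℤ),
    (∀ x ∈ S, eval x g = 0 ∧ ∀ l, |x l| ≤ 4 ^ L) → S.card ≤ c * L ^ k * 4 ^ L := by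
  obtain ⟨c, k, hck⟩ := PB_fA
  refine ⟨c, k, fun g hg L hL S hS => ?_⟩
  refine le_trans ?_ (Nat.mul_le_mul_right _ (hck L hL))
  have p4 : 1 ≤ 4 ^ L := Nat.one_le_pow _ _ (by norm_num)
  obtain ⟨g', h1, h2, h3, h4⟩ := heightPoly 4 (4^L) p4 (toQ g) hg.irr.ne_zero hg.hd (S : Set (Fin 3 → ℤ)) (by
    intro x hx
    have hx' : x ∈ S := hx
    exact ⟨by simpa using (hS x hx').2, (eval_qp_zero x g).2 (hS x hx').1⟩)
  by_cases hd : toQ g ∣ toQ g'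
  · have h0 : toQ g' ≠ 0 := by
      intro h
      apply h1
      apply map_injective (Int.castRingHom ℚ) (RingHom.injective_int _)
      simpa [toQ] using h
    obtain ⟨a, ha, hga⟩ := assoc_of_dvd h0 hd (by
      rw [totalDegree_eq_four hg.hd (hg.hc 0), totalDegree_toQ]; exact h2)
    refine (claimA_bdd g' (hg.scale a ha hga) L hL h3 S (fun x hx => ⟨h4 x hx, (hS x hx).2⟩)).trans (Nat.mul_le_mul_right _ ?_)
    unfold fA
    exact Nat.le_add_left _ _
  · have := count3 2 (toQ g) (toQ g') hg.irr hg.hd (hg.hc 2) hd 4 (by rw [totalDegree_toQ]; exact h2) S (4^L) (by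
      intro x hx
      exact ⟨(eval_qp_zero x g).2 (hS x hx).1, (eval_qp_zero x g').2 (h4 x hx), by simpa using (hS x hx).2⟩)
    refine this.trans ?_
    have h5 : 256 * 3 * 4 ^ L ≤ fA L * 4 ^ L := Nat.mul_le_mul_right _ (by unfold fA; exact Nat.le_add_right _ _)
    refine le_trans ?_ h5
    norm_num only
    omega

end DG


namespace DG
open MvPolynomial

/-- a filtered algebra -/
structure Filt (A : Type*) [CommRing A] [Algebra ℚ A] where
  V : ℕ → Submodule ℚ A
  one : (1:A) ∈ V 0
  mul : ∀ d e a b, a ∈ V d → b ∈ V e → a * b ∈ V (d + e)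
  mono : Monotone V

lemma Filt.pow {A : Type*} [CommRing A] [Algebra ℚ A] (F : Filt A) {a : A} {d : ℕ} (ha : a ∈ F.V d) (n : ℕ) : a ^ n ∈ F.V (n * d) := by
  induction n with
  | zero => simpa using F.one
  | succ n ih => rw [pow_succ, Nat.succ_mul]; exact F.mul _ _ _ _ ih ha

lemma Filt.prod {A ι : Type*} [CommRing A] [Algebra ℚ A] (F : Filt A) (s : Finset ι) (a : ι → A) (d : ι → ℕ)
    (h : ∀ i ∈ s, a i ∈ F.V (d i)) : ∏ i ∈ s, a i ∈ F.V (∑ i ∈ s, d i) := by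
  classical
  induction s using Finset.induction_on with
  | empty => simpa using F.one
  | insert i s hi ih =>
    rw [Finset.prod_insert hi, Finset.sum_insert hi]
    exact F.mul _ _ _ _ (h i (by simp)) (ih fun j hj => h j (by simp [hj]))

lemma Filt.algebraMap_mem {A : Type*} [CommRing A] [Algebra ℚ A] (F : Filt A) (c : ℚ) (d : ℕ) : algebraMap ℚ A c ∈ F.V d := by
  rw [Algebra.algebraMap_eq_smul_one]
  exact (F.V d).smul_mem c (F.mono (Nat.zero_le d) F.one)

lemma Filt.aeval {A : Type*} [CommRing A] [Algebra ℚ A] (F : Filt A) {m : ℕ} (g : Fin m → A) (hg : ∀ i, g i ∈ F.V 1)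
    (f : MvPolynomial (Fin m) ℚ) (d : ℕ) (hf : f.totalDegree ≤ d) : MvPolynomial.aeval g f ∈ F.V d := by
  rw [aeval_def, eval₂_eq']
  refine Submodule.sum_mem _ fun e he => ?_
  rw [← Algebra.smul_def]
  refine Submodule.smul_mem _ _ ?_
  have h1 := F.prod Finset.univ (fun i => g i ^ e i) (fun i => e i * 1) (fun i _ => F.pow (hg i) (e i))
  refine F.mono ?_ h1
  have := le_totalDegree he
  rw [Finsupp.sum_fintype _ _ (by simp)] at this
  simpa using this.trans hf

/-- total degree filtration -/
noncomputable def Filt.deg (σ : Type*) : Filt (MvPolynomial σ ℚ) where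
  V := fun d => restrictTotalDegree σ ℚ d
  one := by simp [mem_restrictTotalDegree]
  mul := by
    intro d e a b ha hb
    rw [mem_restrictTotalDegree] at *
    exact (totalDegree_mul a b).trans (by omega)
  mono := by
    intro d e h a ha
    rw [mem_restrictTotalDegree] at *
    omega

lemma Filt.mem_deg {σ : Type*} (d : ℕ) (a : MvPolynomial σ ℚ) : a ∈ (Filt.deg σ).V d ↔ a.totalDegree ≤ d := by
  simp [Filt.deg, mem_restrictTotalDegree]

/-- trivial filtration -/
def Filt.triv (A : Type*) [CommRing A] [Algebra ℚ A] : Filt A where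
  V := fun _ => ⊤
  one := trivial
  mul := fun _ _ _ _ _ _ => trivial
  mono := fun _ _ _ => le_rfl

/-- coefficientwise filtration, variable of weight zero -/
def Filt.poly0 {A : Type*} [CommRing A] [Algebra ℚ A] (F : Filt A) : Filt (Polynomial A) where
  V := fun d => 
    { carrier := {P | ∀ i, P.coeff i ∈ F.V d}
      add_mem' := fun {a b} ha hb i => by rw [Polynomial.coeff_add]; exact Submodule.add_mem _ (ha i) (hb i)
      zero_mem' := fun i => by simp
      smul_mem' := fun c a ha i => by rw [Polynomial.coeff_smul]; exact Submodule.smul_mem _ c (ha i) }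
  one := fun i => by
    rw [Polynomial.coeff_one]; split_ifs
    · exact F.one
    · simp
  mul := fun d e a b ha hb i => by
    rw [Polynomial.coeff_mul]
    exact Submodule.sum_mem _ fun x _ => F.mul _ _ _ _ (ha _) (hb _)
  mono := fun d e h a ha i => F.mono h (ha i)

/-- coefficientwise filtration, variable of weight one -/
def Filt.poly1 {A : Type*} [CommRing A] [Algebra ℚ A] (F : Filt A) : Filt (Polynomial A) where
  V := fun d => 
    { carrier := {P | ∀ i, (i ≤ d → P.coeff i ∈ F.V (d - i)) ∧ (d < i → P.coeff i = 0)}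
      add_mem' := fun {a b} ha hb i => ⟨fun h => by rw [Polynomial.coeff_add]; exact Submodule.add_mem _ ((ha i).1 h) ((hb i).1 h),
        fun h => by rw [Polynomial.coeff_add, (ha i).2 h, (hb i).2 h, add_zero]⟩
      zero_mem' := fun i => by simp
      smul_mem' := fun c a ha i => ⟨fun h => by rw [Polynomial.coeff_smul]; exact Submodule.smul_mem _ c ((ha i).1 h),
        fun h => by rw [Polynomial.coeff_smul, (ha i).2 h, smul_zero]⟩ }
  one := fun i => ⟨fun h => by
      obtain rfl : i = 0 := by omega
      simpa using F.one, fun h => by rw [Polynomial.coeff_one, if_neg (by omega)]⟩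
  mul := fun d e a b ha hb i => by
    rw [Polynomial.coeff_mul]
    constructor
    · intro hi
      refine Submodule.sum_mem _ fun x hx => ?_
      rw [Finset.HasAntidiagonal.mem_antidiagonal] at hx
      by_cases h1 : x.1 ≤ d
      · by_cases h2 : x.2 ≤ e
        · have := F.mul _ _ _ _ ((ha _).1 h1) ((hb _).1 h2)
          rwa [show d - x.1 + (e - x.2) = d + e - i by omega] at this
        · rw [(hb _).2 (by omega), mul_zero]; simp
      · rw [(ha _).2 (by omega), zero_mul]; simp
    · intro hi
      refine Finset.sum_eq_zero fun x hx => ?_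
      rw [Finset.HasAntidiagonal.mem_antidiagonal] at hx
      by_cases h1 : x.1 ≤ d
      · rw [(hb _).2 (by omega), mul_zero]
      · rw [(ha _).2 (by omega), zero_mul]
  mono := fun d e h a ha i => ⟨fun hi => by
      by_cases h1 : i ≤ d
      · exact F.mono (by omega) ((ha i).1 h1)
      · rw [(ha i).2 (by omega)]; simp, fun hi => (ha i).2 (by omega)⟩

lemma Filt.mem_poly0 {A : Type*} [CommRing A] [Algebra ℚ A] (F : Filt A) (d : ℕ) (P : Polynomial A) :
    P ∈ F.poly0.V d ↔ ∀ i, P.coeff i ∈ F.V d := Iff.rfl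

lemma Filt.mem_poly1 {A : Type*} [CommRing A] [Algebra ℚ A] (F : Filt A) (d : ℕ) (P : Polynomial A) :
    P ∈ F.poly1.V d ↔ ∀ i, (i ≤ d → P.coeff i ∈ F.V (d - i)) ∧ (d < i → P.coeff i = 0) := Iff.rfl

lemma Filt.C_poly0 {A : Type*} [CommRing A] [Algebra ℚ A] (F : Filt A) {d : ℕ} {a : A} (ha : a ∈ F.V d) : Polynomial.C a ∈ F.poly0.V d := by
  rw [Filt.mem_poly0]; intro i; rw [Polynomial.coeff_C]; split_ifs
  · exact ha
  · simp

lemma Filt.C_poly1 {A : Type*} [CommRing A] [Algebra ℚ A] (F : Filt A) {d : ℕ} {a : A} (ha : a ∈ F.V d) : Polynomial.C a ∈ F.poly1.V d := by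
  rw [Filt.mem_poly1]; intro i; rw [Polynomial.coeff_C]; split_ifs with h
  · subst h; exact ⟨fun _ => by simpa using ha, fun h => by omega⟩
  · simp

lemma Filt.X_poly0 {A : Type*} [CommRing A] [Algebra ℚ A] (F : Filt A) : Polynomial.X ∈ F.poly0.V 0 := by
  rw [Filt.mem_poly0]; intro i; rw [Polynomial.coeff_X]; split_ifs
  · exact F.one
  · simp

lemma Filt.X_poly1 {A : Type*} [CommRing A] [Algebra ℚ A] (F : Filt A) : Polynomial.X ∈ F.poly1.V 1 := by
  rw [Filt.mem_poly1]; intro i; rw [Polynomial.coeff_X]; split_ifs with h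
  · subst h; exact ⟨fun _ => by simpa using F.one, fun h => by omega⟩
  · simp

/-- leading coefficient of a substitution -/
lemma coeff_top {A : Type*} [CommRing A] [Algebra ℚ A] {m : ℕ} (g : Fin m → Polynomial A) (hg : ∀ i, (g i).natDegree ≤ 1)
    (f : MvPolynomial (Fin m) ℚ) (d : ℕ) (hf : f.IsHomogeneous d) :
    (aeval g f).coeff d = aeval (fun i => (g i).coeff 1) f := by
  rw [aeval_def, aeval_def, eval₂_eq', eval₂_eq', Polynomial.finsetSum_coeff]
  refine Finset.sum_congr rfl fun e he => ?_
  rw [show (algebraMap ℚ (Polynomial A)) (coeff e f) = Polynomial.C (algebraMap ℚ A (coeff e f)) from rfl, Polynomial.coeff_C_mul]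
  congr 1
  have hd : ∑ i, e i = d := by
    have := hf (mem_support_iff.1 he)
    rw [← this, Finsupp.weight_apply, Finsupp.sum_fintype _ _ (by simp)]; simp
  have key : ∀ s : Finset (Fin m), (∏ i ∈ s, g i ^ e i).natDegree ≤ ∑ i ∈ s, e i ∧
      (∏ i ∈ s, g i ^ e i).coeff (∑ i ∈ s, e i) = ∏ i ∈ s, (g i).coeff 1 ^ e i := by
    intro s
    induction s using Finset.induction_on with
    | empty => simp
    | insert i s hi ih =>
      rw [Finset.prod_insert hi, Finset.sum_insert hi, Finset.prod_insert hi]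
      have h1 : (g i ^ e i).natDegree ≤ e i := (Polynomial.natDegree_pow_le_of_le (e i) (hg i)).trans (by simp)
      refine ⟨Polynomial.natDegree_mul_le_of_le h1 ih.1, ?_⟩
      rw [Polynomial.coeff_mul_add_eq_of_natDegree_le h1 ih.1, ih.2]
      congr 1
      have := Polynomial.coeff_pow_of_natDegree_le (m := e i) (hg i)
      simpa using this
  have := (key Finset.univ).2
  rwa [hd] at this

lemma chain {A : Type*} [CommRing A] [Algebra ℚ A] (D : Derivation ℚ A A) {m : ℕ} (g : Fin m → A) (f : MvPolynomial (Fin m) ℚ) :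
    D (aeval g f) = ∑ i, aeval g (pderiv i f) * D (g i) := by
  induction f using MvPolynomial.induction_on with
  | C a => simp
  | add p q hp hq => simp [hp, hq, add_mul, Finset.sum_add_distrib]
  | mul_X p i hp =>
    simp only [map_mul, aeval_X, Derivation.leibniz, hp, smul_eq_mul, map_add, pderiv_X, add_mul, Finset.sum_add_distrib, Finset.mul_sum]
    congr 1
    · rw [Finset.sum_eq_single i]
      · simp
      · intro b _ hb; simp [hb]
      · simp
    · exact Finset.sum_congr rfl fun j _ => by ring

/-- avoiding a hypersurface by a small integer point -/
lemma avoid {m : ℕ} (P : MvPolynomial (Fin m) ℚ) (hP : P ≠ 0) (D : ℕ) (hD : P.totalDegree ≤ D) :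
    ∃ w : Fin m → ℤ, (∀ i, |w i| ≤ D) ∧ eval (qp w) P ≠ 0 := by
  by_contra! hcon
  apply hP
  refine eq_zero_of_eval_zero_at_prod_finset P (fun _ => (Finset.range (D+1)).image (fun t : ℕ => (t:ℚ))) ?_ ?_
  · intro i
    rw [Finset.card_image_of_injective _ Nat.cast_injective, Finset.card_range]
    have := degreeOf_le_totalDegree P i
    omega
  · intro x hx
    choose t ht htx using fun i => Finset.mem_image.1 (hx i)
    have h := hcon (fun i => (t i : ℤ)) (fun i => by
      have := Finset.mem_range.1 (ht i)
      rw [abs_of_nonneg (by positivity)]; exact_mod_cast (by omega))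
    rw [← h]; congr 1; apply congrArg; ext i; simp [qp, htx]

/-- the shear homomorphism -/
noncomputable def shear {m : ℕ} (u : Fin m → ℚ) : Polynomial (MvPolynomial (Fin m) ℚ) →+* Polynomial (MvPolynomial (Fin m) ℚ) :=
  Polynomial.eval₂RingHom (aeval (fun i => Polynomial.C (X i) + Polynomial.C (C (u i)) * Polynomial.X) :
    MvPolynomial (Fin m) ℚ →ₐ[ℚ] Polynomial (MvPolynomial (Fin m) ℚ)).toRingHom Polynomial.X

lemma shear_comp {m : ℕ} (u v : Fin m → ℚ) (h : ∀ i, u i + v i = 0) : (shear u).comp (shear v) = RingHom.id _ := by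
  apply Polynomial.ringHom_ext
  · intro a
    simp only [shear, RingHom.comp_apply, Polynomial.coe_eval₂RingHom, Polynomial.eval₂_C, RingHom.id_apply]
    induction a using MvPolynomial.induction_on with
    | C a => simp
    | add p q hp hq => rw [map_add, Polynomial.eval₂_add, hp, hq, map_add]
    | mul_X p i hp =>
      rw [map_mul, Polynomial.eval₂_mul, hp]
      simp
      left
      rw [add_assoc, ← add_mul, ← map_add, ← map_add, h i]; simp
  · simp [shear]

lemma shear_irr {m : ℕ} (u : Fin m → ℚ) (f : MvPolynomial (Fin m) ℚ) (hf : Irreducible f) : 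
    Irreducible (aeval (fun i => Polynomial.C (X i) + Polynomial.C (C (u i)) * Polynomial.X) f : Polynomial (MvPolynomial (Fin m) ℚ)) := by
  have h1 : Irreducible (Polynomial.C f) := (Polynomial.prime_C_iff.2 hf.prime).irreducible
  let E : Polynomial (MvPolynomial (Fin m) ℚ) ≃+* Polynomial (MvPolynomial (Fin m) ℚ) :=
    RingEquiv.ofRingHom (shear u) (shear (fun i => - u i)) (shear_comp _ _ (by simp)) (shear_comp _ _ (by simp))
  have h2 := (MulEquiv.irreducible_iff E.toMulEquiv).2 h1
  have h3 : E (Polynomial.C f) = (aeval (fun i => Polynomial.C (X i) + Polynomial.C (C (u i)) * Polynomial.X) f : Polynomial (MvPolynomial (Fin m) ℚ)) := by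
    change shear u (Polynomial.C f) = _
    simp [shear]
  rw [← h3]; exact h2

end DG


namespace DG
open MvPolynomial

/-- restriction to a line -/
noncomputable def lineP {m : ℕ} (u1 u2 : Fin m → ℚ) (f : MvPolynomial (Fin m) ℚ) : Polynomial ℚ :=
  aeval (fun i => Polynomial.C (u2 i) + Polynomial.C (u1 i) * Polynomial.X) f

lemma natDeg_lin {A : Type*} [CommRing A] (a b : A) : (Polynomial.C a + Polynomial.C b * Polynomial.X).natDegree ≤ 1 := by
  rw [add_comm]; exact Polynomial.natDegree_linear_le

lemma coeff_lin {A : Type*} [CommRing A] (a b : A) : (Polynomial.C a + Polynomial.C b * Polynomial.X).coeff 1 = b := by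
  simp [Polynomial.coeff_C]

lemma natDegree_aeval_le {A : Type*} [CommRing A] [Algebra ℚ A] {m : ℕ} (a b : Fin m → A) (f : MvPolynomial (Fin m) ℚ) (d : ℕ) (hf : f.totalDegree ≤ d) :
    (aeval (fun i => Polynomial.C (a i) + Polynomial.C (b i) * Polynomial.X) f).natDegree ≤ d := by
  have h := (Filt.triv A).poly1.aeval (fun i => Polynomial.C (a i) + Polynomial.C (b i) * Polynomial.X) (fun i => by
    refine Submodule.add_mem _ (Filt.C_poly1 _ trivial) ?_
    exact Filt.mul _ 0 1 _ _ (Filt.C_poly1 _ trivial) (Filt.X_poly1 _)) f d hf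
  rw [Filt.mem_poly1] at h
  exact Polynomial.natDegree_le_iff_coeff_eq_zero.2 fun i hi => (h i).2 hi

lemma monic_line {A : Type*} [CommRing A] [Nontrivial A] [Algebra ℚ A] {m : ℕ} (a : Fin m → A) (u : Fin m → ℚ) (f : MvPolynomial (Fin m) ℚ)
    (hf : f.IsHomogeneous 4) (hu : eval u f = 1) : 
    (aeval (fun i => Polynomial.C (a i) + Polynomial.C (algebraMap ℚ A (u i)) * Polynomial.X) f).Monic ∧ 
    (aeval (fun i => Polynomial.C (a i) + Polynomial.C (algebraMap ℚ A (u i)) * Polynomial.X) f).natDegree = 4 := by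
  have h1 := natDegree_aeval_le a (fun i => algebraMap ℚ A (u i)) f 4 hf.totalDegree_le
  have h2 := coeff_top (fun i => Polynomial.C (a i) + Polynomial.C (algebraMap ℚ A (u i)) * Polynomial.X) (fun i => natDeg_lin _ _) f 4 hf
  simp only [coeff_lin] at h2
  have h3 : aeval (fun i => algebraMap ℚ A (u i)) f = 1 := by
    have := aeval_algebraMap_apply A u f
    rw [← map_one (algebraMap ℚ A), ← hu, ← aeval_eq_eval]
    exact this
  rw [h3] at h2
  have h4 : (aeval (fun i => Polynomial.C (a i) + Polynomial.C (algebraMap ℚ A (u i)) * Polynomial.X) f).natDegree = 4 := by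
    refine le_antisymm h1 (Polynomial.le_natDegree_of_ne_zero ?_)
    rw [h2]; exact one_ne_zero
  refine ⟨?_, h4⟩
  rw [Polynomial.Monic, Polynomial.leadingCoeff, h4, h2]

lemma sep {m : ℕ} (f : MvPolynomial (Fin m) ℚ) (hf : f.IsHomogeneous 4) (hirr : Irreducible f) (u1 : Fin m → ℚ) (hu : eval u1 f = 1) :
    ∃ r : MvPolynomial (Fin m) ℚ, r ≠ 0 ∧ r.totalDegree ≤ 64 ∧ ∀ u2 : Fin m → ℚ, eval u2 r ≠ 0 → 
      IsCoprime (lineP u1 u2 f) (Polynomial.derivative (lineP u1 u2 f)) := by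
  let P : Polynomial (MvPolynomial (Fin m) ℚ) := aeval (fun i => Polynomial.C (X i) + Polynomial.C (C (u1 i)) * Polynomial.X) f
  have hPirr : Irreducible P := shear_irr u1 f hirr
  obtain ⟨hmon, hdeg⟩ : P.Monic ∧ P.natDegree = 4 := monic_line (A := MvPolynomial (Fin m) ℚ) (fun i => X i) u1 f hf hu
  set Q := Polynomial.derivative P with hQ
  have hQd : Q.natDegree ≤ 3 := (Polynomial.natDegree_derivative_le P).trans (by omega)
  have hQ0 : Q ≠ 0 := by
    intro h
    have := Polynomial.coeff_derivative P 3
    rw [← hQ, h, show 3 + 1 = P.natDegree by omega, hmon.coeff_natDegree] at this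
    simp at this
    norm_num at this
  have hPQ : ¬ P ∣ Q := by
    intro h
    have := Polynomial.natDegree_le_of_dvd h hQ0
    omega
  have hPc : ∀ i, (P.coeff i).totalDegree ≤ 4 := by
    have h := (Filt.deg (Fin m)).poly0.aeval (fun i => Polynomial.C (X i) + Polynomial.C (C (u1 i)) * Polynomial.X) (fun i => by
      refine Submodule.add_mem _ (Filt.C_poly0 _ ?_) ?_
      · rw [Filt.mem_deg]; exact (totalDegree_X i).le
      · refine Filt.mul _ 1 0 _ _ (Filt.C_poly0 _ ?_) (Filt.X_poly0 _)
        rw [Filt.mem_deg]; simp) f 4 hf.totalDegree_le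
    rw [Filt.mem_poly0] at h
    exact fun i => (Filt.mem_deg _ _).1 (h i)
  refine ⟨Polynomial.resultant P Q, ?_, ?_, ?_⟩
  · have hc := isCoprime_of_irreducible (K := FractionRing (MvPolynomial (Fin m) ℚ)) P Q hPirr (by omega) hPQ
    have := Polynomial.resultant_ne_zero _ _ hc
    intro h
    apply this
    have hinj := IsFractionRing.injective (MvPolynomial (Fin m) ℚ) (FractionRing (MvPolynomial (Fin m) ℚ))
    rw [Polynomial.natDegree_map_eq_of_injective hinj, Polynomial.natDegree_map_eq_of_injective hinj,
      Polynomial.resultant_map_map, h, map_zero]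
  · refine (totalDegree_resultant_le P Q 4 4 hdeg.le (by omega) hPc ?_).trans (by norm_num)
    intro i
    rw [hQ, Polynomial.coeff_derivative]
    refine (totalDegree_mul _ _).trans ?_
    have h1 : (((i:MvPolynomial (Fin m) ℚ)) + 1).totalDegree = 0 := by
      rw [show ((i:MvPolynomial (Fin m) ℚ)) + 1 = C ((i:ℚ) + 1) by simp]
      exact totalDegree_C _
    rw [h1]; exact hPc _
  · intro u2 hu2
    have hmap : P.map (eval u2) = lineP u1 u2 f := by
      have : (Polynomial.mapAlgHom (aeval u2 : MvPolynomial (Fin m) ℚ →ₐ[ℚ] ℚ)) P = lineP u1 u2 f := by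
        simp only [P, lineP]
        rw [← AlgHom.comp_apply, comp_aeval]
        congr 2
        ext i : 1
        simp
      rw [← this]
      rfl
    obtain ⟨a, b, -, -, hab⟩ := Polynomial.exists_mul_add_mul_eq_C_resultant P Q le_rfl le_rfl (Or.inl (by omega))
    have h := congrArg (Polynomial.map (eval u2)) hab
    rw [Polynomial.map_add, Polynomial.map_mul, Polynomial.map_mul, Polynomial.map_C, hQ, ← Polynomial.derivative_map, hmap] at h
    rw [← hQ] at h
    set c := eval u2 (Polynomial.resultant P Q) with hc
    refine ⟨Polynomial.C c⁻¹ * a.map (eval u2), Polynomial.C c⁻¹ * b.map (eval u2), ?_⟩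
    have : Polynomial.C c⁻¹ * Polynomial.C c = 1 := by rw [← Polynomial.C_mul, inv_mul_cancel₀ hu2, Polynomial.C_1]
    rw [← this, ← h]; ring

end DG


namespace DG
open MvPolynomial

lemma hom_aeval {A B : Type*} [CommRing A] [CommRing B] [Algebra ℚ A] [Algebra ℚ B] (φ : A →+* B) {m : ℕ} (g : Fin m → A) (f : MvPolynomial (Fin m) ℚ) :
    φ (aeval g f) = aeval (fun i => φ (g i)) f := by
  rw [aeval_def, aeval_def, eval₂_eq', eval₂_eq', map_sum]
  refine Finset.sum_congr rfl fun e _ => ?_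
  rw [map_mul, map_prod]
  congr 1
  · exact RingHom.congr_fun (Subsingleton.elim (φ.comp (algebraMap ℚ A)) (algebraMap ℚ B)) _
  · simp

/-- the pencil of planes, affine equation -/
noncomputable def Phw {m : ℕ} (u1 u2 : Fin m → ℚ) (f : MvPolynomial (Fin m) ℚ) (w : Fin m → ℚ) : Polynomial (Polynomial ℚ) :=
  aeval (fun i => Polynomial.C (Polynomial.C (u2 i) + Polynomial.C (u1 i) * Polynomial.X) + Polynomial.C (Polynomial.C (w i)) * Polynomial.X) f

/-- factorizations with given constant terms -/
structure Fact {m : ℕ} (u1 u2 : Fin m → ℚ) (f : MvPolynomial (Fin m) ℚ) (w : Fin m → ℚ) (a0 b0 : Polynomial ℚ)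
    (A B : Polynomial (Polynomial ℚ)) : Prop where
  mul : A * B = Phw u1 u2 f w
  A0 : A.coeff 0 = a0
  B0 : B.coeff 0 = b0
  dA : ∀ j, 1 ≤ j → (A.coeff j).natDegree < a0.natDegree
  dB : ∀ j, 1 ≤ j → (B.coeff j).natDegree < b0.natDegree
  nA : A.natDegree ≤ 4
  nB : B.natDegree ≤ 4

lemma Filt.modByMonic {m : ℕ} (q : Polynomial ℚ) (hq : q.Monic) (P : Polynomial (MvPolynomial (Fin m) ℚ)) (d : ℕ)
    (hP : P ∈ (Filt.deg (Fin m)).poly0.V d) : P %ₘ (q.map C) ∈ (Filt.deg (Fin m)).poly0.V d := by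
  have hm : (q.map (C : ℚ →+* MvPolynomial (Fin m) ℚ)).Monic := hq.map _
  have h1 : P %ₘ (q.map C) = ∑ i ∈ Finset.range (P.natDegree + 1), Polynomial.C (P.coeff i) * ((Polynomial.X ^ i %ₘ q).map C) := by
    conv_lhs => rw [P.as_sum_range_C_mul_X_pow]
    rw [← Polynomial.modByMonicHom_apply, map_sum]
    refine Finset.sum_congr rfl fun i _ => ?_
    rw [← Polynomial.smul_eq_C_mul, map_smul, Polynomial.modByMonicHom_apply, Polynomial.smul_eq_C_mul, Polynomial.map_modByMonic _ hq]
    simp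
  rw [h1]
  refine Submodule.sum_mem _ fun i _ => ?_
  refine Filt.mul _ d 0 _ _ (Filt.C_poly0 _ (hP i)) ?_
  rw [Filt.mem_poly0]
  intro j
  rw [Polynomial.coeff_map, Filt.mem_deg, totalDegree_C]

lemma hensel {m : ℕ} (u1 u2 : Fin m → ℚ) (f : MvPolynomial (Fin m) ℚ) (hf : f.totalDegree ≤ 4) (a0 b0 : Polynomial ℚ)
    (ha : a0.Monic) (hb : b0.Monic) (hab : IsCoprime a0 b0) (j : ℕ) :
    ∃ α β : Polynomial (MvPolynomial (Fin m) ℚ), α ∈ (Filt.deg (Fin m)).poly0.V (4 * j) ∧ β ∈ (Filt.deg (Fin m)).poly0.V (4 * j) ∧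
      ∀ w A B, Fact u1 u2 f w a0 b0 A B → A.coeff j = α.map (eval w) ∧ B.coeff j = β.map (eval w) := by
  have hmc : ∀ (q : Polynomial ℚ) (w : Fin m → ℚ), (q.map (C : ℚ →+* MvPolynomial (Fin m) ℚ)).map (eval w) = q := by
    intro q w
    rw [Polynomial.map_map]
    have : (eval w).comp (C : ℚ →+* MvPolynomial (Fin m) ℚ) = RingHom.id ℚ := by ext; simp
    rw [this, Polynomial.map_id]
  have hcf : ∀ (q : Polynomial ℚ) (d : ℕ), q.map (C : ℚ →+* MvPolynomial (Fin m) ℚ) ∈ (Filt.deg (Fin m)).poly0.V d := by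
    intro q d
    rw [Filt.mem_poly0]; intro i; rw [Polynomial.coeff_map, Filt.mem_deg, totalDegree_C]; omega
  induction j using Nat.strong_induction_on with
  | _ j ih =>
  rcases j with _ | j
  · exact ⟨a0.map C, b0.map C, hcf _ _, hcf _ _, fun w A B h => ⟨by rw [hmc, h.A0], by rw [hmc, h.B0]⟩⟩
  choose! α β hα hβ h using ih
  obtain ⟨Y0, X0, hXY⟩ := hab
  let Φ : Polynomial (Polynomial (MvPolynomial (Fin m) ℚ)) := aeval (fun i => Polynomial.C (Polynomial.C (C (u2 i)) + Polynomial.C (C (u1 i)) * Polynomial.X) + Polynomial.C (Polynomial.C (X i)) * Polynomial.X) f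
  have hΦ : Φ ∈ (Filt.deg (Fin m)).poly0.poly0.V 4 := by
    refine Filt.aeval _ _ (fun i => ?_) f 4 hf
    refine Submodule.add_mem _ (Filt.C_poly0 _ (Submodule.add_mem _ (Filt.C_poly0 _ ?_) (Filt.mul _ 1 0 _ _ (Filt.C_poly0 _ ?_) (Filt.X_poly0 _)))) 
      (Filt.mul _ 1 0 _ _ (Filt.C_poly0 _ (Filt.C_poly0 _ ?_)) (Filt.X_poly0 _))
    · rw [Filt.mem_deg]; simp
    · rw [Filt.mem_deg]; simp
    · rw [Filt.mem_deg]; simp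
  have hΦm : ∀ w, Φ.map (Polynomial.mapRingHom (eval w)) = Phw u1 u2 f w := by
    intro w
    rw [← Polynomial.coe_mapRingHom]
    refine (hom_aeval (A := Polynomial (Polynomial (MvPolynomial (Fin m) ℚ))) (B := Polynomial (Polynomial ℚ)) (Polynomial.mapRingHom (Polynomial.mapRingHom (eval w))) _ f).trans ?_
    rw [Phw]
    congr 2
    ext i : 1
    simp
  let rhs : Polynomial (MvPolynomial (Fin m) ℚ) := Φ.coeff (j+1) - ∑ k ∈ Finset.range j, α (k+1) * β (j - k)
  have hrhs : rhs ∈ (Filt.deg (Fin m)).poly0.V (4 * (j+1)) := by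
    refine Submodule.sub_mem _ (Filt.mono _ (by omega) (hΦ (j+1))) (Submodule.sum_mem _ fun k hk => ?_)
    have hk := Finset.mem_range.1 hk
    have := Filt.mul _ _ _ _ _ (hα (k+1) (by omega)) (hβ (j-k) (by omega))
    rwa [show 4 * (k+1) + 4 * (j-k) = 4 * (j+1) by omega] at this
  refine ⟨(X0.map C * rhs) %ₘ (a0.map C), (Y0.map C * rhs) %ₘ (b0.map C), ?_, ?_, ?_⟩
  · refine Filt.modByMonic a0 ha _ _ ?_
    have := Filt.mul _ _ _ _ _ (hcf X0 0) hrhs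
    rwa [zero_add] at this
  · refine Filt.modByMonic b0 hb _ _ ?_
    have := Filt.mul _ _ _ _ _ (hcf Y0 0) hrhs
    rwa [zero_add] at this
  · intro w A B hF
    have hr : a0 * B.coeff (j+1) + b0 * A.coeff (j+1) = rhs.map (eval w) := by
      have h1 := congrArg (fun P => Polynomial.coeff P (j+1)) hF.mul
      simp only [← hΦm w] at h1
      rw [Polynomial.coeff_mul, Finset.Nat.sum_antidiagonal_eq_sum_range_succ (fun a b => A.coeff a * B.coeff b), Finset.sum_range_succ,
        Finset.sum_range_succ', Polynomial.coeff_map, hF.A0] at h1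
      simp only [Nat.sub_zero, Nat.sub_self, hF.B0, Nat.reduceSubDiff, Polynomial.coe_mapRingHom] at h1
      simp only [rhs, Polynomial.map_sub, Polynomial.map_sum, Polynomial.map_mul]
      rw [← h1]
      have h2 : ∑ k ∈ Finset.range j, A.coeff (k+1) * B.coeff (j-k) = ∑ k ∈ Finset.range j, (α (k+1)).map (eval w) * (β (j-k)).map (eval w) := by
        refine Finset.sum_congr rfl fun k hk => ?_
        have hk := Finset.mem_range.1 hk
        rw [(h (k+1) (by omega) w A B hF).1, (h (j-k) (by omega) w A B hF).2]
      rw [← h2]; ring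
    rw [Polynomial.map_modByMonic _ (ha.map _), Polynomial.map_modByMonic _ (hb.map _), Polynomial.map_mul, Polynomial.map_mul, hmc, hmc, hmc, hmc, ← hr]
    constructor
    · symm
      refine (Polynomial.div_modByMonic_unique (X0 * B.coeff (j+1) - Y0 * A.coeff (j+1)) _ ha ⟨?_, ?_⟩).2
      · linear_combination - A.coeff (j+1) * hXY
      · exact Polynomial.degree_lt_degree (hF.dA _ (by omega))
    · symm
      refine (Polynomial.div_modByMonic_unique (Y0 * A.coeff (j+1) - X0 * B.coeff (j+1)) _ hb ⟨?_, ?_⟩).2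
      · linear_combination - B.coeff (j+1) * hXY
      · exact Polynomial.degree_lt_degree (hF.dB _ (by omega))

/-- bidegree filtration on polynomials in two variables -/
noncomputable def F2 : Filt (Polynomial (Polynomial ℚ)) := (Filt.triv ℚ).poly1.poly1

lemma F2_natDegree {P : Polynomial (Polynomial ℚ)} {d : ℕ} (h : P ∈ F2.V d) : P.natDegree ≤ d :=
  Polynomial.natDegree_le_iff_coeff_eq_zero.2 fun i hi => (h i).2 hi

lemma F2_coeff {P : Polynomial (Polynomial ℚ)} {d : ℕ} (h : P ∈ F2.V d) (j : ℕ) : (P.coeff j).natDegree ≤ d - j := by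
  by_cases hj : j ≤ d
  · have := (h j).1 hj
    rw [Filt.mem_poly1] at this
    exact Polynomial.natDegree_le_iff_coeff_eq_zero.2 fun i hi => (this i).2 hi
  · rw [(h j).2 (by omega)]; simp

lemma F2_aeval {P : Polynomial (Polynomial ℚ)} (h : P ∈ F2.V 1) (a : Polynomial ℚ) : Polynomial.aeval P a ∈ F2.V a.natDegree := by
  rw [Polynomial.aeval_eq_sum_range]
  refine Submodule.sum_mem _ fun i hi => Submodule.smul_mem _ _ ?_
  have := F2.pow h i
  have hi := Finset.mem_range.1 hi
  exact F2.mono (by omega) this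

lemma fact_shear {m : ℕ} (u1 u2 : Fin m → ℚ) (f : MvPolynomial (Fin m) ℚ) (a0 b0 : Polynomial ℚ)
    (hab : a0 * b0 = lineP u1 u2 f) (hda : 1 ≤ a0.natDegree) (hdb : 1 ≤ b0.natDegree) (hd : a0.natDegree + b0.natDegree = 4) (t : ℚ) :
    Fact u1 u2 f (fun i => t * u1 i) a0 b0 (Polynomial.aeval (Polynomial.C Polynomial.X + Polynomial.C (Polynomial.C t) * Polynomial.X) a0)
      (Polynomial.aeval (Polynomial.C Polynomial.X + Polynomial.C (Polynomial.C t) * Polynomial.X) b0) := by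
  set θ : Polynomial (Polynomial ℚ) := Polynomial.C Polynomial.X + Polynomial.C (Polynomial.C t) * Polynomial.X with hθ
  have hmem : θ ∈ F2.V 1 := by
    refine Submodule.add_mem _ (Filt.C_poly1 _ (Filt.X_poly1 _)) (Filt.mul _ 0 1 _ _ (Filt.C_poly1 _ (Filt.C_poly1 _ trivial)) (Filt.X_poly1 _))
  have h0 : ∀ a : Polynomial ℚ, (Polynomial.aeval θ a).coeff 0 = a := by
    intro a
    rw [Polynomial.coeff_zero_eq_eval_zero]
    have : ((Polynomial.aeval (0 : Polynomial ℚ) : Polynomial (Polynomial ℚ) →ₐ[Polynomial ℚ] Polynomial ℚ).restrictScalars ℚ) (Polynomial.aeval θ a) = a := by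
      rw [← Polynomial.aeval_algHom_apply]
      simp [hθ]
    rw [← Polynomial.coe_aeval_eq_eval]
    exact this
  have hA := F2_aeval hmem a0
  have hB := F2_aeval hmem b0
  refine ⟨?_, h0 _, h0 _, ?_, ?_, (F2_natDegree hA).trans (by omega), (F2_natDegree hB).trans (by omega)⟩
  · rw [← map_mul, hab, lineP, Phw, ← AlgHom.comp_apply, comp_aeval]
    congr 2
    ext i : 1
    simp [hθ]
    ring
  · intro j hj
    have := F2_coeff hA j
    omega
  · intro j hj
    have := F2_coeff hB j
    omega

end DG


namespace DG
open MvPolynomial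

lemma shift_irr {m : ℕ} (f : MvPolynomial (Fin m) ℚ) (hirr : Irreducible f) (u : Fin m → ℚ) (A B : MvPolynomial (Fin m) ℚ)
    (h : aeval (fun i => C (u i) + X i) f = A * B) : (∃ c, ∀ w, eval w A = c) ∨ (∃ c, ∀ w, eval w B = c) := by
  have h1 : f = aeval (fun i => X i - C (u i)) A * aeval (fun i => X i - C (u i)) B := by
    rw [← map_mul, ← h, ← AlgHom.comp_apply, comp_aeval]
    simp
  have key : ∀ A : MvPolynomial (Fin m) ℚ, IsUnit (aeval (fun i => X i - C (u i)) A : MvPolynomial (Fin m) ℚ) → ∃ c, ∀ w, eval w A = c := by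
    intro A hA
    obtain ⟨c, -, hc⟩ := MvPolynomial.isUnit_iff_eq_C_of_isReduced.1 hA
    refine ⟨c, fun w => ?_⟩
    have := congrArg (eval (fun i => w i + u i)) hc
    rw [hom_aeval] at this
    simpa [aeval_eq_eval] using this
  rcases hirr.isUnit_or_isUnit h1 with h2 | h2
  · exact Or.inl (key _ h2)
  · exact Or.inr (key _ h2)

lemma eval_sum5 (A : Polynomial (Polynomial ℚ)) (h : A.natDegree ≤ 4) : (A.eval 1).eval 0 = ∑ j ∈ Finset.range 5, (A.coeff j).eval 0 := by
  rw [Polynomial.eval_eq_sum_range' (show A.natDegree < 5 by omega)]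
  simp [Polynomial.eval_finsetSum]

lemma obstr {m : ℕ} (u1 u2 : Fin m → ℚ) (f : MvPolynomial (Fin m) ℚ) (hf : f.totalDegree ≤ 4) (hirr : Irreducible f) (a0 b0 : Polynomial ℚ)
    (ha : a0.Monic) (hb : b0.Monic) (hc : IsCoprime a0 b0)
    (hab : a0 * b0 = lineP u1 u2 f) (hda : 1 ≤ a0.natDegree) (hdb : 1 ≤ b0.natDegree) (hd : a0.natDegree + b0.natDegree = 4) :
    ∃ G : MvPolynomial (Fin m) ℚ, G ≠ 0 ∧ G.totalDegree ≤ 32 ∧ ∀ w A B, Fact u1 u2 f w a0 b0 A B → eval w G = 0 := by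
  choose α β hα hβ h using hensel u1 u2 f hf a0 b0 ha hb hc
  let Ah : MvPolynomial (Fin m) ℚ := ∑ j ∈ Finset.range 5, (α j).coeff 0
  let Bh : MvPolynomial (Fin m) ℚ := ∑ j ∈ Finset.range 5, (β j).coeff 0
  have hAh : ∀ w A B, Fact u1 u2 f w a0 b0 A B → (A.eval 1).eval 0 = eval w Ah := by
    intro w A B hF
    rw [eval_sum5 A hF.nA, map_sum]
    refine Finset.sum_congr rfl fun j _ => ?_
    rw [(h j w A B hF).1, ← Polynomial.coeff_zero_eq_eval_zero, Polynomial.coeff_map]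
  have hBh : ∀ w A B, Fact u1 u2 f w a0 b0 A B → (B.eval 1).eval 0 = eval w Bh := by
    intro w A B hF
    rw [eval_sum5 B hF.nB, map_sum]
    refine Finset.sum_congr rfl fun j _ => ?_
    rw [(h j w A B hF).2, ← Polynomial.coeff_zero_eq_eval_zero, Polynomial.coeff_map]
  have hcm : ∀ j ∈ Finset.range 5, (α j).coeff 0 ∈ (Filt.deg (Fin m)).V 16 ∧ (β j).coeff 0 ∈ (Filt.deg (Fin m)).V 16 := by
    intro j hj
    have hj := Finset.mem_range.1 hj
    exact ⟨Filt.mono _ (by omega) (hα j 0), Filt.mono _ (by omega) (hβ j 0)⟩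
  refine ⟨aeval (fun i => C (u2 i) + X i) f - Ah * Bh, ?_, ?_, ?_⟩
  · intro h0
    rw [sub_eq_zero] at h0
    have hconst : ∀ a : Polynomial ℚ, 1 ≤ a.natDegree → ¬ ∃ c, ∀ t, Polynomial.eval t a = c := by
      rintro a ha ⟨c, hc⟩
      have : a = Polynomial.C c := Polynomial.funext fun t => by rw [hc, Polynomial.eval_C]
      rw [this, Polynomial.natDegree_C] at ha
      omega
    have he : ∀ (a : Polynomial ℚ) (t : ℚ), ((Polynomial.aeval (Polynomial.C Polynomial.X + Polynomial.C (Polynomial.C t) * Polynomial.X : Polynomial (Polynomial ℚ)) a).eval 1).eval 0 = a.eval t := by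
      intro a t
      induction a using Polynomial.induction_on' with
      | add p q hp hq => simp [hp, hq]
      | monomial n c =>
        rw [Polynomial.aeval_monomial]
        simp
    rcases shift_irr f hirr u2 Ah Bh h0 with ⟨c, h1⟩ | ⟨c, h1⟩
    · exact hconst a0 hda ⟨c, fun t => by rw [← he, hAh _ _ _ (fact_shear u1 u2 f a0 b0 hab hda hdb hd t), h1]⟩
    · exact hconst b0 hdb ⟨c, fun t => by rw [← he, hBh _ _ _ (fact_shear u1 u2 f a0 b0 hab hda hdb hd t), h1]⟩
  · rw [← Filt.mem_deg]
    refine Submodule.sub_mem _ (Filt.mono _ (show 4 ≤ 32 by norm_num) (Filt.aeval _ _ (fun i => ?_) f 4 hf)) ?_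
    · refine Submodule.add_mem _ ?_ ?_ <;> rw [Filt.mem_deg] <;> simp
    · exact Filt.mul _ 16 16 _ _ (Submodule.sum_mem _ fun j hj => (hcm j hj).1) (Submodule.sum_mem _ fun j hj => (hcm j hj).2)
  · intro w A B hF
    rw [map_sub, map_mul, ← hAh w A B hF, ← hBh w A B hF, ← Polynomial.eval_mul, ← Polynomial.eval_mul, hF.mul, hom_aeval, Phw]
    have := hom_aeval ((Polynomial.evalRingHom (0:ℚ)).comp (Polynomial.evalRingHom (1 : Polynomial ℚ)))
       (fun i => Polynomial.C (Polynomial.C (u2 i) + Polynomial.C (u1 i) * Polynomial.X) + Polynomial.C (Polynomial.C (w i)) * Polynomial.X) f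
    rw [sub_eq_zero]
    refine Eq.trans ?_ this.symm
    congr 2
    ext i : 1
    simp

lemma types (p : Polynomial ℚ) (hp : p ≠ 0) (hd : p.natDegree ≤ 4) (hs : p.Separable) :
    ∃ D : Finset (Polynomial ℚ), D.card ≤ 16 ∧ ∀ a : Polynomial ℚ, a.Monic → a ∣ p → a ∈ D := by
  classical
  let K := AlgebraicClosure ℚ
  let rt : Polynomial ℚ → Finset K := fun a => (a.map (algebraMap ℚ K)).roots.toFinset
  have hinj : ∀ a b : Polynomial ℚ, a.Monic → a ∣ p → b.Monic → b ∣ p → rt a = rt b → a = b := by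
    intro a b ha hap hb hbp hab
    have key : ∀ a : Polynomial ℚ, a.Monic → a ∣ p → a.map (algebraMap ℚ K) = ((rt a).val.map (fun r => Polynomial.X - Polynomial.C r)).prod := by
      intro a ha hap
      have h1 : (a.map (algebraMap ℚ K)).Separable := (hs.of_dvd hap).map
      have h2 := (Polynomial.nodup_roots h1)
      rw [show (rt a).val = (a.map (algebraMap ℚ K)).roots by simp [rt, h2.dedup]]
      exact (IsAlgClosed.splits _).eq_prod_roots_of_monic (ha.map _)
    apply Polynomial.map_injective (algebraMap ℚ K) (algebraMap ℚ K).injective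
    rw [key a ha hap, key b hb hbp, hab]
  refine ⟨(rt p).powerset.image (fun T => if h : ∃ a : Polynomial ℚ, a.Monic ∧ a ∣ p ∧ rt a = T then h.choose else 0), ?_, ?_⟩
  · refine Finset.card_image_le.trans ?_
    rw [Finset.card_powerset]
    have h1 : (rt p).card ≤ 4 := by
      refine (Multiset.toFinset_card_le _).trans ((Polynomial.card_roots' _).trans ?_)
      rw [Polynomial.natDegree_map]; exact hd
    calc 2 ^ (rt p).card ≤ 2 ^ 4 := Nat.pow_le_pow_right (by norm_num) h1
      _ = 16 := by norm_num
  · intro a ha hap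
    rw [Finset.mem_image]
    refine ⟨rt a, ?_, ?_⟩
    · rw [Finset.mem_powerset]
      intro r hr
      simp only [rt, Multiset.mem_toFinset] at hr ⊢
      exact Multiset.mem_of_le (Polynomial.roots.le_of_dvd (by rwa [Ne, Polynomial.map_eq_zero]) (Polynomial.map_dvd _ hap)) hr
    · have hex : ∃ b : Polynomial ℚ, b.Monic ∧ b ∣ p ∧ rt b = rt a := ⟨a, ha, hap, rfl⟩
      rw [dif_pos hex]
      obtain ⟨h1, h2, h3⟩ := hex.choose_spec
      exact hinj _ _ h1 h2 ha hap h3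

/-- restriction to a plane -/
noncomputable def plane {m : ℕ} (u1 u2 w : Fin m → ℚ) (f : MvPolynomial (Fin m) ℚ) : MvPolynomial (Fin 3) ℚ :=
  aeval (fun i => C (u1 i) * X 0 + C (u2 i) * X 1 + C (w i) * X 2) f

lemma plane_deg {m : ℕ} (u1 u2 w : Fin m → ℚ) (f : MvPolynomial (Fin m) ℚ) (hf : f.totalDegree ≤ 4) : (plane u1 u2 w f).totalDegree ≤ 4 := by
  rw [← Filt.mem_deg, plane]
  refine Filt.aeval _ _ (fun i => ?_) f 4 hf
  refine Submodule.add_mem _ (Submodule.add_mem _ ?_ ?_) ?_ <;> rw [Filt.mem_deg] <;> refine (totalDegree_mul _ _).trans ?_ <;> simp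

/-- the dehomogenization -/
noncomputable def psi : MvPolynomial (Fin 3) ℚ →ₐ[ℚ] Polynomial (Polynomial ℚ) :=
  aeval ![Polynomial.C Polynomial.X, 1, Polynomial.X]

lemma psi_plane {m : ℕ} (u1 u2 w : Fin m → ℚ) (f : MvPolynomial (Fin m) ℚ) : psi (plane u1 u2 w f) = Phw u1 u2 f w := by
  rw [plane, Phw]
  refine (hom_aeval (A := MvPolynomial (Fin 3) ℚ) (B := Polynomial (Polynomial ℚ)) psi.toRingHom _ f).trans ?_
  congr 2
  ext i : 1
  have hC : ∀ c : ℚ, psi (C c) = Polynomial.C (Polynomial.C c) := by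
    intro c
    rw [psi, aeval_C]; rfl
  simp [hC]
  simp [psi]
  ring

lemma psi_mem (A : MvPolynomial (Fin 3) ℚ) : psi A ∈ F2.V A.totalDegree := by
  refine Filt.aeval F2 _ (fun i => ?_) A _ le_rfl
  fin_cases i
  · exact Filt.C_poly1 _ (Filt.X_poly1 _)
  · exact Filt.mono _ (Nat.zero_le 1) (Filt.one _)
  · exact Filt.X_poly1 _

lemma Phw_coeff_zero {m : ℕ} (u1 u2 w : Fin m → ℚ) (f : MvPolynomial (Fin m) ℚ) : (Phw u1 u2 f w).coeff 0 = lineP u1 u2 f := by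
  rw [Polynomial.coeff_zero_eq_eval_zero, Phw, lineP, ← Polynomial.coe_evalRingHom]
  refine (hom_aeval (A := Polynomial (Polynomial ℚ)) (B := Polynomial ℚ) (Polynomial.evalRingHom 0) _ f).trans ?_
  congr 2
  ext i : 1
  simp

lemma plane_irr {m : ℕ} (u1 u2 : Fin m → ℚ) (f : MvPolynomial (Fin m) ℚ) (hf : f.IsHomogeneous 4) (hirr : Irreducible f)
    (hu : eval u1 f = 1) (hs : (lineP u1 u2 f).Separable) :
    ∃ G : MvPolynomial (Fin m) ℚ, G ≠ 0 ∧ G.totalDegree ≤ 512 ∧ ∀ w, eval w G ≠ 0 → Irreducible (plane u1 u2 w f) := by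
  classical
  obtain ⟨hmon, hdeg⟩ : (lineP u1 u2 f).Monic ∧ (lineP u1 u2 f).natDegree = 4 := monic_line (A := ℚ) u2 u1 f hf hu
  set p := lineP u1 u2 f with hp
  obtain ⟨D, hD, hDm⟩ := types p hmon.ne_zero hdeg.le hs
  have key : ∀ a : Polynomial ℚ, ∃ G : MvPolynomial (Fin m) ℚ, G ≠ 0 ∧ G.totalDegree ≤ 32 ∧
      ∀ b, a.Monic → b.Monic → a * b = p → 1 ≤ a.natDegree → 1 ≤ b.natDegree → ∀ w A B, Fact u1 u2 f w a b A B → eval w G = 0 := by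
    intro a
    by_cases h : ∃ b : Polynomial ℚ, a.Monic ∧ b.Monic ∧ a * b = p ∧ 1 ≤ a.natDegree ∧ 1 ≤ b.natDegree
    · obtain ⟨b, ha, hb, hab, hda, hdb⟩ := h
      have hsum : a.natDegree + b.natDegree = 4 := by rw [← hdeg, ← hab, ha.natDegree_mul hb]
      obtain ⟨G, hG0, hGd, hG⟩ := obstr u1 u2 f hf.totalDegree_le hirr a b ha hb (by rw [← hab] at hs; exact hs.isCoprime) hab hda hdb hsum
      refine ⟨G, hG0, hGd, fun b' _ hb' hab' _ _ => ?_⟩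
      have : b' = b := mul_left_cancel₀ ha.ne_zero (hab'.trans hab.symm)
      rw [this]; exact hG
    · exact ⟨1, one_ne_zero, by simp, fun b h1 h2 h3 h4 h5 => absurd ⟨b, h1, h2, h3, h4, h5⟩ h⟩
  choose G hG0 hGd hG using key
  refine ⟨∏ a ∈ D, G a, Finset.prod_ne_zero_iff.2 fun a _ => hG0 a, ?_, ?_⟩
  · refine (totalDegree_finsetProd _ _).trans ((Finset.sum_le_card_nsmul _ _ 32 fun a _ => hGd a).trans ?_)
    rw [smul_eq_mul]; omega
  · intro w hw
    rw [map_prod, Finset.prod_ne_zero_iff] at hw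
    have hF4 := plane_deg u1 u2 w f hf.totalDegree_le
    have hpsi := psi_plane u1 u2 w f
    have h0 := Phw_coeff_zero u1 u2 w f
    have hFne : plane u1 u2 w f ≠ 0 := by
      intro h
      rw [h, map_zero] at hpsi
      rw [← hpsi, Polynomial.coeff_zero] at h0
      exact hmon.ne_zero h0.symm
    have hunit : ∀ A : MvPolynomial (Fin 3) ℚ, A ≠ 0 → A.totalDegree = 0 → IsUnit A := by
      intro A hA hAd
      rw [totalDegree_eq_zero_iff_eq_C] at hAd
      rw [hAd]
      refine IsUnit.map C (isUnit_iff_ne_zero.2 fun h => hA ?_)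
      rw [hAd, h, map_zero]
    have main : ∀ A B : MvPolynomial (Fin 3) ℚ, plane u1 u2 w f = A * B → 1 ≤ A.totalDegree → 1 ≤ B.totalDegree → False := by
      intro A B hAB hA1 hB1
      have hA0 : A ≠ 0 := left_ne_zero_of_mul (hAB ▸ hFne)
      have hB0 : B ≠ 0 := right_ne_zero_of_mul (hAB ▸ hFne)
      have htd : A.totalDegree + B.totalDegree ≤ 4 := by
        rw [← totalDegree_mul_of_isDomain hA0 hB0, ← hAB]; exact hF4
      have hmA := psi_mem A
      have hmB := psi_mem B
      have hmul : psi A * psi B = Phw u1 u2 f w := by rw [← map_mul, ← hAB, hpsi]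
      have h00 : (psi A).coeff 0 * (psi B).coeff 0 = p := by rw [← Polynomial.mul_coeff_zero, hmul, h0]
      set a := (psi A).coeff 0 with ha
      set b := (psi B).coeff 0 with hb
      have hane : a ≠ 0 := left_ne_zero_of_mul (h00 ▸ hmon.ne_zero)
      have hbne : b ≠ 0 := right_ne_zero_of_mul (h00 ▸ hmon.ne_zero)
      have hsum : a.natDegree + b.natDegree = 4 := by rw [← Polynomial.natDegree_mul hane hbne, h00, hdeg]
      have had : a.natDegree ≤ A.totalDegree - 0 := F2_coeff hmA 0
      have hbd : b.natDegree ≤ B.totalDegree - 0 := F2_coeff hmB 0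
      have hlc : a.leadingCoeff * b.leadingCoeff = 1 := by rw [← Polynomial.leadingCoeff_mul, h00]; exact hmon
      have hla : a.leadingCoeff ≠ 0 := left_ne_zero_of_mul (hlc ▸ one_ne_zero)
      have hlb : b.leadingCoeff ≠ 0 := right_ne_zero_of_mul (hlc ▸ one_ne_zero)
      have hna : (Polynomial.C b.leadingCoeff * a).natDegree = a.natDegree := Polynomial.natDegree_C_mul hlb
      have hnb : (Polynomial.C a.leadingCoeff * b).natDegree = b.natDegree := Polynomial.natDegree_C_mul hla
      have hmona : (Polynomial.C b.leadingCoeff * a).Monic := by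
        rw [Polynomial.Monic, Polynomial.leadingCoeff_mul, Polynomial.leadingCoeff_C, mul_comm, hlc]
      have hmonb : (Polynomial.C a.leadingCoeff * b).Monic := by
        rw [Polynomial.Monic, Polynomial.leadingCoeff_mul, Polynomial.leadingCoeff_C, hlc]
      have hCC : (Polynomial.C a.leadingCoeff * Polynomial.C b.leadingCoeff : Polynomial ℚ) = 1 := by
        rw [← Polynomial.C_mul, hlc, Polynomial.C_1]
      have hprod : Polynomial.C b.leadingCoeff * a * (Polynomial.C a.leadingCoeff * b) = p := by
        rw [← h00]; linear_combination (a * b) * hCC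
      have hfact : Fact u1 u2 f w (Polynomial.C b.leadingCoeff * a) (Polynomial.C a.leadingCoeff * b)
          (Polynomial.C (Polynomial.C b.leadingCoeff) * psi A) (Polynomial.C (Polynomial.C a.leadingCoeff) * psi B) := by
        refine ⟨?_, ?_, ?_, ?_, ?_, ?_, ?_⟩
        · rw [← hmul]
          have : (Polynomial.C (Polynomial.C a.leadingCoeff) * Polynomial.C (Polynomial.C b.leadingCoeff) : Polynomial (Polynomial ℚ)) = 1 := by
            rw [← Polynomial.C_mul, hCC, Polynomial.C_1]
          linear_combination (psi A * psi B) * this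
        · rw [Polynomial.coeff_C_mul]
        · rw [Polynomial.coeff_C_mul]
        · intro j hj
          rw [Polynomial.coeff_C_mul, Polynomial.natDegree_C_mul hlb, hna]
          have := F2_coeff hmA j
          omega
        · intro j hj
          rw [Polynomial.coeff_C_mul, Polynomial.natDegree_C_mul hla, hnb]
          have := F2_coeff hmB j
          omega
        · refine (Polynomial.natDegree_C_mul_le _ _).trans ((F2_natDegree hmA).trans ?_); omega
        · refine (Polynomial.natDegree_C_mul_le _ _).trans ((F2_natDegree hmB).trans ?_); omega
      exact hw _ (hDm _ hmona (Dvd.intro _ hprod)) (hG _ _ hmona hmonb hprod (by omega) (by omega) w _ _ hfact)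
    refine ⟨fun hun => ?_, fun A B hAB => ?_⟩
    · have h1 := (MvPolynomial.isUnit_iff_totalDegree_of_isReduced.1 hun).2
      have h2 := F2_coeff (psi_mem (plane u1 u2 w f)) 0
      rw [hpsi, h0, hdeg, h1] at h2
      omega
    · by_contra! hcon
      have hA0 : A ≠ 0 := left_ne_zero_of_mul (hAB ▸ hFne)
      have hB0 : B ≠ 0 := right_ne_zero_of_mul (hAB ▸ hFne)
      refine main A B hAB ?_ ?_
      · by_contra h; exact hcon.1 (hunit A hA0 (by omega))
      · by_contra h; exact hcon.2 (hunit B hB0 (by omega))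

end DG


namespace DG
open MvPolynomial

lemma noncone {m : ℕ} (u1 u2 : Fin m → ℚ) (f : MvPolynomial (Fin m) ℚ) (hf : f.IsHomogeneous 4) (hu : eval u1 f = 1)
    (hs : IsCoprime (lineP u1 u2 f) (Polynomial.derivative (lineP u1 u2 f))) :
    ∃ l1 l2 : (Fin m → ℚ) →ₗ[ℚ] ℚ, l1 u1 = 1 ∧ l1 u2 = 0 ∧ l2 u1 = 0 ∧ l2 u2 = 1 ∧
      ∀ (w : Fin m → ℚ) (v : Fin 3 → ℚ), v ≠ 0 → ∑ j, C (v j) * pderiv j (plane u1 u2 w f) = 0 →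
        eval w f = eval (fun i => u1 i * l1 w + u2 i * l2 w) f := by
  classical
  obtain ⟨hmon, hdeg⟩ : (lineP u1 u2 f).Monic ∧ (lineP u1 u2 f).natDegree = 4 := monic_line (A := ℚ) u2 u1 f hf hu
  set p := lineP u1 u2 f with hp
  set g : Fin m → Polynomial ℚ := fun i => Polynomial.C (u2 i) + Polynomial.C (u1 i) * Polynomial.X with hg
  have hpg : p = aeval g f := rfl
  let N : (Fin m → ℚ) →ₗ[ℚ] Polynomial ℚ := ∑ i, (LinearMap.proj i).smulRight (aeval g (pderiv i f))
  have hN : ∀ w, N w = ∑ i, Polynomial.C (w i) * aeval g (pderiv i f) := by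
    intro w
    simp [N, LinearMap.sum_apply, Polynomial.smul_eq_C_mul]
  have hN1 : N u1 = Polynomial.derivative p := by
    have h := chain (Polynomial.derivative' : Derivation ℚ (Polynomial ℚ) (Polynomial ℚ)) g f
    rw [hN, hpg]
    refine Eq.trans ?_ h.symm
    refine Finset.sum_congr rfl fun i _ => ?_
    have : (Polynomial.derivative' : Derivation ℚ (Polynomial ℚ) (Polynomial ℚ)) (g i) = Polynomial.C (u1 i) := by
      simp [hg, Polynomial.derivative']
    rw [this, mul_comm]
  have hN2 : N u2 = 4 * p - Polynomial.X * Polynomial.derivative p := by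
    have h := congrArg (aeval g) hf.sum_X_mul_pderiv
    rw [map_sum] at h
    simp only [map_mul, aeval_X, map_nsmul] at h
    rw [← hpg] at h
    have h2 : ∑ i, g i * aeval g (pderiv i f) = N u2 + Polynomial.X * N u1 := by
      rw [hN, hN, Finset.mul_sum, ← Finset.sum_add_distrib]
      refine Finset.sum_congr rfl fun i _ => ?_
      simp only [hg]; ring
    rw [h2, hN1] at h
    rw [eq_sub_iff_add_eq, h]; simp [nsmul_eq_mul]
  let E : (ℚ × ℚ) →ₗ[ℚ] Polynomial ℚ := (LinearMap.fst ℚ ℚ ℚ).smulRight (N u1) + (LinearMap.snd ℚ ℚ ℚ).smulRight (N u2)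
  have hE : ∀ a b, E (a, b) = Polynomial.C a * N u1 + Polynomial.C b * N u2 := by
    intro a b; simp [E, Polynomial.smul_eq_C_mul]
  have hEinj : LinearMap.ker E = ⊥ := by
    rw [LinearMap.ker_eq_bot']
    rintro ⟨a, b⟩ hab
    rw [hE, hN1, hN2] at hab
    have h1 : p ∣ (Polynomial.C b * Polynomial.X - Polynomial.C a) * Polynomial.derivative p :=
      ⟨4 * Polynomial.C b, by linear_combination -hab⟩
    have h2 := hs.dvd_of_dvd_mul_right h1
    have h3 : Polynomial.C b * Polynomial.X - Polynomial.C a = 0 := by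
      by_contra hne
      have h4 := Polynomial.natDegree_le_of_dvd h2 hne
      have h5 : (Polynomial.C b * Polynomial.X - Polynomial.C a).natDegree ≤ 1 := by
        rw [sub_eq_add_neg, ← Polynomial.C_neg]; exact Polynomial.natDegree_linear_le
      omega
    have hb : b = 0 := by simpa [Polynomial.coeff_C] using congrArg (fun q => Polynomial.coeff q 1) h3
    have ha : a = 0 := by simpa using congrArg (fun q => Polynomial.coeff q 0) h3
    rw [ha, hb]; rfl
  obtain ⟨r, hr⟩ := LinearMap.exists_leftInverse_of_injective E hEinj
  have hr' : ∀ x, r (E x) = x := fun x => LinearMap.congr_fun hr x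
  have hr1 : r (N u1) = (1, 0) := by
    have := hr' (1, 0); rw [hE] at this; simpa using this
  have hr2 : r (N u2) = (0, 1) := by
    have := hr' (0, 1); rw [hE] at this; simpa using this
  refine ⟨LinearMap.fst ℚ ℚ ℚ ∘ₗ r ∘ₗ N, LinearMap.snd ℚ ℚ ℚ ∘ₗ r ∘ₗ N, ?_, ?_, ?_, ?_, ?_⟩
  · simp [hr1]
  · simp [hr2]
  · simp [hr1]
  · simp [hr2]
  intro w v hv hcone
  set G : Fin m → MvPolynomial (Fin 3) ℚ := fun i => C (u1 i) * X 0 + C (u2 i) * X 1 + C (w i) * X 2 with hG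
  have hNv : N (v 0 • u1 + v 1 • u2 + v 2 • w) = 0 := by
    have h := congrArg (aeval ![(Polynomial.X : Polynomial ℚ), 1, 0]) hcone
    rw [map_zero, map_sum] at h
    rw [← h, hN]
    have hj : ∀ j : Fin 3, aeval ![(Polynomial.X : Polynomial ℚ), 1, 0] (C (v j) * pderiv j (plane u1 u2 w f)) =
        ∑ i, Polynomial.C (v j) * (aeval g (pderiv i f) * aeval ![(Polynomial.X : Polynomial ℚ), 1, 0] (pderiv j (G i))) := by
      intro j
      have h1 : pderiv j (plane u1 u2 w f) = ∑ i, aeval G (pderiv i f) * pderiv j (G i) := chain (pderiv j) G f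
      rw [h1, map_mul, map_sum, Finset.mul_sum]
      refine Finset.sum_congr rfl fun i _ => ?_
      rw [map_mul]
      have h2 : aeval ![(Polynomial.X : Polynomial ℚ), 1, 0] (aeval G (pderiv i f)) = aeval g (pderiv i f) := by
        rw [← AlgHom.comp_apply, comp_aeval]
        congr 2
        funext i
        simp [hG, hg, algHom_C]
        ring
      rw [h2, algHom_C]; rfl
    rw [Finset.sum_congr rfl fun j _ => hj j, Finset.sum_comm]
    refine Finset.sum_congr rfl fun i _ => ?_
    simp [Fin.sum_univ_three, hG, pderiv_X, algHom_C, Pi.single_apply]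
    ring
  have hrv : v 0 • ((1:ℚ), (0:ℚ)) + v 1 • ((0:ℚ), (1:ℚ)) + v 2 • r (N w) = 0 := by
    have := congrArg r hNv
    simp only [map_add, map_smul, map_zero, hr1, hr2] at this
    exact this
  have e1 : v 0 + v 2 * (r (N w)).1 = 0 := by simpa using congrArg Prod.fst hrv
  have e2 : v 1 + v 2 * (r (N w)).2 = 0 := by simpa using congrArg Prod.snd hrv
  have hv2 : v 2 ≠ 0 := by
    intro h
    apply hv
    rw [h] at e1 e2
    funext j
    fin_cases j
    · simpa using e1
    · simpa using e2
    · exact h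
  -- invariance
  let gl : Fin 3 → Polynomial ℚ := fun j => Polynomial.C (![(0:ℚ), 0, 1] j) + Polynomial.C (v j) * Polynomial.X
  have hder : Polynomial.derivative (aeval gl (plane u1 u2 w f)) = 0 := by
    have h := chain (Polynomial.derivative' : Derivation ℚ (Polynomial ℚ) (Polynomial ℚ)) gl (plane u1 u2 w f)
    refine (show Polynomial.derivative (aeval gl (plane u1 u2 w f)) = (Polynomial.derivative' : Derivation ℚ (Polynomial ℚ) (Polynomial ℚ)) (aeval gl (plane u1 u2 w f)) from rfl).trans (h.trans ?_)
    have h2 := congrArg (aeval gl) hcone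
    rw [map_zero, map_sum] at h2
    rw [← h2]
    refine Finset.sum_congr rfl fun i _ => ?_
    have : (Polynomial.derivative' : Derivation ℚ (Polynomial ℚ) (Polynomial ℚ)) (gl i) = Polynomial.C (v i) := by
      simp [gl, Polynomial.derivative']
    rw [this, map_mul, algHom_C, mul_comm]; rfl
  have hconst := Polynomial.eq_C_of_natDegree_eq_zero (Polynomial.derivative_eq_zero.1 hder)
  have hev : ∀ t : ℚ, (aeval gl (plane u1 u2 w f)).eval t = eval (fun i => u1 i * (t * v 0) + u2 i * (t * v 1) + w i * (1 + t * v 2)) f := by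
    intro t
    have h := hom_aeval (Polynomial.evalRingHom t) gl (plane u1 u2 w f)
    refine h.trans ?_
    rw [aeval_eq_eval]
    have h2 := hom_aeval (A := MvPolynomial (Fin 3) ℚ) (B := ℚ) (eval (fun i => (Polynomial.evalRingHom t) (gl i))) G f
    refine Eq.trans h2 ?_
    rw [aeval_eq_eval]
    congr 2
    funext i
    simp [hG, gl]
    ring
  have h0 := hev 0
  have h1 := hev (-(v 2)⁻¹)
  rw [hconst, Polynomial.eval_C] at h0 h1
  have h3 := h0.symm.trans h1
  have f0 : eval w f = eval (fun i => u1 i * (0 * v 0) + u2 i * (0 * v 1) + w i * (1 + 0 * v 2)) f := by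
    congr 2; funext i; ring
  rw [f0, h3]
  congr 2; funext i
  simp only [LinearMap.comp_apply, LinearMap.fst_apply, LinearMap.snd_apply]
  rw [show (r (N w)).1 = - (v 2)⁻¹ * v 0 by field_simp; linear_combination e1,
    show (r (N w)).2 = - (v 2)⁻¹ * v 1 by field_simp; linear_combination e2]
  field_simp
  ring

end DG


namespace DG
open MvPolynomial

lemma hom_aeval_mul {A : Type*} [CommRing A] [Algebra ℚ A] {m n : ℕ} (f : MvPolynomial (Fin m) ℚ) (hf : f.IsHomogeneous n) (c : A) (v : Fin m → ℚ) :
    aeval (fun l => c * algebraMap ℚ A (v l)) f = c ^ n * algebraMap ℚ A (eval v f) := by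
  rw [aeval_def, eval₂_eq', eval_eq', map_sum, Finset.mul_sum]
  refine Finset.sum_congr rfl fun e he => ?_
  have h1 : e.degree = n := by
    have := hf (mem_support_iff.1 he)
    rw [Finsupp.degree_eq_weight_one]; exact this
  simp only [mul_pow, map_mul, map_prod, map_pow]
  rw [Finset.prod_mul_distrib, Finset.prod_pow_eq_pow_sum, ← Finsupp.degree_eq_sum, h1]
  ring

/-- linear form as a polynomial -/
noncomputable def linF {m : ℕ} (l : (Fin m → ℚ) →ₗ[ℚ] ℚ) : MvPolynomial (Fin m) ℚ := ∑ i, C (l (Pi.single i 1)) * X i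

lemma eval_linF {m : ℕ} (l : (Fin m → ℚ) →ₗ[ℚ] ℚ) (x : Fin m → ℚ) : eval x (linF l) = l x := by
  rw [linF, map_sum]
  conv_rhs => rw [LinearMap.pi_apply_eq_sum_univ l x]
  refine Finset.sum_congr rfl fun i _ => ?_
  have : (fun j => if i = j then (1:ℚ) else 0) = Pi.single i 1 := by
    funext j; simp [Pi.single_apply, eq_comm]
  simp only [map_mul, eval_C, eval_X, smul_eq_mul]
  rw [this, mul_comm]

lemma linF_deg {m : ℕ} (l : (Fin m → ℚ) →ₗ[ℚ] ℚ) : (linF l).totalDegree ≤ 1 := by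
  refine totalDegree_finsetSum_le fun i _ => ?_
  refine (totalDegree_mul _ _).trans ?_
  simp

/-- the obstruction polynomial for cones -/
noncomputable def obC {m : ℕ} (u1 u2 : Fin m → ℚ) (l1 l2 : (Fin m → ℚ) →ₗ[ℚ] ℚ) (f : MvPolynomial (Fin m) ℚ) : MvPolynomial (Fin m) ℚ :=
  f - aeval (fun i => C (u1 i) * linF l1 + C (u2 i) * linF l2) f

lemma eval_obC {m : ℕ} (u1 u2 : Fin m → ℚ) (l1 l2 : (Fin m → ℚ) →ₗ[ℚ] ℚ) (f : MvPolynomial (Fin m) ℚ) (w : Fin m → ℚ) :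
    eval w (obC u1 u2 l1 l2 f) = eval w f - eval (fun i => u1 i * l1 w + u2 i * l2 w) f := by
  rw [obC, map_sub]
  congr 1
  refine (hom_aeval (A := MvPolynomial (Fin m) ℚ) (B := ℚ) (eval w) _ f).trans ?_
  rw [aeval_eq_eval]
  congr 2
  funext i
  simp [eval_linF]

lemma obC_deg {m : ℕ} (u1 u2 : Fin m → ℚ) (l1 l2 : (Fin m → ℚ) →ₗ[ℚ] ℚ) (f : MvPolynomial (Fin m) ℚ) (hf : f.totalDegree ≤ 4) :
    (obC u1 u2 l1 l2 f).totalDegree ≤ 4 := by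
  rw [obC]
  refine (totalDegree_sub _ _).trans (max_le hf ?_)
  have h := (Filt.deg (Fin m)).aeval (fun i => C (u1 i) * linF l1 + C (u2 i) * linF l2) (fun i => by
    rw [Filt.mem_deg]
    refine (totalDegree_add _ _).trans (max_le ?_ ?_)
    · exact (totalDegree_mul _ _).trans (by simpa using linF_deg l1)
    · exact (totalDegree_mul _ _).trans (by simpa using linF_deg l2)) f 4 hf
  rwa [Filt.mem_deg] at h

lemma binary_zero {m : ℕ} (u1 u2 : Fin m → ℚ) (l1 l2 : (Fin m → ℚ) →ₗ[ℚ] ℚ) (f : MvPolynomial (Fin m) ℚ) (hf : f.IsHomogeneous 4)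
    (hirr : Irreducible f) (h11 : l1 u1 = 1) (h12 : l1 u2 = 0) (h21 : l2 u1 = 0) (h22 : l2 u2 = 1) (hob : obC u1 u2 l1 l2 f = 0)
    (x : Fin m → ℚ) (hx : eval x f = 0) : l1 x = 0 ∧ l2 x = 0 := by
  by_contra hne
  set a := l1 x with ha
  set b := l2 x with hb
  have hab : a ^ 2 + b ^ 2 ≠ 0 := by
    intro h
    apply hne
    constructor <;> nlinarith [sq_nonneg a, sq_nonneg b]
  set D := C b * linF l1 - C a * linF l2 with hD
  set c := a / (a ^ 2 + b ^ 2) with hc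
  set d := b / (a ^ 2 + b ^ 2) with hd
  have hcd : a * c + b * d = 1 := by rw [hc, hd]; field_simp
  set M := C c * linF l1 + C d * linF l2 with hM
  have hCC : (C a * C c + C b * C d : MvPolynomial (Fin m) ℚ) = 1 := by
    rw [← C_mul, ← C_mul, ← C_add, hcd, C_1]
  have hfx : eval (fun i => a * u1 i + b * u2 i) f = 0 := by
    have := eval_obC u1 u2 l1 l2 f x
    rw [hob, map_zero, hx, zero_sub, eq_comm, neg_eq_zero] at this
    rw [← this]; congr 2; funext i; ring
  have hdvd : D ∣ f := by
    have h1 : f = aeval (fun i => C (u1 i) * linF l1 + C (u2 i) * linF l2) f := by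
      rw [obC, sub_eq_zero] at hob; exact hob
    rw [h1, ← Ideal.mem_span_singleton, ← Ideal.Quotient.eq_zero_iff_mem]
    refine (hom_aeval (A := MvPolynomial (Fin m) ℚ) (B := MvPolynomial (Fin m) ℚ ⧸ Ideal.span {D}) _ _ f).trans ?_
    have h2 : ∀ i, Ideal.Quotient.mk (Ideal.span {D}) (C (u1 i) * linF l1 + C (u2 i) * linF l2) =
        Ideal.Quotient.mk (Ideal.span {D}) (M * C (a * u1 i + b * u2 i)) := by
      intro i
      rw [Ideal.Quotient.eq, Ideal.mem_span_singleton]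
      refine ⟨C (u1 i) * C d - C (u2 i) * C c, ?_⟩
      rw [hM, hD, C_add, C_mul, C_mul]
      linear_combination (-(C (u1 i) * linF l1) - (C (u2 i) * linF l2)) * hCC
    have h3 := hom_aeval (A := MvPolynomial (Fin m) ℚ) (B := MvPolynomial (Fin m) ℚ ⧸ Ideal.span {D}) (Ideal.Quotient.mk (Ideal.span {D}))
      (fun i => M * algebraMap ℚ (MvPolynomial (Fin m) ℚ) (a * u1 i + b * u2 i)) f
    rw [hom_aeval_mul f hf, hfx, map_zero, mul_zero, map_zero] at h3
    rw [h3]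
    congr 2
    funext i
    exact h2 i
  have hDne : D ≠ 0 := by
    intro h
    have e1 := congrArg (eval u1) h
    have e2 := congrArg (eval u2) h
    simp [hD, eval_linF, h11, h12, h21, h22] at e1 e2
    rw [e1, e2] at hab
    simp at hab
  obtain ⟨q, hq⟩ := hdvd
  have hq0 : q ≠ 0 := by rintro rfl; rw [mul_zero] at hq; exact hirr.ne_zero hq
  have hDd : D.totalDegree ≤ 1 := by
    refine (totalDegree_sub _ _).trans (max_le ?_ ?_)
    · exact (totalDegree_mul _ _).trans (by simpa using linF_deg l1)
    · exact (totalDegree_mul _ _).trans (by simpa using linF_deg l2)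
  have hfd : f.totalDegree = 4 := hf.totalDegree hirr.ne_zero
  rcases hirr.isUnit_or_isUnit hq with h | h
  · have h1 := h.map (eval (0 : Fin m → ℚ))
    have h2 : eval (0 : Fin m → ℚ) D = 0 := by
      rw [hD, map_sub, map_mul, map_mul, eval_linF, eval_linF, map_zero, map_zero]; ring
    rw [h2] at h1
    exact not_isUnit_zero h1
  · have h1 := (MvPolynomial.isUnit_iff_totalDegree_of_isReduced.1 h).2
    rw [hq, totalDegree_mul_of_isDomain hDne hq0, h1] at hfd
    omega

/-- 3 by 3 minor -/
def mnr {R : Type*} [CommRing R] {k : ℕ} (a b c : Fin (k+3) → R) : R :=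
  (a 1 * b 2 - a 2 * b 1) * c 0 + (a 2 * b 0 - a 0 * b 2) * c 1 + (a 0 * b 1 - a 1 * b 0) * c 2

lemma lin3_deg {k : ℕ} (A B E : ℚ) : (C A * X 0 + C B * X 1 + C E * X 2 : MvPolynomial (Fin (k+3)) ℚ).totalDegree ≤ 1 := by
  have : ∀ (c : ℚ) (i : Fin (k+3)), (C c * X i : MvPolynomial (Fin (k+3)) ℚ).totalDegree ≤ 1 := fun c i =>
    (totalDegree_mul _ _).trans (by simp)
  refine (totalDegree_add _ _).trans (max_le ((totalDegree_add _ _).trans (max_le ?_ ?_)) ?_) <;> exact this _ _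

lemma plane_C {m : ℕ} (u1 u2 w : Fin m → ℚ) (c : ℚ) (f : MvPolynomial (Fin m) ℚ) : plane u1 u2 w (C c * f) = C c * plane u1 u2 w f := by
  simp [plane, algHom_C]

def Binary {m : ℕ} (f : MvPolynomial (Fin m) ℚ) : Prop :=
  ∃ (u1 u2 : Fin m → ℚ) (l1 l2 : (Fin m → ℚ) →ₗ[ℚ] ℚ), l1 u1 = 1 ∧ l1 u2 = 0 ∧ l2 u1 = 0 ∧ l2 u2 = 1 ∧
    ∀ x, eval x f = 0 → l1 x = 0 ∧ l2 x = 0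

structure GoodPlane {k : ℕ} (f : MvPolynomial (Fin (k+3)) ℚ) (u1 u2 w : Fin (k+3) → ℤ) : Prop where
  b1 : ∀ i, |u1 i| ≤ 521
  b2 : ∀ i, |u2 i| ≤ 521
  b3 : ∀ i, |w i| ≤ 521
  n1 : eval (qp u1) f ≠ 0
  n2 : eval (qp u2) f ≠ 0
  n3 : eval (qp w) f ≠ 0
  dt : mnr u1 u2 w ≠ 0
  irr : Irreducible (plane (qp u1) (qp u2) (qp w) f)
  nc : ∀ v : Fin 3 → ℚ, v ≠ 0 → ∑ j, C (v j) * pderiv j (plane (qp u1) (qp u2) (qp w) f) ≠ 0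

lemma geo_aux {k : ℕ} (f : MvPolynomial (Fin (k+3)) ℚ) (hf : f.IsHomogeneous 4) (hirr : Irreducible f) (u1 : Fin (k+3) → ℤ)
    (hb : ∀ i, |u1 i| ≤ 521) (h0 : u1 0 ≠ 0) (hu : eval (qp u1) f = 1) : Binary f ∨ ∃ u2 w, GoodPlane f u1 u2 w := by
  obtain ⟨r, hr0, hrd, hr⟩ := sep f hf hirr (qp u1) hu
  have hfd : f.totalDegree = 4 := hf.totalDegree hirr.ne_zero
  have hl0 : (C (-(u1 1:ℚ)) * X 0 + C (u1 0:ℚ) * X 1 + C 0 * X 2 : MvPolynomial (Fin (k+3)) ℚ) ≠ 0 := by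
    intro h
    have := congrArg (eval (Pi.single (1 : Fin (k+3)) (1:ℚ))) h
    simp at this
    exact h0 this
  obtain ⟨u2, hb2, h2⟩ := avoid (r * f * _) (mul_ne_zero (mul_ne_zero hr0 hirr.ne_zero) hl0) 69 (by
    refine (totalDegree_mul _ _).trans (add_le_add (b := 68) ((totalDegree_mul _ _).trans ?_) (lin3_deg _ _ _))
    omega)
  rw [map_mul, map_mul, mul_ne_zero_iff, mul_ne_zero_iff] at h2
  obtain ⟨⟨h2r, h2f⟩, h2l⟩ := h2
  have hs := hr _ h2r
  obtain ⟨G, hG0, hGd, hG⟩ := plane_irr (qp u1) (qp u2) f hf hirr hu hs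
  obtain ⟨l1, l2, h11, h12, h21, h22, hc⟩ := noncone (qp u1) (qp u2) f hf hu hs
  by_cases hob : obC (qp u1) (qp u2) l1 l2 f = 0
  · exact Or.inl ⟨qp u1, qp u2, l1, l2, h11, h12, h21, h22, binary_zero _ _ l1 l2 f hf hirr h11 h12 h21 h22 hob⟩
  right
  have hm0 : (C ((u1 1 * u2 2 - u1 2 * u2 1 : ℤ):ℚ) * X 0 + C ((u1 2 * u2 0 - u1 0 * u2 2 : ℤ):ℚ) * X 1 + C ((u1 0 * u2 1 - u1 1 * u2 0 : ℤ):ℚ) * X 2 : MvPolynomial (Fin (k+3)) ℚ) ≠ 0 := by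
    intro h
    have h3 := congrArg (eval (Pi.single (2 : Fin (k+3)) (1:ℚ))) h
    have e0 : (0 : Fin (k+3)) ≠ 2 := fun h => by
      have := congrArg Fin.val h
      rw [show ((2 : Fin (k+3)) : ℕ) = 2 from Nat.mod_eq_of_lt (Nat.lt_of_lt_of_le (Nat.lt_succ_self 2) (Nat.le_add_left 3 k))] at this
      simp at this
    have e1 : (1 : Fin (k+3)) ≠ 2 := fun h => by
      have := congrArg Fin.val h
      rw [show ((2 : Fin (k+3)) : ℕ) = 2 from Nat.mod_eq_of_lt (Nat.lt_of_lt_of_le (Nat.lt_succ_self 2) (Nat.le_add_left 3 k))] at this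
      simp at this
    simp [e0, e1] at h3
    apply h2l
    simp [qp]
    linear_combination h3
  obtain ⟨w, hb3, h3⟩ := avoid (G * f * obC (qp u1) (qp u2) l1 l2 f * _) (mul_ne_zero (mul_ne_zero (mul_ne_zero hG0 hirr.ne_zero) hob) hm0) 521 (by
    refine (totalDegree_mul _ _).trans (add_le_add (b := 520) ((totalDegree_mul _ _).trans (add_le_add (b := 516) ((totalDegree_mul _ _).trans ?_) (obC_deg _ _ _ _ _ hfd.le))) (lin3_deg _ _ _))
    omega)
  rw [map_mul, map_mul, map_mul, mul_ne_zero_iff, mul_ne_zero_iff, mul_ne_zero_iff] at h3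
  obtain ⟨⟨⟨h3G, h3f⟩, h3o⟩, h3m⟩ := h3
  refine ⟨u2, w, hb, fun i => (hb2 i).trans (by norm_num), by exact_mod_cast hb3, ?_, h2f, h3f, ?_, hG _ h3G, ?_⟩
  · rw [hu]; exact one_ne_zero
  · intro h
    apply h3m
    have : ((mnr u1 u2 w : ℤ) : ℚ) = 0 := by rw [h]; simp
    rw [← this]
    simp [mnr, qp]
  · intro v hv hcone
    apply h3o
    rw [eval_obC, hc _ v hv hcone, sub_self]

theorem geo {k : ℕ} (f : MvPolynomial (Fin (k+3)) ℚ) (hf : f.IsHomogeneous 4) (hirr : Irreducible f) :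
    Binary f ∨ ∃ u1 u2 w, GoodPlane f u1 u2 w := by
  have hfd : f.totalDegree = 4 := hf.totalDegree hirr.ne_zero
  obtain ⟨u1, hb1, h1⟩ := avoid (f * X 0) (mul_ne_zero hirr.ne_zero (X_ne_zero _)) 5 (by
    refine (totalDegree_mul _ _).trans ?_
    rw [totalDegree_X]; omega)
  rw [map_mul, mul_ne_zero_iff, eval_X] at h1
  set a := eval (qp u1) f with ha
  have hunit : IsUnit (C a⁻¹ : MvPolynomial (Fin (k+3)) ℚ) := IsUnit.map C (isUnit_iff_ne_zero.2 (inv_ne_zero h1.1))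
  have hirr' : Irreducible (C a⁻¹ * f) := (irreducible_isUnit_mul hunit).2 hirr
  rcases geo_aux (C a⁻¹ * f) (by simpa using (isHomogeneous_C _ a⁻¹).mul hf) hirr' u1 (fun i => (hb1 i).trans (by norm_num))
    (by intro h; apply h1.2; simp [qp, h]) (by rw [map_mul, eval_C, ← ha, inv_mul_cancel₀ h1.1]) with ⟨u1, u2, l1, l2, h11, h12, h21, h22, hz⟩ | ⟨u2, w, hg⟩
  · exact Or.inl ⟨u1, u2, l1, l2, h11, h12, h21, h22, fun x hx => hz x (by rw [map_mul, hx, mul_zero])⟩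
  · refine Or.inr ⟨u1, u2, w, hg.b1, hg.b2, hg.b3, ?_, ?_, ?_, hg.dt, ?_, ?_⟩
    · intro h; apply hg.n1; rw [map_mul, h, mul_zero]
    · intro h; apply hg.n2; rw [map_mul, h, mul_zero]
    · intro h; apply hg.n3; rw [map_mul, h, mul_zero]
    · have := hg.irr
      rw [plane_C] at this
      exact (irreducible_isUnit_mul (IsUnit.map C (isUnit_iff_ne_zero.2 (inv_ne_zero h1.1)))).1 this
    · intro v hv h
      apply hg.nc v hv
      rw [plane_C]
      simp only [Derivation.leibniz, pderiv_C, smul_eq_mul, mul_zero, add_zero]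
      rw [← mul_zero (C a⁻¹), ← h, Finset.mul_sum]
      refine Finset.sum_congr rfl fun j _ => ?_
      ring

end DG


namespace DG
open MvPolynomial

/-- `Q` is the degree `d` part of `P`, up to terms of lower degree -/
structure TopF {σ : Type*} (d : ℕ) (P Q : MvPolynomial σ ℚ) : Prop where
  hP : P.totalDegree ≤ d
  hQ : Q.totalDegree ≤ d
  low : ∀ m, d ≤ m.degree → coeff m P = coeff m Q

lemma deg_le_of_coeff {σ : Type*} {P : MvPolynomial σ ℚ} {m : σ →₀ ℕ} (h : coeff m P ≠ 0) : m.degree ≤ P.totalDegree := by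
  have := le_totalDegree (mem_support_iff.2 h)
  exact this

lemma TopF.mul {σ : Type*} {d e : ℕ} {P Q P' Q' : MvPolynomial σ ℚ} (h : TopF d P Q) (h' : TopF e P' Q') : TopF (d+e) (P * P') (Q * Q') := by
  classical
  refine ⟨(totalDegree_mul _ _).trans (add_le_add h.hP h'.hP), (totalDegree_mul _ _).trans (add_le_add h.hQ h'.hQ), fun m hm => ?_⟩
  rw [coeff_mul, coeff_mul]
  refine Finset.sum_congr rfl fun x hx => ?_
  have hx' := Finset.HasAntidiagonal.mem_antidiagonal.1 hx
  have hdeg : x.1.degree + x.2.degree = m.degree := by rw [← hx', map_add]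
  by_cases h1 : x.1.degree < d
  · have h2 : e < x.2.degree := by omega
    have z1 : coeff x.2 P' = 0 := by
      by_contra hne; have := deg_le_of_coeff hne; have := h'.hP; omega
    have z2 : coeff x.2 Q' = 0 := by
      by_contra hne; have := deg_le_of_coeff hne; have := h'.hQ; omega
    rw [z1, z2, mul_zero, mul_zero]
  · rw [h.low _ (by omega)]
    by_cases h2 : x.2.degree < e
    · have z1 : coeff x.1 Q = 0 := by
        by_contra hne; have := deg_le_of_coeff hne; have := h.hQ; omega
      rw [z1, zero_mul, zero_mul]
    · rw [h'.low _ (by omega)]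

lemma TopF.one {σ : Type*} : TopF 0 (1 : MvPolynomial σ ℚ) 1 := ⟨by simp, by simp, fun _ _ => rfl⟩

lemma TopF.pow {σ : Type*} {P Q : MvPolynomial σ ℚ} (h : TopF 1 P Q) (n : ℕ) : TopF n (P ^ n) (Q ^ n) := by
  induction n with
  | zero => simpa using TopF.one
  | succ n ih => rw [pow_succ, pow_succ]; exact ih.mul h

lemma TopF.prod {σ ι : Type*} (s : Finset ι) (P Q : ι → MvPolynomial σ ℚ) (e : ι → ℕ) (h : ∀ i ∈ s, TopF (e i) (P i) (Q i)) :
    TopF (∑ i ∈ s, e i) (∏ i ∈ s, P i) (∏ i ∈ s, Q i) := by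
  classical
  induction s using Finset.induction_on with
  | empty => simpa using TopF.one
  | insert a s ha ih =>
    rw [Finset.sum_insert ha, Finset.prod_insert ha, Finset.prod_insert ha]
    exact (h a (Finset.mem_insert_self _ _)).mul (ih fun i hi => h i (Finset.mem_insert_of_mem hi))

lemma TopF.sum {σ ι : Type*} (s : Finset ι) (P Q : ι → MvPolynomial σ ℚ) (e : ℕ) (h : ∀ i ∈ s, TopF e (P i) (Q i)) :
    TopF e (∑ i ∈ s, P i) (∑ i ∈ s, Q i) := by
  refine ⟨totalDegree_finsetSum_le fun i hi => (h i hi).hP, totalDegree_finsetSum_le fun i hi => (h i hi).hQ, fun m hm => ?_⟩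
  rw [coeff_sum, coeff_sum]
  exact Finset.sum_congr rfl fun i hi => (h i hi).low m hm

lemma TopF.C {σ : Type*} (c : ℚ) : TopF 0 (MvPolynomial.C c : MvPolynomial σ ℚ) (MvPolynomial.C c) := ⟨by simp, by simp, fun _ _ => rfl⟩

lemma TopF.aeval {σ : Type*} {m n : ℕ} (g L : Fin m → MvPolynomial σ ℚ) (h : ∀ i, TopF 1 (g i) (L i)) (f : MvPolynomial (Fin m) ℚ) (hf : f.IsHomogeneous n) :
    TopF n (MvPolynomial.aeval g f) (MvPolynomial.aeval L f) := by
  rw [aeval_def, aeval_def, eval₂_eq', eval₂_eq']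
  refine TopF.sum _ _ _ _ fun e he => ?_
  have h1 : e.degree = n := by
    have := hf (mem_support_iff.1 he)
    rw [Finsupp.degree_eq_weight_one]; exact this
  rw [← h1, Finsupp.degree_eq_sum, ← zero_add (∑ i, e i)]
  exact (TopF.C _).mul (TopF.prod _ _ _ _ fun i _ => (h i).pow _)

lemma TopF.comp {σ : Type*} {d : ℕ} {P Q : MvPolynomial σ ℚ} (h : TopF d P Q) : homogeneousComponent d P = homogeneousComponent d Q := by
  ext m
  rw [coeff_homogeneousComponent, coeff_homogeneousComponent]
  split_ifs with hm
  · exact h.low m hm.ge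
  · rfl

lemma TopF.self {σ : Type*} (A : MvPolynomial σ ℚ) : TopF A.totalDegree A (homogeneousComponent A.totalDegree A) := by
  refine ⟨le_rfl, (homogeneousComponent_isHomogeneous _ _).totalDegree_le, fun m hm => ?_⟩
  rw [coeff_homogeneousComponent]
  split_ifs with h
  · rfl
  · by_contra hne
    have := deg_le_of_coeff hne
    omega

lemma comp_top_ne {σ : Type*} (A : MvPolynomial σ ℚ) (hA : A ≠ 0) : homogeneousComponent A.totalDegree A ≠ 0 := by
  obtain ⟨m, hm, hdm⟩ := Finset.exists_mem_eq_sup A.support (support_nonempty.2 hA) (fun m => m.sum fun _ e => e)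
  intro h
  have h1 := congrArg (coeff m) h
  rw [coeff_homogeneousComponent, if_pos, coeff_zero] at h1
  · exact mem_support_iff.1 hm h1
  · exact hdm.symm

lemma homComp_self {σ : Type*} {d : ℕ} {Q : MvPolynomial σ ℚ} (hQ : Q.IsHomogeneous d) : homogeneousComponent d Q = Q := by
  rw [homogeneousComponent_of_mem ((mem_homogeneousSubmodule _ _).2 hQ), if_pos rfl]

lemma irr_of_top {σ : Type*} {d : ℕ} (hd : 0 < d) (P Q : MvPolynomial σ ℚ) (h : TopF d P Q) (hQ : Q.IsHomogeneous d) (hirr : Irreducible Q) : Irreducible P := by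
  have hcQ : homogeneousComponent d Q = Q := homComp_self hQ
  have hP0 : P ≠ 0 := by
    rintro rfl
    have := h.comp
    rw [map_zero, hcQ] at this
    exact hirr.ne_zero this.symm
  have hPd : P.totalDegree = d := by
    refine le_antisymm h.hP ?_
    by_contra hlt
    have := h.comp
    rw [homogeneousComponent_eq_zero _ _ (by omega), hcQ] at this
    exact hirr.ne_zero this.symm
  have key : ∀ A : MvPolynomial σ ℚ, A ≠ 0 → IsUnit (homogeneousComponent A.totalDegree A) → IsUnit A := by
    intro A hA hu
    have h1 := (MvPolynomial.isUnit_iff_totalDegree_of_isReduced.1 hu).2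
    rw [(homogeneousComponent_isHomogeneous _ _).totalDegree (comp_top_ne A hA)] at h1
    rw [totalDegree_eq_zero_iff_eq_C] at h1
    rw [h1]
    refine IsUnit.map MvPolynomial.C (isUnit_iff_ne_zero.2 fun h => hA ?_)
    rw [h1, h, map_zero]
  refine ⟨fun hu => ?_, fun A B hAB => ?_⟩
  · have h1 := (MvPolynomial.isUnit_iff_totalDegree_of_isReduced.1 hu).2
    omega
  · have hA0 : A ≠ 0 := left_ne_zero_of_mul (hAB ▸ hP0)
    have hB0 : B ≠ 0 := right_ne_zero_of_mul (hAB ▸ hP0)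
    have hT := (TopF.self A).mul (TopF.self B)
    rw [← hAB, ← totalDegree_mul_of_isDomain hA0 hB0, ← hAB, hPd] at hT
    have h2 := h.comp.symm.trans hT.comp
    have hAB' : ((homogeneousComponent A.totalDegree A) * (homogeneousComponent B.totalDegree B)).IsHomogeneous d := by
      have := (homogeneousComponent_isHomogeneous A.totalDegree A).mul (homogeneousComponent_isHomogeneous B.totalDegree B)
      rwa [← totalDegree_mul_of_isDomain hA0 hB0, ← hAB, hPd] at this
    rw [hcQ, homComp_self hAB'] at h2
    rcases hirr.isUnit_or_isUnit h2 with hu | hu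
    · exact Or.inl (key A hA0 hu)
    · exact Or.inr (key B hB0 hu)

lemma eval_single {k n : ℕ} (F : MvPolynomial (Fin k) ℚ) (hF : F.IsHomogeneous n) (i : Fin k) :
    eval (Pi.single i 1) F = coeff (Finsupp.single i n) F := by
  classical
  rw [eval_eq', Finset.sum_eq_single (Finsupp.single i n)]
  · have : ∏ j, (Pi.single i 1 : Fin k → ℚ) j ^ (Finsupp.single i n) j = 1 := by
      refine Finset.prod_eq_one fun j _ => ?_
      by_cases h : j = i
      · subst h; simp
      · simp [Ne.symm h]
    rw [this, mul_one]
  · intro m hm hne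
    have h1 : m.degree = n := by
      have := hF (mem_support_iff.1 hm)
      rw [Finsupp.degree_eq_weight_one]; exact this
    have : ∃ j, j ≠ i ∧ m j ≠ 0 := by
      by_contra! hcon
      apply hne
      have hm' : m = Finsupp.single i (m i) := by
        ext j
        by_cases h : j = i
        · subst h; simp
        · rw [hcon j h, Finsupp.single_apply, if_neg (Ne.symm h)]
      rw [hm', Finsupp.degree_single] at h1
      rw [hm', h1]
    obtain ⟨j, hj, hmj⟩ := this
    rw [Finset.prod_eq_zero (Finset.mem_univ j), mul_zero]
    simp [hj, hmj]
  · intro h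
    rw [notMem_support_iff.1 h, zero_mul]

/-- the slices -/
noncomputable def slice {m : ℕ} (u1 u2 w τ : Fin m → ℤ) (f : MvPolynomial (Fin m) ℤ) : MvPolynomial (Fin 3) ℤ :=
  aeval (fun i => C (u1 i) * X 0 + C (u2 i) * X 1 + C (w i) * X 2 + C (τ i)) f

lemma eval_slice {m : ℕ} (u1 u2 w τ : Fin m → ℤ) (f : MvPolynomial (Fin m) ℤ) (y : Fin 3 → ℤ) :
    eval y (slice u1 u2 w τ f) = eval (fun i => u1 i * y 0 + u2 i * y 1 + w i * y 2 + τ i) f := by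
  rw [slice, ← aeval_eq_eval, ← aeval_eq_eval, ← AlgHom.comp_apply, comp_aeval]
  congr 2
  funext i
  simp

lemma toQ_slice {m : ℕ} (u1 u2 w τ : Fin m → ℤ) (f : MvPolynomial (Fin m) ℤ) :
    toQ (slice u1 u2 w τ f) = aeval (fun i => C (qp u1 i) * X 0 + C (qp u2 i) * X 1 + C (qp w i) * X 2 + C (qp τ i)) (toQ f) := by
  rw [toQ, slice, toQ, aeval_def, aeval_def, eval₂_map, ← coe_eval₂Hom, ← coe_eval₂Hom, ← RingHom.comp_apply]
  congr 1
  refine ringHom_ext ?_ ?_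
  · intro r; simp
  · intro i; simp [qp]

lemma plane_hom {m : ℕ} (u1 u2 w : Fin m → ℚ) (f : MvPolynomial (Fin m) ℚ) (hf : f.IsHomogeneous 4) : (plane u1 u2 w f).IsHomogeneous 4 := by
  have := hf.aeval (fun i => C (u1 i) * X 0 + C (u2 i) * X 1 + C (w i) * X 2 : Fin m → MvPolynomial (Fin 3) ℚ) (n := 1) (fun i => by
    refine (IsHomogeneous.add ?_ ?_).add ?_ <;> exact (isHomogeneous_C_mul_X _ _))
  exact this

lemma eval_plane {m : ℕ} (u1 u2 w : Fin m → ℚ) (f : MvPolynomial (Fin m) ℚ) (y : Fin 3 → ℚ) :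
    eval y (plane u1 u2 w f) = eval (fun i => u1 i * y 0 + u2 i * y 1 + w i * y 2) f := by
  refine (hom_aeval (A := MvPolynomial (Fin 3) ℚ) (B := ℚ) (eval y) _ f).trans ?_
  rw [aeval_eq_eval]
  congr 2
  funext i
  simp

lemma slice_good {k : ℕ} (f : MvPolynomial (Fin (k+3)) ℤ) (hf : (toQ f).IsHomogeneous 4) (u1 u2 w τ : Fin (k+3) → ℤ)
    (hg : GoodPlane (toQ f) u1 u2 w) : Good (slice u1 u2 w τ f) := by
  have hT : TopF 4 (toQ (slice u1 u2 w τ f)) (plane (qp u1) (qp u2) (qp w) (toQ f)) := by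
    rw [toQ_slice]
    refine TopF.aeval _ _ (fun i => ?_) _ hf
    have h1 : ((C (qp u1 i) * X 0 + C (qp u2 i) * X 1 + C (qp w i) * X 2 : MvPolynomial (Fin 3) ℚ)).totalDegree ≤ 1 := lin3_deg (k := 0) _ _ _
    refine ⟨(totalDegree_add _ _).trans (max_le h1 (by simp)), h1, fun m hm => ?_⟩
    rw [coeff_add, coeff_C, if_neg, add_zero]
    rintro rfl
    simp at hm
  have hh := plane_hom (qp u1) (qp u2) (qp w) (toQ f) hf
  have hcomp : homogeneousComponent 4 (toQ (slice u1 u2 w τ f)) = plane (qp u1) (qp u2) (qp w) (toQ f) := by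
    rw [hT.comp, homComp_self hh]
  refine ⟨hT.hP, irr_of_top (by norm_num) _ _ hT hh hg.irr, by rw [hcomp]; exact hg.irr, fun i => ?_, by rw [hcomp]; exact hg.nc⟩
  rw [hT.low _ (by rw [Finsupp.degree_single]), ← eval_single _ hh, eval_plane]
  fin_cases i
  · refine fun h => hg.n1 (Eq.trans ?_ h); congr 2; funext l; simp
  · refine fun h => hg.n2 (Eq.trans ?_ h); congr 2; funext l; simp
  · refine fun h => hg.n3 (Eq.trans ?_ h); congr 2; funext l; simp

end DG


namespace DG
open MvPolynomial

/-- constant -/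
def KK : ℕ := 24 * 521 ^ 3

lemma mnr_bound {k : ℕ} (a b c : Fin (k+3) → ℤ) (A B E : ℤ) (hA : ∀ i, |a i| ≤ A) (hB : ∀ i, |b i| ≤ B) (hE : ∀ i, |c i| ≤ E) :
    |mnr a b c| ≤ 6 * (A * B * E) := by
  have hA0 : 0 ≤ A := (abs_nonneg _).trans (hA 0)
  have hB0 : 0 ≤ B := (abs_nonneg _).trans (hB 0)
  have h : ∀ i j l, |a i * b j * c l| ≤ A * B * E := by
    intro i j l
    rw [abs_mul, abs_mul]
    gcongr
    · exact hA i
    · exact hB j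
    · exact hE l
  have e1 := abs_le.1 (h 1 2 0)
  have e2 := abs_le.1 (h 2 1 0)
  have e3 := abs_le.1 (h 2 0 1)
  have e4 := abs_le.1 (h 0 2 1)
  have e5 := abs_le.1 (h 0 1 2)
  have e6 := abs_le.1 (h 1 0 2)
  have : mnr a b c = a 1 * b 2 * c 0 - a 2 * b 1 * c 0 + a 2 * b 0 * c 1 - a 0 * b 2 * c 1 + a 0 * b 1 * c 2 - a 1 * b 0 * c 2 := by
    unfold mnr; ring
  rw [this, abs_le]
  constructor <;> linarith [e1.1, e1.2, e2.1, e2.2, e3.1, e3.2, e4.1, e4.2, e5.1, e5.2, e6.1, e6.2]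

lemma fin3_cases {k : ℕ} (i : Fin (k+3)) : i = 0 ∨ i = 1 ∨ i = 2 ∨ ∃ j : Fin k, i = j.succ.succ.succ := by
  refine Fin.cases ?_ (fun i => ?_) i
  · exact Or.inl rfl
  refine Fin.cases ?_ (fun i => ?_) i
  · exact Or.inr (Or.inl rfl)
  refine Fin.cases ?_ (fun i => ?_) i
  · exact Or.inr (Or.inr (Or.inl rfl))
  · exact Or.inr (Or.inr (Or.inr ⟨i, rfl⟩))

lemma good_count (c κ : ℕ) (hA : ∀ g : MvPolynomial (Fin 3) ℤ, Good g → ∀ L, 1 ≤ L → ∀ S : Finset (Fin 3 → ℤ), (∀ x ∈ S, eval x g = 0 ∧ ∀ l, |x l| ≤ 4 ^ L) → S.card ≤ c * L ^ κ * 4 ^ L)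
    {k : ℕ} (f : MvPolynomial (Fin (k+3)) ℤ) (hf : (toQ f).IsHomogeneous 4) (hfz : f.IsHomogeneous 4) (u1 u2 w : Fin (k+3) → ℤ)
    (hg : GoodPlane (toQ f) u1 u2 w) (N L : ℕ) (hL : 1 ≤ L) (hN : KK * N ≤ 4 ^ L) (S : Finset (Fin (k+3) → ℤ))
    (hS : ∀ x ∈ S, eval x f = 0 ∧ ∀ i, |x i| ≤ N) : S.card ≤ c * L ^ κ * 4 ^ L * (2 * (KK * N) + 1) ^ k := by
  classical
  set δ := mnr u1 u2 w with hδ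
  let y : (Fin (k+3) → ℤ) → Fin 3 → ℤ := fun x => ![mnr x u2 w, mnr u1 x w, mnr u1 u2 x]
  let τ : (Fin (k+3) → ℤ) → (Fin (k+3) → ℤ) := fun x i => δ * x i - (u1 i * y x 0 + u2 i * y x 1 + w i * y x 2)
  have hτ0 : ∀ x, τ x 0 = 0 := by intro x; simp [τ, y, hδ, mnr]; ring
  have hτ1 : ∀ x, τ x 1 = 0 := by intro x; simp [τ, y, hδ, mnr]; ring
  have hτ2 : ∀ x, τ x 2 = 0 := by intro x; simp [τ, y, hδ, mnr]; ring
  have hyb : ∀ x ∈ S, ∀ j, |y x j| ≤ 6 * (521 * 521 * N) := by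
    intro x hx j
    have hx' := (hS x hx).2
    fin_cases j
    · refine (mnr_bound x u2 w N 521 521 hx' hg.b2 hg.b3).trans (le_of_eq (by ring))
    · refine (mnr_bound u1 x w 521 N 521 hg.b1 hx' hg.b3).trans (le_of_eq (by ring))
    · exact mnr_bound u1 u2 x 521 521 N hg.b1 hg.b2 hx'
  have hδb : |δ| ≤ 6 * (521 * 521 * 521) := mnr_bound u1 u2 w 521 521 521 hg.b1 hg.b2 hg.b3
  have hτb : ∀ x ∈ S, ∀ i, |τ x i| ≤ (KK * N : ℕ) := by
    intro x hx i
    have h1 : |δ * x i| ≤ 6 * (521 * 521 * 521) * N := by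
      rw [abs_mul]; exact mul_le_mul hδb ((hS x hx).2 i) (abs_nonneg _) (by norm_num)
    have h2 : ∀ (u : Fin (k+3) → ℤ) j, (∀ i, |u i| ≤ 521) → |u i * y x j| ≤ 521 * (6 * (521 * 521 * N)) := by
      intro u j hu
      rw [abs_mul]; exact mul_le_mul (hu i) (hyb x hx j) (abs_nonneg _) (by norm_num)
    have e1 := abs_le.1 h1
    have e2 := abs_le.1 (h2 u1 0 hg.b1)
    have e3 := abs_le.1 (h2 u2 1 hg.b2)
    have e4 := abs_le.1 (h2 w 2 hg.b3)
    simp only [τ, KK]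
    push_cast
    rw [abs_le]
    constructor <;> linarith [e1.1, e1.2, e2.1, e2.2, e3.1, e3.2, e4.1, e4.2]
  let t : (Fin (k+3) → ℤ) → (Fin k → ℤ) := fun x j => τ x j.succ.succ.succ
  have htτ : ∀ x x', t x = t x' → τ x = τ x' := by
    intro x x' h
    funext i
    rcases fin3_cases i with rfl | rfl | rfl | ⟨j, rfl⟩
    · rw [hτ0, hτ0]
    · rw [hτ1, hτ1]
    · rw [hτ2, hτ2]
    · exact congrFun h j
  let T : Finset (Fin k → ℤ) := Fintype.piFinset fun _ => Finset.Icc (-(KK * N : ℕ) : ℤ) (KK * N : ℕ)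
  have hTc : T.card = (2 * (KK * N) + 1) ^ k := by
    simp only [T, Fintype.card_piFinset, Int.card_Icc, Finset.prod_const, Finset.card_univ, Fintype.card_fin]
    congr 1
    omega
  rw [← hTc]
  refine Finset.card_le_mul_card_image_of_maps_to (f := t) (t := T) ?_ _ ?_
  · intro x hx
    rw [Fintype.mem_piFinset]
    intro j
    rw [Finset.mem_Icc]
    exact abs_le.1 (hτb x hx _)
  · intro b hb
    by_cases hne : (S.filter fun x => t x = b).Nonempty
    · obtain ⟨x0, hx0⟩ := hne
      rw [Finset.mem_filter] at hx0
      have hτeq : ∀ x ∈ S.filter (fun x => t x = b), τ x = τ x0 := fun x hx =>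
        htτ _ _ ((Finset.mem_filter.1 hx).2.trans hx0.2.symm)
      have hinj : Set.InjOn y (S.filter fun x => t x = b) := by
        intro x hx x' hx' hy
        have h1 := (hτeq x hx).trans (hτeq x' hx').symm
        funext i
        have h2 := congrFun h1 i
        simp only [τ, hy] at h2
        exact mul_left_cancel₀ hg.dt (sub_left_inj.1 h2)
      rw [← Finset.card_image_of_injOn hinj]
      refine hA (slice u1 u2 w (τ x0) f) (slice_good f hf u1 u2 w _ hg) L hL _ ?_
      intro z hz
      obtain ⟨x, hx, rfl⟩ := Finset.mem_image.1 hz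
      have hxS := (Finset.mem_filter.1 hx).1
      constructor
      · rw [eval_slice, ← hτeq x hx]
        have : (fun i => u1 i * y x 0 + u2 i * y x 1 + w i * y x 2 + τ x i) = fun i => δ * x i := by
          funext i; simp only [τ]; ring
        rw [this, hom_eval f hfz, (hS x hxS).1, mul_zero]
      · intro l
        refine (hyb x hxS l).trans ?_
        have h3 : ((KK * N : ℕ) : ℤ) ≤ ((4 ^ L : ℕ) : ℤ) := by exact_mod_cast hN
        have h4 : (0:ℤ) ≤ N := Int.natCast_nonneg _
        push_cast [KK] at h3
        linarith
    · rw [Finset.not_nonempty_iff_eq_empty.1 hne]; simp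

lemma binary_count {k : ℕ} (f : MvPolynomial (Fin (k+3)) ℤ) (hb : Binary (toQ f)) (N : ℕ) (S : Finset (Fin (k+3) → ℤ))
    (hS : ∀ x ∈ S, eval x f = 0 ∧ ∀ i, |x i| ≤ N) : S.card ≤ (2 * N + 1) ^ (k + 1) := by
  classical
  obtain ⟨u1, u2, l1, l2, h11, h12, h21, h22, hz⟩ := hb
  have hl : ∀ (l : (Fin (k+3) → ℚ) →ₗ[ℚ] ℚ) x, l x = ∑ i, x i * l (Pi.single i 1) := by
    intro l x
    rw [← eval_linF, linF, map_sum]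
    refine Finset.sum_congr rfl fun i _ => ?_
    rw [map_mul, eval_C, eval_X, mul_comm]
  set a : Fin (k+3) → ℚ := fun i => l1 (Pi.single i 1) with ha
  set b : Fin (k+3) → ℚ := fun i => l2 (Pi.single i 1) with hb
  have hmin : ∃ i j, a i * b j - a j * b i ≠ 0 := by
    by_contra! hcon
    have h1 : l1 u1 * l2 u2 - l2 u1 * l1 u2 = 0 := by
      rw [hl l1 u1, hl l2 u2, hl l2 u1, hl l1 u2, Finset.sum_mul_sum, Finset.sum_mul_sum, ← Finset.sum_sub_distrib]
      refine Finset.sum_eq_zero fun i _ => ?_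
      rw [← Finset.sum_sub_distrib]
      refine Finset.sum_eq_zero fun j _ => ?_
      have := hcon i j
      simp only [ha, hb] at this
      linear_combination u1 i * u2 j * this
    rw [h11, h12, h21, h22] at h1
    norm_num at h1
  obtain ⟨i, j, hij⟩ := hmin
  have hne : i ≠ j := by rintro rfl; apply hij; ring
  let ρ : (Fin (k+3) → ℤ) → ({l : Fin (k+3) // l ≠ i ∧ l ≠ j} → ℤ) := fun x l => x l.1
  have hinj : Set.InjOn ρ S := by
    intro x hx x' hx' h
    have zx := hz (qp x) ((eval_qp_zero x f).2 (hS x hx).1)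
    have zx' := hz (qp x') ((eval_qp_zero x' f).2 (hS x' hx').1)
    have hd : ∀ l, l ≠ i → l ≠ j → x l = x' l := fun l h1 h2 => congrFun h ⟨l, h1, h2⟩
    have hs : ∀ c : Fin (k+3) → ℚ, ∑ l, (qp x l - qp x' l) * c l = (qp x i - qp x' i) * c i + (qp x j - qp x' j) * c j := by
      intro c
      rw [Finset.sum_eq_add i j hne]
      · intro l _ hl
        simp [qp, hd l hl.1 hl.2]
      · simp
      · simp
    have e1 : (qp x i - qp x' i) * a i + (qp x j - qp x' j) * a j = 0 := by
      rw [← hs]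
      simp only [sub_mul, Finset.sum_sub_distrib, ha]
      rw [← hl, ← hl, zx.1, zx'.1, sub_zero]
    have e2 : (qp x i - qp x' i) * b i + (qp x j - qp x' j) * b j = 0 := by
      rw [← hs]
      simp only [sub_mul, Finset.sum_sub_distrib, hb]
      rw [← hl, ← hl, zx.2, zx'.2, sub_zero]
    have f1 : qp x i - qp x' i = 0 := by
      have : (qp x i - qp x' i) * (a i * b j - a j * b i) = 0 := by linear_combination b j * e1 - a j * e2
      exact (mul_eq_zero.1 this).resolve_right hij
    have f2 : qp x j - qp x' j = 0 := by
      have : (qp x j - qp x' j) * (a i * b j - a j * b i) = 0 := by linear_combination a i * e2 - b i * e1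
      exact (mul_eq_zero.1 this).resolve_right hij
    funext l
    by_cases h1 : l = i
    · subst h1; simp only [qp, sub_eq_zero] at f1; exact_mod_cast f1
    by_cases h2 : l = j
    · subst h2; simp only [qp, sub_eq_zero] at f2; exact_mod_cast f2
    exact hd l h1 h2
  let T : Finset ({l : Fin (k+3) // l ≠ i ∧ l ≠ j} → ℤ) := Fintype.piFinset fun _ => Finset.Icc (-(N:ℤ)) N
  have hcard : Fintype.card {l : Fin (k+3) // l ≠ i ∧ l ≠ j} = k + 1 := by
    rw [Fintype.card_of_subtype ((Finset.univ.erase i).erase j) (by intro l; simp [and_comm])]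
    rw [Finset.card_erase_of_mem (by simp [hne.symm]), Finset.card_erase_of_mem (Finset.mem_univ _)]
    simp
  have hTc : T.card = (2 * N + 1) ^ (k+1) := by
    simp only [T, Fintype.card_piFinset, Int.card_Icc, Finset.prod_const, Finset.card_univ, hcard]
    congr 1
    omega
  rw [← hTc, ← Finset.card_image_of_injOn hinj]
  refine Finset.card_le_card fun z hz => ?_
  obtain ⟨x, hx, rfl⟩ := Finset.mem_image.1 hz
  rw [Fintype.mem_piFinset]
  intro l
  rw [Finset.mem_Icc]
  exact abs_le.1 ((hS x hx).2 _)

theorem count_final : ∃ κ : ℕ, ∀ k : ℕ, ∃ C : ℝ, ∀ f : MvPolynomial (Fin (k+3)) ℤ, f.IsHomogeneous 4 → Irreducible (toQ f) →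
    ∀ (H : ℝ), 2 ≤ H → ∀ S : Finset (Fin (k+3) → ℤ), (∀ x ∈ S, eval x f = 0 ∧ ∀ i, (|x i| : ℝ) ≤ H) →
      (S.card : ℝ) ≤ C * H ^ (k+1) * Real.log H ^ κ := by
  obtain ⟨c, κ, hA⟩ := claimA
  refine ⟨κ, fun k => ?_⟩
  set C' : ℝ := (Real.log KK + 1) / Real.log 2 + 1 with hC'
  have hlog2 : 0 < Real.log 2 := Real.log_pos (by norm_num)
  have hKK : (1:ℝ) ≤ KK := by norm_num [KK]
  have hKlog : 0 ≤ Real.log KK := Real.log_nonneg hKK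
  have hC'0 : 0 ≤ C' := by positivity
  refine ⟨c * C' ^ κ * (4 * KK) * (3 * KK) ^ k + 3 ^ (k+1) * (Real.log 2)⁻¹ ^ κ, ?_⟩
  intro f hf hirr H hH S hS
  have hf' : (toQ f).IsHomogeneous 4 := hf.map _
  have hH0 : 0 ≤ H := by linarith
  have hlogH : Real.log 2 ≤ Real.log H := Real.log_le_log (by norm_num) hH
  have hlogH0 : 0 < Real.log H := hlog2.trans_le hlogH
  set N := ⌊H⌋₊ with hN
  have hNH : (N:ℝ) ≤ H := Nat.floor_le hH0
  have hN2 : 2 ≤ N := Nat.le_floor (by exact_mod_cast hH)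
  have hS' : ∀ x ∈ S, eval x f = 0 ∧ ∀ i, |x i| ≤ N := by
    intro x hx
    refine ⟨(hS x hx).1, fun i => ?_⟩
    have h1 := (hS x hx).2 i
    have h2 : ((x i).natAbs : ℝ) ≤ H := by rw [Nat.cast_natAbs, Int.cast_abs]; exact h1
    have h3 := Nat.le_floor h2
    rw [Int.abs_eq_natAbs]
    exact_mod_cast h3
  have t1 : 0 ≤ c * C' ^ κ * (4 * KK) * (3 * KK) ^ k * H ^ (k+1) * Real.log H ^ κ := by positivity
  have t2 : 0 ≤ 3 ^ (k+1) * (Real.log 2)⁻¹ ^ κ * H ^ (k+1) * Real.log H ^ κ := by positivity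
  have goal' : (S.card : ℝ) ≤ c * C' ^ κ * (4 * KK) * (3 * KK) ^ k * H ^ (k+1) * Real.log H ^ κ ∨
      (S.card : ℝ) ≤ 3 ^ (k+1) * (Real.log 2)⁻¹ ^ κ * H ^ (k+1) * Real.log H ^ κ := by
    rcases geo (toQ f) hf' hirr with hb | ⟨u1, u2, w, hg⟩
    · right
      have h1 := binary_count f hb N S hS'
      have h2 : (S.card : ℝ) ≤ (2 * N + 1) ^ (k+1) := by exact_mod_cast h1
      have h3 : (2 * N + 1 : ℝ) ≤ 3 * H := by linarith
      have h4 : (2 * N + 1 : ℝ) ^ (k+1) ≤ (3 * H) ^ (k+1) := by gcongr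
      have h5 : 1 ≤ ((Real.log 2)⁻¹ * Real.log H) ^ κ := by
        refine one_le_pow₀ ?_
        rw [inv_mul_eq_div, le_div_iff₀ hlog2, one_mul]; exact hlogH
      calc (S.card : ℝ) ≤ (3 * H) ^ (k+1) * 1 := by rw [mul_one]; exact h2.trans h4
        _ ≤ (3 * H) ^ (k+1) * ((Real.log 2)⁻¹ * Real.log H) ^ κ := by gcongr
        _ = _ := by rw [mul_pow, mul_pow]; ring
    · left
      set L := Nat.clog 4 (KK * N) with hL
      have hKN1 : 1 < KK * N := by
        have : 1 ≤ KK := by norm_num [KK]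
        nlinarith
      have hL1 : 1 ≤ L := Nat.clog_pos (by norm_num) hKN1
      have h0 := good_count c κ hA f hf' hf u1 u2 w hg N L hL1 (Nat.le_pow_clog (by norm_num) _) S hS'
      have h1 : 4 ^ (L - 1) < KK * N := Nat.pow_pred_clog_lt_self (by norm_num) hKN1
      have h1' : (4:ℝ) ^ (L - 1) ≤ KK * H := by
        have : ((4 ^ (L-1) : ℕ) : ℝ) ≤ ((KK * N : ℕ) : ℝ) := by exact_mod_cast h1.le
        push_cast at this
        exact this.trans (by gcongr)
      have h2 : (4:ℝ) ^ L ≤ 4 * KK * H := by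
        have : (4:ℝ) ^ L = 4 * 4 ^ (L-1) := by rw [← pow_succ', Nat.sub_add_cancel hL1]
        rw [this, mul_assoc]
        gcongr
      have h3 : (L : ℝ) ≤ C' * Real.log H := by
        have e1 : Real.log ((4:ℝ) ^ (L-1)) ≤ Real.log (KK * H) := Real.log_le_log (by positivity) h1'
        rw [Real.log_pow, Real.log_mul (by positivity) (by positivity)] at e1
        have e2 : (1:ℝ) ≤ Real.log 4 := by
          rw [Real.le_log_iff_exp_le (by norm_num)]
          exact (Real.exp_one_lt_d9.le).trans (by norm_num)
        have e3 : ((L - 1 : ℕ) : ℝ) = L - 1 := by push_cast [Nat.cast_sub hL1]; ring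
        have e4 : ((L - 1 : ℕ) : ℝ) ≤ (L - 1 : ℕ) * Real.log 4 := le_mul_of_one_le_right (Nat.cast_nonneg _) e2
        rw [e3] at e1 e4
        have e5 : Real.log KK + 1 ≤ (Real.log KK + 1) / Real.log 2 * Real.log H := by
          rw [div_mul_eq_mul_div, le_div_iff₀ hlog2]
          gcongr
        rw [hC', add_mul, one_mul]
        linarith
      have h4 : (2 * (KK * N) + 1 : ℝ) ≤ 3 * KK * H := by
        have : (KK:ℝ) * N ≤ KK * H := by gcongr
        have : (1:ℝ) ≤ KK * H := by nlinarith
        linarith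
      have h5 : (S.card : ℝ) ≤ c * L ^ κ * 4 ^ L * (2 * (KK * N) + 1) ^ k := by exact_mod_cast h0
      calc (S.card : ℝ) ≤ c * L ^ κ * 4 ^ L * (2 * (KK * N) + 1) ^ k := h5
        _ ≤ c * (C' * Real.log H) ^ κ * (4 * KK * H) * (3 * KK * H) ^ k := by gcongr
        _ = _ := by rw [mul_pow, mul_pow (3 * (KK:ℝ)) H, pow_succ]; ring
  rw [add_mul, add_mul]
  rcases goal' with h | h <;> linarith

end DG

theorem dimension_growth_projective_deg_four :
    ∃ κ : ℝ, ∀ n : ℕ, 2 < n → ∃ c : ℝ,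
      ∀ (f : MvPolynomial (Fin (n + 1)) ℤ) (d : ℕ),
      f.IsHomogeneous d → d = 4 →
      Irreducible (MvPolynomial.map (Int.castRingHom ℚ) f) →
      ∀ H : ℝ, 2 ≤ H →
      ∀ S : Set (Projectivization ℚ (Fin (n + 1) → ℚ)),
        S = {p | ∃ (x : Fin (n + 1) → ℤ) (hx : (fun i => (x i : ℚ)) ≠ 0),
              Projectivization.mk ℚ (fun i => (x i : ℚ)) hx = p ∧
              Finset.univ.gcd x = 1 ∧
              MvPolynomial.eval x f = 0 ∧
              ∀ i, (|x i| : ℝ) ≤ H} →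
        S.Finite ∧ (S.ncard : ℝ) ≤ c * H ^ ((n : ℝ) - 1) * Real.log H ^ κ := by
  classical
  obtain ⟨κ, hκ⟩ := DG.count_final
  refine ⟨κ, fun n hn => ?_⟩
  obtain ⟨k, rfl⟩ : ∃ k, n = k + 2 := ⟨n - 2, by omega⟩
  obtain ⟨C, hC⟩ := hκ k
  refine ⟨C, ?_⟩
  intro f d hf hd hirr H hH S hS
  subst hd
  set T : Finset (Fin (k + 2 + 1) → ℤ) := (Fintype.piFinset fun _ => Finset.Icc (-(⌊H⌋₊ : ℤ)) ⌊H⌋₊).filter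
    (fun x => MvPolynomial.eval x f = 0 ∧ ∀ i, (|x i| : ℝ) ≤ H) with hT
  have h1 := hC f hf hirr H hH T (fun x hx => (Finset.mem_filter.1 hx).2)
  let φ : (Fin (k + 2 + 1) → ℤ) → Projectivization ℚ (Fin (k + 2 + 1) → ℚ) := fun x =>
    if hx : (fun i => (x i : ℚ)) ≠ 0 then Projectivization.mk ℚ (fun i => (x i : ℚ)) hx else Classical.arbitrary _
  have hsub : S ⊆ φ '' (T : Set (Fin (k + 2 + 1) → ℤ)) := by
    rw [hS]
    rintro p ⟨x, hx, rfl, -, hx0, hxH⟩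
    refine ⟨x, ?_, ?_⟩
    · rw [Finset.mem_coe, hT, Finset.mem_filter]
      refine ⟨?_, hx0, hxH⟩
      rw [Fintype.mem_piFinset]
      intro i
      rw [Finset.mem_Icc, ← abs_le]
      have h2 : ((x i).natAbs : ℝ) ≤ H := by rw [Nat.cast_natAbs, Int.cast_abs]; exact hxH i
      have h3 := Nat.le_floor h2
      rw [Int.abs_eq_natAbs]
      exact_mod_cast h3
    · simp only [φ]; rw [dif_pos hx]
  have hfin : (φ '' (T : Set (Fin (k + 2 + 1) → ℤ))).Finite := T.finite_toSet.image φ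
  refine ⟨hfin.subset hsub, ?_⟩
  have h2 : S.ncard ≤ T.card := by
    refine (Set.ncard_le_ncard hsub hfin).trans ((Set.ncard_image_le T.finite_toSet).trans ?_)
    rw [Set.ncard_coe_finset]
  have h3 : H ^ (((k + 2 : ℕ) : ℝ) - 1) = H ^ (k + 1) := by
    rw [← Real.rpow_natCast]; congr 1; push_cast; ring
  rw [h3, Real.rpow_natCast]
  exact (Nat.cast_le.2 h2).trans h1
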